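/- Honeycomb conjecture for disconnected regions. Let K be a compact set in ℝ² containing pairwise disjoint measurable sets R₁, R₂, … such that each frontier ∂Rᵢ has finite 1-dimensional Hausdorff measure. Set αᵢ = min(1, vol(Rᵢ)) and Γ = ⋃ᵢ ∂Rᵢ, and assume αᵢ > 0 for some i. Then ℋ¹(Γ) > 12^(1/4) · Σᵢ αᵢ. -/

import Mathlib

open scoped ZMod ComplexConjugate

theorem zmod_parseval {n : ℕ} [NeZero n] (f : ZMod n → ℂ) :
    ∑ k, ‖𝓕 f k‖ ^ 2 = n * ∑ k, ‖f k‖ ^ 2 := by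
  have key : ∑ k, conj (𝓕 f k) * 𝓕 f k = n * ∑ k, conj (f k) * f k := by
    have h2 (j : ZMod n) : ∑ k, conj (𝓕 f k) * ZMod.stdAddChar (-(j * k)) = n * conj (f j) := by
      have h1 := congrFun (ZMod.dft_dft f) (-j)
      rw [ZMod.dft_apply, neg_neg] at h1
      rw [← map_natCast (starRingEnd ℂ) n, ← map_mul, ← smul_eq_mul, ← h1, map_sum]
      refine Finset.sum_congr rfl fun k _ => ?_
      rw [smul_eq_mul, map_mul, mul_comm]
      congr 1
      rw [ZMod.stdAddChar_apply, ZMod.stdAddChar_apply, ← Circle.coe_inv_eq_conj,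
        ← AddChar.map_neg_eq_inv]
      congr 2
      ring
    calc ∑ k, conj (𝓕 f k) * 𝓕 f k
        = ∑ k, ∑ j, (conj (𝓕 f k) * ZMod.stdAddChar (-(j * k))) * f j := by
          refine Finset.sum_congr rfl fun k _ => ?_
          nth_rewrite 2 [ZMod.dft_apply]
          rw [Finset.mul_sum]
          simp_rw [smul_eq_mul, mul_assoc]
      _ = ∑ j, (n * conj (f j)) * f j := by
          rw [Finset.sum_comm]
          simp_rw [← Finset.sum_mul, h2]
      _ = _ := by rw [Finset.mul_sum]; simp_rw [mul_assoc]
  have h3 (z : ℂ) : conj z * z = ((‖z‖ ^ 2 : ℝ) : ℂ) := by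
    rw [mul_comm, Complex.mul_conj, Complex.normSq_eq_norm_sq]
  simp_rw [h3] at key
  exact_mod_cast key

theorem zmod_norm_stdAddChar_sub_one {n : ℕ} [NeZero n] (k : ZMod n) (hk : k ≠ 0) :
    2 * Real.sin (Real.pi / n) ≤ ‖ZMod.stdAddChar k - 1‖ := by
  have hn : (0 : ℝ) < n := by exact_mod_cast NeZero.pos n
  have h0 : 0 < k.val := by
    rw [Nat.pos_iff_ne_zero]; simpa using hk
  have h1 : k.val + 1 ≤ n := k.val_lt
  have e : ZMod.stdAddChar k = Complex.exp (Complex.I * ((2 * (Real.pi * k.val / n) : ℝ) : ℂ)) := by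
    have := ZMod.stdAddChar_coe (N := n) (k.val : ℤ)
    rw [Int.cast_natCast, ZMod.natCast_zmod_val] at this
    rw [this]
    congr 1
    push_cast
    ring
  rw [e, Complex.norm_exp_I_mul_ofReal_sub_one, mul_div_cancel_left₀ _ two_ne_zero, norm_mul]
  have h0' : (1 : ℝ) ≤ k.val := by exact_mod_cast h0
  have h1' : (k.val : ℝ) + 1 ≤ n := by exact_mod_cast h1
  have hpi := Real.pi_pos
  simp only [Real.norm_eq_abs, Nat.abs_ofNat]
  refine mul_le_mul_of_nonneg_left (le_trans ?_ (le_abs_self _)) zero_le_two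
  have a1 : Real.pi / n ≤ Real.pi * k.val / n := by
    gcongr; nlinarith
  have a2 : Real.pi * k.val / n ≤ Real.pi - Real.pi / n := by
    rw [div_le_iff₀ hn, sub_mul, div_mul_cancel₀ _ hn.ne']; nlinarith
  have a3 : 0 < Real.pi / n := by positivity
  rcases le_total (Real.pi * k.val / n) (Real.pi / 2) with h | h
  · exact Real.sin_le_sin_of_le_of_le_pi_div_two (by linarith) h a1
  · rw [← Real.sin_pi_sub (Real.pi * k.val / n)]
    exact Real.sin_le_sin_of_le_of_le_pi_div_two (by linarith) (by linarith) (by linarith)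

theorem zmod_dft_shift {n : ℕ} [NeZero n] (f : ZMod n → ℂ) (k : ZMod n) :
    𝓕 (fun j => f (j + 1) - f j) k = (ZMod.stdAddChar k - 1) * 𝓕 f k := by
  simp only [ZMod.dft_apply, smul_eq_mul, mul_sub, Finset.sum_sub_distrib, sub_mul, one_mul]
  congr 1
  rw [Finset.mul_sum, ← Equiv.sum_comp (Equiv.addRight (1 : ZMod n))
    (fun j => ZMod.stdAddChar k * (ZMod.stdAddChar (-(j * k)) * f j))]
  refine Finset.sum_congr rfl fun j _ => ?_
  rw [← mul_assoc, ← AddChar.map_add_eq_mul]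
  simp only [Equiv.coe_addRight]
  congr 2
  ring

theorem zmod_wirtinger {n : ℕ} [NeZero n] (f : ZMod n → ℂ) (hf : ∑ k, f k = 0) :
    4 * Real.sin (Real.pi / n) ^ 2 * ∑ k, ‖f k‖ ^ 2 ≤ ∑ k, ‖f (k + 1) - f k‖ ^ 2 := by
  have hn : (0 : ℝ) < n := by exact_mod_cast NeZero.pos n
  have hs : 0 ≤ Real.sin (Real.pi / n) := by
    apply Real.sin_nonneg_of_nonneg_of_le_pi
    · positivity
    · apply div_le_self Real.pi_pos.le
      exact_mod_cast NeZero.pos n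
  have h1 := zmod_parseval f
  have h2 := zmod_parseval (fun j => f (j + 1) - f j)
  refine le_of_mul_le_mul_left ?_ hn
  rw [← h2, mul_left_comm, ← h1, Finset.mul_sum]
  refine Finset.sum_le_sum fun k _ => ?_
  rw [zmod_dft_shift, norm_mul, mul_pow]
  by_cases hk : k = 0
  · subst hk
    rw [ZMod.dft_apply_zero, hf]; simp
  · have := zmod_norm_stdAddChar_sub_one k hk
    refine mul_le_mul_of_nonneg_right ?_ (by positivity)
    nlinarith

theorem discrete_wirtinger {n : ℕ} (hn : n ≠ 0) (f : ℕ → ℂ) (hc : f n = f 0)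
    (hf : ∑ k ∈ Finset.range n, f k = 0) :
    4 * Real.sin (Real.pi / n) ^ 2 * ∑ k ∈ Finset.range n, ‖f k‖ ^ 2
      ≤ ∑ k ∈ Finset.range n, ‖f (k + 1) - f k‖ ^ 2 := by
  obtain ⟨m, rfl⟩ := Nat.exists_eq_succ_of_ne_zero hn
  have hv (k : ZMod (m + 1)) : f (k + 1).val = f (k.val + 1) := by
    have h0 := Fin.val_add_one (n := m) k
    split_ifs at h0 with h
    · have h2 : k.val = m := congrArg Fin.val h
      rw [h2]
      exact (congrArg f h0).trans hc.symm
    · exact congrArg f h0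
  have hs (g : ℕ → ℝ) : ∑ k ∈ Finset.range (m + 1), g k = ∑ k : ZMod (m + 1), g k.val :=
    Finset.sum_range g
  have hs' : ∑ k ∈ Finset.range (m + 1), f k = ∑ k : ZMod (m + 1), f k.val :=
    Finset.sum_range f
  have := zmod_wirtinger (n := m + 1) (fun k => f k.val) (by rw [← hs', hf])
  simp only [hv] at this
  rw [hs (fun k => ‖f k‖ ^ 2), hs (fun k => ‖f (k + 1) - f k‖ ^ 2)]
  exact this

/-- The planar cross product of two complex numbers. -/
def crossp (a b : ℂ) : ℝ := a.re * b.im - a.im * b.re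

/-- The signed area swept from the origin by the polygonal path with the given edge vectors. -/
noncomputable def larea : List ℂ → ℝ
  | [] => 0
  | a :: l => larea l + crossp a l.sum / 2

/-- The length of the polygonal path with the given edge vectors. -/
noncomputable def llen (l : List ℂ) : ℝ := (l.map norm).sum

theorem crossp_add_left (a b c : ℂ) : crossp (a + b) c = crossp a c + crossp b c := by
  simp [crossp]; ring

theorem crossp_add_right (a b c : ℂ) : crossp a (b + c) = crossp a b + crossp a c := by
  simp [crossp]; ring

@[simp] theorem crossp_zero_left (a : ℂ) : crossp 0 a = 0 := by simp [crossp]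
@[simp] theorem crossp_zero_right (a : ℂ) : crossp a 0 = 0 := by simp [crossp]
@[simp] theorem crossp_self (a : ℂ) : crossp a a = 0 := by simp [crossp, mul_comm]

theorem crossp_neg_left (a b : ℂ) : crossp (-a) b = -crossp a b := by simp [crossp]; ring
theorem crossp_neg_right (a b : ℂ) : crossp a (-b) = -crossp a b := by simp [crossp]; ring
theorem crossp_comm (a b : ℂ) : crossp a b = -crossp b a := by simp [crossp]; ring

theorem crossp_mul (z a b : ℂ) : crossp (z * a) (z * b) = ‖z‖ ^ 2 * crossp a b := by
  rw [← Complex.normSq_eq_norm_sq, Complex.normSq_apply]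
  simp [crossp]; ring

theorem crossp_sq_add_dot_sq (a b : ℂ) :
    crossp a b ^ 2 + (a.re * b.re + a.im * b.im) ^ 2 = ‖a‖ ^ 2 * ‖b‖ ^ 2 := by
  simp only [← Complex.normSq_eq_norm_sq, Complex.normSq_apply, crossp]; ring

theorem abs_crossp_le (a b : ℂ) : |crossp a b| ≤ ‖a‖ * ‖b‖ := by
  apply abs_le_of_sq_le_sq _ (by positivity)
  nlinarith [crossp_sq_add_dot_sq a b, sq_nonneg (a.re * b.re + a.im * b.im)]

theorem crossp_le (a b : ℂ) : crossp a b ≤ ‖a‖ * ‖b‖ := (le_abs_self _).trans (abs_crossp_le a b)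

theorem norm_add_sq_complex (a b : ℂ) :
    ‖a + b‖ ^ 2 = ‖a‖ ^ 2 + ‖b‖ ^ 2 + 2 * (a.re * b.re + a.im * b.im) := by
  simp only [← Complex.normSq_eq_norm_sq, Complex.normSq_apply]; simp; ring

theorem continuous_crossp : Continuous fun p : ℂ × ℂ => crossp p.1 p.2 := by
  unfold crossp; fun_prop

@[simp] theorem larea_nil : larea [] = 0 := rfl
theorem larea_cons (a : ℂ) (l : List ℂ) : larea (a :: l) = larea l + crossp a l.sum / 2 := rfl
@[simp] theorem larea_singleton (a : ℂ) : larea [a] = 0 := by simp [larea_cons]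
@[simp] theorem llen_nil : llen [] = 0 := rfl
@[simp] theorem llen_cons (a : ℂ) (l : List ℂ) : llen (a :: l) = ‖a‖ + llen l := by simp [llen]
@[simp] theorem llen_append (l m : List ℂ) : llen (l ++ m) = llen l + llen m := by simp [llen]

theorem llen_nonneg (l : List ℂ) : 0 ≤ llen l :=
  List.sum_nonneg (by simp)

theorem norm_sum_le_llen (l : List ℂ) : ‖l.sum‖ ≤ llen l := by
  induction l with
  | nil => simp
  | cons a l ih => simp only [List.sum_cons, llen_cons]; exact (norm_add_le _ _).trans (by gcongr)

theorem larea_append (l m : List ℂ) :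
    larea (l ++ m) = larea l + larea m + crossp l.sum m.sum / 2 := by
  induction l with
  | nil => simp
  | cons a l ih =>
    simp only [List.cons_append, larea_cons, ih, List.sum_append, List.sum_cons, crossp_add_left,
      crossp_add_right]
    ring

theorem larea_map_mul (z : ℂ) (l : List ℂ) : larea (l.map (z * ·)) = ‖z‖ ^ 2 * larea l := by
  induction l with
  | nil => simp
  | cons a l ih =>
    rw [List.map_cons, larea_cons, larea_cons, ih, List.sum_map_mul_left, crossp_mul]
    simp; ring

theorem llen_map_mul (z : ℂ) (l : List ℂ) : llen (l.map (z * ·)) = ‖z‖ * llen l := by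
  simp [llen, Function.comp_def, List.sum_map_mul_left]

theorem larea_reverse (l : List ℂ) : larea l.reverse = -larea l := by
  induction l with
  | nil => simp
  | cons a l ih =>
    rw [List.reverse_cons, larea_append, ih, larea_cons]
    simp [crossp_comm l.sum a, larea_cons]; ring

@[simp] theorem llen_reverse (l : List ℂ) : llen l.reverse = llen l := by
  simp [llen]

theorem larea_map_neg (l : List ℂ) : larea (l.map (-·)) = larea l := by
  have := larea_map_mul (-1) l
  simpa using this

@[simp] theorem llen_map_neg (l : List ℂ) : llen (l.map (-·)) = llen l := by
  have := llen_map_mul (-1) l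
  simpa using this

theorem sum_map_neg (l : List ℂ) : (l.map (-·)).sum = -l.sum := by
  simp [List.sum_neg]

theorem larea_eq_sum (l : List ℂ) :
    larea l = ∑ k ∈ Finset.range l.length, crossp (l.take k).sum (l.take (k + 1)).sum / 2 := by
  induction l with
  | nil => simp
  | cons a l ih =>
    rw [larea_cons, ih, List.length_cons, Finset.sum_range_succ']
    simp only [List.take_succ_cons, List.sum_cons, List.take_zero, List.sum_nil, crossp_zero_left,
      zero_div, add_zero, crossp_add_left, crossp_add_right, crossp_self, zero_add]
    have h : crossp a l.sum / 2 = ∑ k ∈ Finset.range l.length,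
        (crossp a (l.take (k + 1)).sum / 2 - crossp a (l.take k).sum / 2) := by
      rw [Finset.sum_range_sub (fun k => crossp a (l.take k).sum / 2)]
      simp
    rw [h, ← Finset.sum_add_distrib]
    refine Finset.sum_congr rfl fun k _ => ?_
    rw [crossp_comm (l.take k).sum a]
    ring

theorem tan_mul_larea_le_sum_sq {l : List ℂ} (h0 : l.sum = 0) (hn : 3 ≤ l.length) :
    4 * Real.tan (Real.pi / l.length) * larea l ≤ (l.map (‖·‖ ^ 2)).sum := by
  set n := l.length with hnd
  have hn0 : (n : ℝ) ≠ 0 := by positivity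
  have hn3 : (3 : ℝ) ≤ n := by exact_mod_cast hn
  set c : ℂ := (∑ k ∈ Finset.range n, (l.take k).sum) / n with hc
  set f : ℕ → ℂ := fun k => (l.take k).sum - c with hf
  have hcl : f n = f 0 := by simp [hf, hnd, h0]
  have hmean : ∑ k ∈ Finset.range n, f k = 0 := by
    simp only [hf, Finset.sum_sub_distrib, Finset.sum_const, Finset.card_range, nsmul_eq_mul, hc]
    rw [mul_div_cancel₀ _ (by exact_mod_cast hn0), sub_self]
  have hw := discrete_wirtinger (by omega : n ≠ 0) f hcl hmean
  have hA : larea l = ∑ k ∈ Finset.range n, crossp (f k) (f (k + 1)) / 2 := by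
    rw [larea_eq_sum]
    have h : ∑ k ∈ Finset.range n,
        (crossp c (l.take (k + 1)).sum / 2 - crossp c (l.take k).sum / 2) = 0 := by
      rw [Finset.sum_range_sub (fun k => crossp c (l.take k).sum / 2)]
      simp [hnd, h0]
    rw [← sub_eq_zero, ← h, ← Finset.sum_sub_distrib]
    refine Finset.sum_congr rfl fun k _ => ?_
    simp only [hf, crossp]
    simp
    ring
  have hE : (l.map (‖·‖ ^ 2)).sum = ∑ k ∈ Finset.range n, ‖f (k + 1) - f k‖ ^ 2 := by
    have : ∀ m : List ℂ, (m.map (‖·‖ ^ 2)).sum =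
        ∑ k ∈ Finset.range m.length, ‖(m.take (k + 1)).sum - (m.take k).sum‖ ^ 2 := by
      intro m
      induction m with
      | nil => simp
      | cons a m ih => simp [Finset.sum_range_succ', ih, add_comm]
    rw [this]
    simp [hf, hnd]
  have hpos : 0 < Real.pi / n := by positivity
  have hlt : Real.pi / n < Real.pi / 2 := by
    apply div_lt_div_of_pos_left Real.pi_pos two_pos; linarith
  have hcos : 0 < Real.cos (Real.pi / n) := Real.cos_pos_of_mem_Ioo ⟨by linarith, hlt⟩
  have hsin : 0 < Real.sin (Real.pi / n) := Real.sin_pos_of_pos_of_lt_pi hpos (by linarith)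
  have ht : Real.tan (Real.pi / n) = Real.sin (Real.pi / n) / Real.cos (Real.pi / n) :=
    Real.tan_eq_sin_div_cos _
  set t := Real.tan (Real.pi / n) with htd
  have hZ : ∑ k ∈ Finset.range n, ‖f (k + 1)‖ ^ 2 = ∑ k ∈ Finset.range n, ‖f k‖ ^ 2 := by
    have := Finset.sum_range_sub (fun k => ‖f k‖ ^ 2) n
    rw [Finset.sum_sub_distrib, hcl, sub_self] at this
    linarith
  have hpt (k : ℕ) : 4 * t * crossp (f k) (f (k + 1)) ≤
      t ^ 2 * (2 * ‖f k‖ ^ 2 + 2 * ‖f (k + 1)‖ ^ 2 - ‖f (k + 1) - f k‖ ^ 2)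
        + ‖f (k + 1) - f k‖ ^ 2 := by
    have e1 : crossp (f k) (f (k + 1)) = crossp (f k + f (k + 1)) (f (k + 1) - f k) / 2 := by
      simp [crossp]; ring
    have e2 : ‖f k + f (k + 1)‖ ^ 2 =
        2 * ‖f k‖ ^ 2 + 2 * ‖f (k + 1)‖ ^ 2 - ‖f (k + 1) - f k‖ ^ 2 := by
      simp only [← Complex.normSq_eq_norm_sq, Complex.normSq_apply]; simp; ring
    have e3 := crossp_le (f k + f (k + 1)) (f (k + 1) - f k)
    have ht0 : 0 ≤ t := by rw [ht]; positivity
    rw [← e2, e1]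
    nlinarith [sq_nonneg (t * ‖f k + f (k + 1)‖ - ‖f (k + 1) - f k‖),
      mul_le_mul_of_nonneg_left e3 ht0]
  have hsum := Finset.sum_le_sum fun k (_ : k ∈ Finset.range n) => hpt k
  rw [Finset.sum_add_distrib, ← Finset.mul_sum, ← Finset.mul_sum, Finset.sum_sub_distrib,
    Finset.sum_add_distrib, ← Finset.mul_sum, ← Finset.mul_sum, hZ, ← hE] at hsum
  rw [← hE] at hw
  rw [← Finset.sum_div] at hA
  have hts : t ^ 2 * (4 * ∑ k ∈ Finset.range n, ‖f k‖ ^ 2) ≤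
      (1 + t ^ 2) * (l.map (‖·‖ ^ 2)).sum := by
    have h1 : 1 + t ^ 2 = 1 / Real.cos (Real.pi / n) ^ 2 := by
      rw [ht]; field_simp; rw [Real.cos_sq_add_sin_sq]
    have h2 : t ^ 2 = Real.sin (Real.pi / n) ^ 2 / Real.cos (Real.pi / n) ^ 2 := by
      rw [ht]; field_simp
    rw [h1, h2, div_mul_eq_mul_div, div_mul_eq_mul_div, one_mul]
    gcongr
    linarith
  rw [hA]
  linarith

theorem exists_isosceles (a c : ℂ) (hac : ‖a‖ ≠ ‖c‖) :
    ∃ a' c' : ℂ, a' + c' = a + c ∧ ‖a'‖ + ‖c'‖ = ‖a‖ + ‖c‖ ∧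
      ‖a'‖ ^ 2 + ‖c'‖ ^ 2 < ‖a‖ ^ 2 + ‖c‖ ^ 2 ∧ crossp a c ≤ crossp a' c' := by
  have hb : a + c ≠ 0 := by
    intro h
    rw [eq_neg_of_add_eq_zero_left h, norm_neg] at hac
    exact hac rfl
  set b := a + c with hbd
  have hb0 : 0 < ‖b‖ := norm_pos_iff.mpr hb
  set s := (‖a‖ + ‖c‖) / 2 with hs
  have hbs : ‖b‖ ≤ 2 * s := by rw [hs]; linarith [norm_add_le a c]
  set h := √(s ^ 2 - ‖b‖ ^ 2 / 4) with hh
  have hh2 : h ^ 2 = s ^ 2 - ‖b‖ ^ 2 / 4 := Real.sq_sqrt (by nlinarith)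
  have hh0 : 0 ≤ h := Real.sqrt_nonneg _
  have hs0 : 0 ≤ s := by positivity
  set r : ℝ := h / ‖b‖ with hr
  have hrb : r * ‖b‖ = h := div_mul_cancel₀ _ hb0.ne'
  have hre : ‖b‖ ^ 2 = b.re * b.re + b.im * b.im := by
    rw [← Complex.normSq_eq_norm_sq, Complex.normSq_apply]
  have n1 : ‖(1 / 2 - r * Complex.I) * b‖ = s := by
    rw [← sq_eq_sq₀ (norm_nonneg _) hs0, norm_mul, mul_pow]
    have : ‖(1 / 2 - r * Complex.I : ℂ)‖ ^ 2 = 1 / 4 + r ^ 2 := by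
      rw [← Complex.normSq_eq_norm_sq, Complex.normSq_apply]; simp; ring
    rw [this, add_mul, ← mul_pow, hrb, hh2]; ring
  have n2 : ‖(1 / 2 + r * Complex.I) * b‖ = s := by
    rw [← sq_eq_sq₀ (norm_nonneg _) hs0, norm_mul, mul_pow]
    have : ‖(1 / 2 + r * Complex.I : ℂ)‖ ^ 2 = 1 / 4 + r ^ 2 := by
      rw [← Complex.normSq_eq_norm_sq, Complex.normSq_apply]; simp; ring
    rw [this, add_mul, ← mul_pow, hrb, hh2]; ring
  refine ⟨(1 / 2 - r * Complex.I) * b, (1 / 2 + r * Complex.I) * b, by ring, ?_, ?_, ?_⟩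
  · rw [n1, n2, hs]; ring
  · rw [n1, n2, hs]
    have := sq_pos_of_ne_zero (sub_ne_zero.mpr hac)
    nlinarith
  · have e : crossp ((1 / 2 - r * Complex.I) * b) ((1 / 2 + r * Complex.I) * b) = ‖b‖ * h := by
      rw [← hrb, mul_left_comm, ← sq, hre]
      simp [crossp]; ring
    rw [e]
    refine le_of_sq_le_sq ?_ (by positivity) 
    have i1 := crossp_sq_add_dot_sq a c
    have i2 := norm_add_sq_complex a c
    rw [← hbd] at i2
    set d := a.re * c.re + a.im * c.im
    have i3 : 0 ≤ ‖a‖ * ‖c‖ - d := by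
      have : d ^ 2 ≤ (‖a‖ * ‖c‖) ^ 2 := by nlinarith [sq_nonneg (crossp a c)]
      linarith [le_of_sq_le_sq this (by positivity)]
    rw [mul_pow, hh2, hs]
    have i4 : 2 * (‖a‖ * ‖c‖ + d) ≤ ‖b‖ ^ 2 := by nlinarith [sq_nonneg (‖a‖ - ‖c‖)]
    nlinarith [mul_le_mul_of_nonneg_right i4 i3]

theorem norm_eq_of_adjacent {l : List ℂ}
    (h : ∀ p a c q, l = p ++ a :: c :: q → ‖a‖ = ‖c‖) : ∃ r, ∀ x ∈ l, ‖x‖ = r := by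
  induction l with
  | nil => exact ⟨0, by simp⟩
  | cons x l ih =>
    obtain ⟨r, hr⟩ := ih fun p a c q e => h (x :: p) a c q (by simp [e])
    rcases l with _ | ⟨y, l⟩
    · exact ⟨‖x‖, by simp⟩
    · refine ⟨r, fun z hz => ?_⟩
      rcases List.mem_cons.mp hz with rfl | hz
      · rw [h [] z y l rfl]; exact hr y (by simp)
      · exact hr z hz

theorem sum_sq_le_llen_sq (l : List ℂ) : (l.map (‖·‖ ^ 2)).sum ≤ llen l ^ 2 := by
  induction l with
  | nil => simp
  | cons a l ih =>
    simp only [List.map_cons, List.sum_cons, llen_cons]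
    nlinarith [mul_nonneg (norm_nonneg a) (llen_nonneg l)]

theorem sum_sq_nonneg (l : List ℂ) : 0 ≤ (l.map (‖·‖ ^ 2)).sum :=
  List.sum_nonneg (by simp only [List.mem_map]; rintro _ ⟨x, -, rfl⟩; positivity)

theorem continuous_larea_ofFn (n : ℕ) : Continuous fun e : Fin n → ℂ => larea (List.ofFn e) := by
  induction n with
  | zero => simpa using continuous_const
  | succ n ih =>
    simp only [List.ofFn_succ, larea_cons, List.sum_ofFn]
    refine (ih.comp (f := fun e : Fin (n + 1) → ℂ => fun i => e i.succ) (by fun_prop)).add ?_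
    refine Continuous.div_const (continuous_crossp.comp (f := fun e : Fin (n + 1) → ℂ =>
      (e 0, ∑ i : Fin n, e i.succ)) (by fun_prop)) _

theorem exists_penalized_maximizer (n : ℕ) (ε : ℝ) : ∃ l : List ℂ, l.length = n ∧ l.sum = 0 ∧
    llen l ≤ 1 ∧ ∀ m : List ℂ, m.length = n → m.sum = 0 → llen m ≤ 1 →
      larea m - ε * (m.map (‖·‖ ^ 2)).sum ≤ larea l - ε * (l.map (‖·‖ ^ 2)).sum := by
  let S : Set (Fin n → ℂ) := {e | ∑ i, e i = 0 ∧ ∑ i, ‖e i‖ ≤ 1}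
  have hS : IsCompact S := by
    refine Metric.isCompact_of_isClosed_isBounded ?_ ?_
    · exact (isClosed_eq (f := fun e : Fin n → ℂ => ∑ i, e i) (by fun_prop)
        continuous_const).inter
        (isClosed_le (f := fun e : Fin n → ℂ => ∑ i, ‖e i‖) (by fun_prop) continuous_const)
    · refine (Metric.isBounded_closedBall (x := (0 : Fin n → ℂ)) (r := 1)).subset ?_
      rintro e ⟨-, he⟩
      rw [mem_closedBall_zero_iff, pi_norm_le_iff_of_nonneg zero_le_one]
      intro i
      exact (Finset.single_le_sum (f := fun i => ‖e i‖) (fun i _ => norm_nonneg _)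
        (Finset.mem_univ i)).trans he
  have hne : S.Nonempty := ⟨0, by simp [S]⟩
  have hG : Continuous fun e : Fin n → ℂ => larea (List.ofFn e) - ε * ∑ i, ‖e i‖ ^ 2 :=
    (continuous_larea_ofFn n).sub (by fun_prop)
  obtain ⟨e, he, hmax⟩ := hS.exists_isMaxOn hne hG.continuousOn
  have hlen (e : Fin n → ℂ) : llen (List.ofFn e) = ∑ i, ‖e i‖ := by
    rw [llen, List.map_ofFn, List.sum_ofFn]; rfl
  have hsq (e : Fin n → ℂ) : ((List.ofFn e).map (‖·‖ ^ 2)).sum = ∑ i, ‖e i‖ ^ 2 := by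
    rw [List.map_ofFn, List.sum_ofFn]; rfl
  refine ⟨List.ofFn e, by simp, by rw [List.sum_ofFn]; exact he.1, by rw [hlen]; exact he.2, ?_⟩
  rintro m rfl hm0 hm1
  have hm : List.ofFn m.get = m := List.ofFn_get m
  have : m.get ∈ S := by
    constructor
    · rw [← List.sum_ofFn, hm, hm0]
    · rw [← hlen, hm]; exact hm1
  have := hmax this
  simp only [Set.mem_ofPred_eq] at this
  rw [← hsq, ← hsq, hm] at this
  exact this

theorem polygon_isoperimetric {l : List ℂ} (h0 : l.sum = 0) (hn : 3 ≤ l.length) :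
    4 * l.length * Real.tan (Real.pi / l.length) * larea l ≤ llen l ^ 2 := by
  set n := l.length with hnd
  have hn3 : (3 : ℝ) ≤ n := by exact_mod_cast hn
  have ht : 0 < Real.tan (Real.pi / n) := by
    apply Real.tan_pos_of_pos_of_lt_pi_div_two
    · positivity
    · apply div_lt_div_of_pos_left Real.pi_pos two_pos; linarith
  set t := Real.tan (Real.pi / n)
  have key : ∀ ε > 0, ∀ m : List ℂ, m.length = n → m.sum = 0 → llen m ≤ 1 →
      larea m - ε * (m.map (‖·‖ ^ 2)).sum ≤ 1 / (4 * n * t) := by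
    intro ε hε m hm hm0 hm1
    obtain ⟨e, hen, he0, he1, hmax⟩ := exists_penalized_maximizer n ε
    refine (hmax m hm hm0 hm1).trans ?_
    have hadj : ∀ p a c q, e = p ++ a :: c :: q → ‖a‖ = ‖c‖ := by
      intro p a c q he
      by_contra hac
      obtain ⟨a', c', h1, h2, h3, h4⟩ := exists_isosceles a c hac
      have := hmax (p ++ a' :: c' :: q) (by rw [← hen, he]; simp)
        (by
          rw [← he0, he]
          simp only [List.sum_append, List.sum_cons]
          rw [← add_assoc a', h1, add_assoc a])
        (by
          refine le_trans (le_of_eq ?_) he1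
          rw [he]
          simp only [llen_append, llen_cons]
          rw [← add_assoc ‖a'‖, h2, add_assoc])
      rw [he] at this
      simp only [List.map_append, List.map_cons, List.sum_append, List.sum_cons, larea_append,
        larea_cons] at this
      have e1 : crossp p.sum (a' + (c' + q.sum)) = crossp p.sum (a + (c + q.sum)) := by
        rw [← add_assoc a', h1, add_assoc a]
      have e2 : crossp c' q.sum + crossp a' q.sum = crossp c q.sum + crossp a q.sum := by
        rw [add_comm, ← crossp_add_left, h1, add_comm (crossp c _), ← crossp_add_left]
      rw [e1, crossp_add_right a', crossp_add_right a] at this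
      nlinarith
    obtain ⟨r, hr⟩ := norm_eq_of_adjacent hadj
    have hl : llen e = n * r := by
      rw [llen, List.map_congr_left hr]; simp [hen]
    have hq : (e.map (‖·‖ ^ 2)).sum = n * r ^ 2 := by
      rw [List.map_congr_left (g := fun _ => r ^ 2) fun x hx => by rw [hr x hx]]; simp [hen]
    have h1 := tan_mul_larea_le_sum_sq he0 (by rw [hen]; exact hn)
    rw [hen, hq] at h1
    rw [hl] at he1
    have h2 : 0 ≤ n * r := hl ▸ llen_nonneg e
    have h3 : (n * r) ^ 2 ≤ 1 := by nlinarith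
    have h4 : larea e ≤ 1 / (4 * n * t) := by
      rw [le_div_iff₀ (by positivity)]
      calc larea e * (4 * n * t) = n * (4 * t * larea e) := by ring
        _ ≤ n * (n * r ^ 2) := by gcongr
        _ = (n * r) ^ 2 := by ring
        _ ≤ 1 := h3
    have h5 : 0 ≤ ε * (e.map (‖·‖ ^ 2)).sum := mul_nonneg hε.le (sum_sq_nonneg e)
    linarith
  have key2 : ∀ m : List ℂ, m.length = n → m.sum = 0 → llen m ≤ 1 →
      larea m ≤ 1 / (4 * n * t) := by
    intro m hm hm0 hm1
    refine le_of_forall_pos_le_add fun ε hε => ?_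
    have h1 := key ε hε m hm hm0 hm1
    have h2 : (m.map (‖·‖ ^ 2)).sum ≤ 1 := by
      nlinarith [sum_sq_le_llen_sq m, llen_nonneg m]
    nlinarith
  rcases (llen_nonneg l).eq_or_lt with hL | hL
  · have : (l.map (‖·‖ ^ 2)).sum = 0 :=
      le_antisymm (by have := sum_sq_le_llen_sq l; rw [← hL] at this; simpa using this)
        (sum_sq_nonneg l)
    have h1 := tan_mul_larea_le_sum_sq h0 (by exact hn)
    rw [this, ← hnd] at h1
    rw [← hL]
    have : n * (4 * t * larea l) ≤ n * 0 := by gcongr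
    linarith
  · have h1 := key2 (l.map (((llen l)⁻¹ : ℝ) * ·)) (by simp [hnd])
      (by rw [List.sum_map_mul_left]; simp [h0])
      (by
        rw [llen_map_mul, Complex.norm_real, Real.norm_of_nonneg (by positivity),
          inv_mul_cancel₀ hL.ne'])
    rw [larea_map_mul, Complex.norm_real, Real.norm_of_nonneg (by positivity),
      le_div_iff₀ (by positivity)] at h1
    have h2 : 4 * n * t * larea l = llen l ^ 2 * (((llen l)⁻¹) ^ 2 * larea l * (4 * n * t)) := by
      field_simp
    rw [h2]
    nlinarith [sq_nonneg (llen l)]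

theorem isoperimetric_pos {l : List ℂ} (h0 : l.sum = 0) : 4 * Real.pi * larea l ≤ llen l ^ 2 := by
  rcases le_or_gt (larea l) 0 with h | h
  · nlinarith [sq_nonneg (llen l), Real.pi_pos]
  set m := l ++ List.replicate 3 0 with hm
  have hs : m.sum = 0 := by simp [hm, h0]
  have hl : 3 ≤ m.length := by simp [hm]
  have hA : larea m = larea l := by
    have : larea (List.replicate 3 (0 : ℂ)) = 0 := by simp [List.replicate, larea_cons]
    rw [hm, larea_append, this]; simp
  have hL : llen m = llen l := by rw [hm, llen_append]; simp [llen]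
  have h1 := polygon_isoperimetric hs hl
  rw [hA, hL] at h1
  refine le_trans ?_ h1
  have hn3 : (3 : ℝ) ≤ m.length := by exact_mod_cast hl
  have h2 : Real.pi / m.length ≤ Real.tan (Real.pi / m.length) := by
    apply Real.le_tan
    · positivity
    · apply div_lt_div_of_pos_left Real.pi_pos two_pos; linarith
  have h3 : Real.pi ≤ m.length * Real.tan (Real.pi / m.length) := by
    rw [div_le_iff₀ (by positivity)] at h2; linarith
  nlinarith

theorem isoperimetric {l : List ℂ} (h0 : l.sum = 0) : 4 * Real.pi * |larea l| ≤ llen l ^ 2 := by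
  rcases abs_cases (larea l) with ⟨h, -⟩ | ⟨h, -⟩ <;> rw [h]
  · exact isoperimetric_pos h0
  · have := isoperimetric_pos (l := l.reverse) (by simp [h0])
    rwa [larea_reverse, llen_reverse] at this

theorem le_of_sq_bound {L k s r : ℝ} (hL : 0 ≤ L) (hrs : r ^ 2 = s)
    (h : k ^ 2 * s ≤ L ^ 2) : k * r ≤ L := by
  refine le_of_sq_le_sq ?_ hL
  rw [mul_pow, hrs]; exact h

theorem numeric_three {L α a b : ℝ} (hL : 0 ≤ L) (hα : 39 / 100 ≤ α) (hα1 : α ≤ 1) (ha : 0 ≤ a)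
    (ha1 : a ≤ 12 / 5) (hb : 0 ≤ b) (h1 : 1256 / 100 * (α + 2 * a) ≤ L ^ 2)
    (h3 : a < 1 / 2 → b < 1 / 2 → 207 / 10 * (α + a - b) ≤ L ^ 2) :
    18613 / 10000 * (2 * α + a) - 18612 / 10000 * b + 21 / 100 ≤ L := by
  obtain ⟨p, hp0, hp⟩ : ∃ p : ℝ, 0 ≤ p ∧ p ^ 2 = α :=
    ⟨√α, Real.sqrt_nonneg _, Real.sq_sqrt (by linarith)⟩
  obtain ⟨r, hr0, hr⟩ : ∃ r : ℝ, 0 ≤ r ∧ r ^ 2 = α + 2 * a :=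
    ⟨√(α + 2 * a), Real.sqrt_nonneg _, Real.sq_sqrt (by linarith)⟩
  have hLr : 3544 / 1000 * r ≤ L := le_of_sq_bound hL hr (by linarith)
  have hpr : p ≤ r := le_of_sq_le_sq (by linarith) hr0
  have hp1 : p ≤ 1 := by nlinarith only [hp, hα1]
  have hr1 : r ≤ 241 / 100 := by nlinarith only [hr, hα1, ha1]
  have hpl : 62 / 100 ≤ p := by nlinarith only [hp, hα, hp0]
  have hgr : 0 ≤ (r - p) * (3544 / 1000 - 18613 / 20000 * (r + p)) := by
    apply mul_nonneg <;> linarith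
  by_cases c1 : p ≤ 866 / 1000
  · linarith [mul_nonneg (sub_nonneg.mpr hpl) (sub_nonneg.mpr c1)]
  push Not at c1
  have hpp := mul_nonneg (sub_nonneg.mpr c1.le) (sub_nonneg.mpr hp1)
  by_cases c2 : 21 / 100 ≤ b
  · linarith
  by_cases c3 : 32 / 100 ≤ a
  · by_cases c4 : r ≤ 128 / 100
    · linarith [mul_nonneg (sub_nonneg.mpr c4) (sub_nonneg.mpr (c1.le.trans hpr))]
    · linarith [mul_nonneg (sub_nonneg.mpr hr1) (sub_nonneg.mpr (not_le.mp c4).le)]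
  push Not at c2 c3
  have h3 := h3 (by linarith) (by linarith)
  by_cases c4 : α + a - b ≤ 78 / 100
  · linarith
  push Not at c4
  obtain ⟨q, hq0, hq⟩ : ∃ q : ℝ, 0 ≤ q ∧ q ^ 2 = α + a - b :=
    ⟨√(α + a - b), Real.sqrt_nonneg _, Real.sq_sqrt (by linarith)⟩
  have hLq : 4549 / 1000 * q ≤ L := le_of_sq_bound hL hq (by linarith)
  have q1 : 883 / 1000 ≤ q := by
    refine le_of_sq_le_sq ?_ hq0
    rw [hq]; linarith
  have q2 : q ≤ 115 / 100 := by
    refine le_of_sq_le_sq ?_ (by norm_num)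
    rw [hq]; linarith
  linarith [mul_nonneg (sub_nonneg.mpr q1) (sub_nonneg.mpr q2)]

theorem numeric_four {L α a b : ℝ} (hL : 0 ≤ L) (hα : 22 / 100 ≤ α) (hα1 : α ≤ 1) (ha : 0 ≤ a)
    (ha1 : a ≤ 12 / 5) (hb : 0 ≤ b) (h1 : 1256 / 100 * (α + 2 * a) ≤ L ^ 2)
    (h3 : a < 1 / 2 → b < 1 / 2 → 16 * (α + a - b) ≤ L ^ 2) :
    18613 / 10000 * (2 * α + a) - 18612 / 10000 * b + 14 / 100 ≤ L := by
  obtain ⟨p, hp0, hp⟩ : ∃ p : ℝ, 0 ≤ p ∧ p ^ 2 = α :=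
    ⟨√α, Real.sqrt_nonneg _, Real.sq_sqrt (by linarith)⟩
  obtain ⟨r, hr0, hr⟩ : ∃ r : ℝ, 0 ≤ r ∧ r ^ 2 = α + 2 * a :=
    ⟨√(α + 2 * a), Real.sqrt_nonneg _, Real.sq_sqrt (by linarith)⟩
  have hLr : 3544 / 1000 * r ≤ L := le_of_sq_bound hL hr (by linarith)
  have hpr : p ≤ r := le_of_sq_le_sq (by linarith) hr0
  have hp1 : p ≤ 1 := by nlinarith only [hp, hα1]
  have hr1 : r ≤ 241 / 100 := by nlinarith only [hr, hα1, ha1]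
  have hpl : 46 / 100 ≤ p := by nlinarith only [hp, hα, hp0]
  have hgr : 0 ≤ (r - p) * (3544 / 1000 - 18613 / 20000 * (r + p)) := by
    apply mul_nonneg <;> linarith
  by_cases c1 : p ≤ 866 / 1000
  · linarith [mul_nonneg (sub_nonneg.mpr hpl) (sub_nonneg.mpr c1)]
  push Not at c1
  have hpp := mul_nonneg (sub_nonneg.mpr c1.le) (sub_nonneg.mpr hp1)
  by_cases c2 : 172 / 1000 ≤ b
  · linarith
  by_cases c3 : 25 / 100 ≤ a
  · by_cases c4 : r ≤ 1225 / 1000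
    · linarith [mul_nonneg (sub_nonneg.mpr c4) (sub_nonneg.mpr (c1.le.trans hpr))]
    · linarith [mul_nonneg (sub_nonneg.mpr hr1) (sub_nonneg.mpr (not_le.mp c4).le)]
  push Not at c2 c3
  have h3 := h3 (by linarith) (by linarith)
  by_cases c4 : α + a - b ≤ 78 / 100
  · linarith
  push Not at c4
  obtain ⟨q, hq0, hq⟩ : ∃ q : ℝ, 0 ≤ q ∧ q ^ 2 = α + a - b :=
    ⟨√(α + a - b), Real.sqrt_nonneg _, Real.sq_sqrt (by linarith)⟩
  have hLq : 4 * q ≤ L := le_of_sq_bound hL hq (by linarith)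
  have q1 : 883 / 1000 ≤ q := by
    refine le_of_sq_le_sq ?_ hq0
    rw [hq]; linarith
  have q2 : q ≤ 112 / 100 := by
    refine le_of_sq_le_sq ?_ (by norm_num)
    rw [hq]; linarith
  linarith [mul_nonneg (sub_nonneg.mpr q1) (sub_nonneg.mpr q2)]

theorem numeric_five {L α a b : ℝ} (hL : 0 ≤ L) (hα : 14 / 100 ≤ α) (hα1 : α ≤ 1) (ha : 0 ≤ a)
    (ha1 : a ≤ 12 / 5) (hb : 0 ≤ b) (h1 : 1256 / 100 * (α + 2 * a) ≤ L ^ 2)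
    (h3 : a < 1 / 2 → b < 1 / 2 → 1453 / 100 * (α + a - b) ≤ L ^ 2) :
    18613 / 10000 * (2 * α + a) - 18612 / 10000 * b + 7 / 100 ≤ L := by
  obtain ⟨p, hp0, hp⟩ : ∃ p : ℝ, 0 ≤ p ∧ p ^ 2 = α :=
    ⟨√α, Real.sqrt_nonneg _, Real.sq_sqrt (by linarith)⟩
  obtain ⟨r, hr0, hr⟩ : ∃ r : ℝ, 0 ≤ r ∧ r ^ 2 = α + 2 * a :=
    ⟨√(α + 2 * a), Real.sqrt_nonneg _, Real.sq_sqrt (by linarith)⟩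
  have hLr : 3544 / 1000 * r ≤ L := le_of_sq_bound hL hr (by linarith)
  have hpr : p ≤ r := le_of_sq_le_sq (by linarith) hr0
  have hp1 : p ≤ 1 := by nlinarith only [hp, hα1]
  have hr1 : r ≤ 241 / 100 := by nlinarith only [hr, hα1, ha1]
  have hpl : 37 / 100 ≤ p := by nlinarith only [hp, hα, hp0]
  have hgr : 0 ≤ (r - p) * (3544 / 1000 - 18613 / 20000 * (r + p)) := by
    apply mul_nonneg <;> linarith
  by_cases c1 : p ≤ 866 / 1000
  · linarith [mul_nonneg (sub_nonneg.mpr hpl) (sub_nonneg.mpr c1)]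
  push Not at c1
  have hpp := mul_nonneg (sub_nonneg.mpr c1.le) (sub_nonneg.mpr hp1)
  by_cases c2 : 134 / 1000 ≤ b
  · linarith
  by_cases c3 : 20 / 100 ≤ a
  · by_cases c4 : r ≤ 1184 / 1000
    · linarith [mul_nonneg (sub_nonneg.mpr c4) (sub_nonneg.mpr (c1.le.trans hpr))]
    · linarith [mul_nonneg (sub_nonneg.mpr hr1) (sub_nonneg.mpr (not_le.mp c4).le)]
  push Not at c2 c3
  have h3 := h3 (by linarith) (by linarith)
  by_cases c4 : α + a - b ≤ 86 / 100
  · linarith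
  push Not at c4
  obtain ⟨q, hq0, hq⟩ : ∃ q : ℝ, 0 ≤ q ∧ q ^ 2 = α + a - b :=
    ⟨√(α + a - b), Real.sqrt_nonneg _, Real.sq_sqrt (by linarith)⟩
  have hLq : 38118 / 10000 * q ≤ L := le_of_sq_bound hL hq (by linarith)
  have q1 : 927 / 1000 ≤ q := by
    refine le_of_sq_le_sq ?_ hq0
    rw [hq]; linarith
  have q2 : q ≤ 1096 / 1000 := by
    refine le_of_sq_le_sq ?_ (by norm_num)
    rw [hq]; linarith
  linarith [mul_nonneg (sub_nonneg.mpr q1) (sub_nonneg.mpr q2)]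

theorem numeric_seven {L α a b : ℝ} (hL : 0 ≤ L) (hα : 0 ≤ α) (hα1 : α ≤ 1) (ha : 0 ≤ a)
    (ha1 : a ≤ 12 / 5) (hb : 0 ≤ b) (h1 : 1256 / 100 * (α + 2 * a) ≤ L ^ 2)
    (h3 : a < 1 / 2 → b < 1 / 2 → 1339 / 100 * (α + a - b) ≤ L ^ 2) :
    18613 / 10000 * (2 * α + a) - 18612 / 10000 * b + -(7 / 100) ≤ L := by
  obtain ⟨p, hp0, hp⟩ : ∃ p : ℝ, 0 ≤ p ∧ p ^ 2 = α :=
    ⟨√α, Real.sqrt_nonneg _, Real.sq_sqrt (by linarith)⟩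
  obtain ⟨r, hr0, hr⟩ : ∃ r : ℝ, 0 ≤ r ∧ r ^ 2 = α + 2 * a :=
    ⟨√(α + 2 * a), Real.sqrt_nonneg _, Real.sq_sqrt (by linarith)⟩
  have hLr : 3544 / 1000 * r ≤ L := le_of_sq_bound hL hr (by linarith)
  have hpr : p ≤ r := le_of_sq_le_sq (by linarith) hr0
  have hp1 : p ≤ 1 := by nlinarith only [hp, hα1]
  have hr1 : r ≤ 241 / 100 := by nlinarith only [hr, hα1, ha1]
  have hpl : 0 ≤ p := by nlinarith only [hp, hα, hp0]
  have hgr : 0 ≤ (r - p) * (3544 / 1000 - 18613 / 20000 * (r + p)) := by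
    apply mul_nonneg <;> linarith
  by_cases c1 : p ≤ 97 / 100
  · linarith [mul_nonneg (sub_nonneg.mpr hpl) (sub_nonneg.mpr c1)]
  push Not at c1
  have hpp := mul_nonneg (sub_nonneg.mpr c1.le) (sub_nonneg.mpr hp1)
  by_cases c2 : 60 / 1000 ≤ b
  · linarith
  by_cases c3 : 8 / 100 ≤ a
  · by_cases c4 : r ≤ 1077 / 1000
    · linarith [mul_nonneg (sub_nonneg.mpr c4) (sub_nonneg.mpr (c1.le.trans hpr))]
    · linarith [mul_nonneg (sub_nonneg.mpr hr1) (sub_nonneg.mpr (not_le.mp c4).le)]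
  push Not at c2 c3
  have h3 := h3 (by linarith) (by linarith)
  have hα0 : (97 / 100) ^ 2 ≤ α := by rw [← hp]; gcongr
  obtain ⟨q, hq0, hq⟩ : ∃ q : ℝ, 0 ≤ q ∧ q ^ 2 = α + a - b :=
    ⟨√(α + a - b), Real.sqrt_nonneg _, Real.sq_sqrt (by linarith)⟩
  have hLq : 3659 / 1000 * q ≤ L := le_of_sq_bound hL hq (by linarith)
  have q1 : 938 / 1000 ≤ q := by
    refine le_of_sq_le_sq ?_ hq0
    rw [hq]; linarith
  have q2 : q ≤ 1040 / 1000 := by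
    refine le_of_sq_le_sq ?_ (by norm_num)
    rw [hq]; linarith
  linarith [mul_nonneg (sub_nonneg.mpr q1) (sub_nonneg.mpr q2)]

theorem numeric_eight {L α a b : ℝ} (hL : 0 ≤ L) (hα : 0 ≤ α) (hα1 : α ≤ 1) (ha : 0 ≤ a)
    (ha1 : a ≤ 12 / 5) (hb : 0 ≤ b) (h1 : 1256 / 100 * (α + 2 * a) ≤ L ^ 2)
    (h3 : a < 1 / 2 → b < 1 / 2 → 131 / 10 * (α + a - b) ≤ L ^ 2) :
    18613 / 10000 * (2 * α + a) - 18612 / 10000 * b + -(14 / 100) ≤ L := by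
  obtain ⟨p, hp0, hp⟩ : ∃ p : ℝ, 0 ≤ p ∧ p ^ 2 = α :=
    ⟨√α, Real.sqrt_nonneg _, Real.sq_sqrt (by linarith)⟩
  obtain ⟨r, hr0, hr⟩ : ∃ r : ℝ, 0 ≤ r ∧ r ^ 2 = α + 2 * a :=
    ⟨√(α + 2 * a), Real.sqrt_nonneg _, Real.sq_sqrt (by linarith)⟩
  have hLr : 3544 / 1000 * r ≤ L := le_of_sq_bound hL hr (by linarith)
  have hpr : p ≤ r := le_of_sq_le_sq (by linarith) hr0
  have hp1 : p ≤ 1 := by nlinarith only [hp, hα1]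
  have hr1 : r ≤ 241 / 100 := by nlinarith only [hr, hα1, ha1]
  have hpl : 0 ≤ p := by nlinarith only [hp, hα, hp0]
  have hgr : 0 ≤ (r - p) * (3544 / 1000 - 18613 / 20000 * (r + p)) := by
    apply mul_nonneg <;> linarith
  by_cases c1 : p ≤ 985 / 1000
  · linarith [mul_nonneg (sub_nonneg.mpr hpl) (sub_nonneg.mpr c1)]
  push Not at c1
  have hpp := mul_nonneg (sub_nonneg.mpr c1.le) (sub_nonneg.mpr hp1)
  by_cases c2 : 22 / 1000 ≤ b
  · linarith
  by_cases c3 : 3 / 100 ≤ a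
  · by_cases c4 : r ≤ 1030 / 1000
    · linarith [mul_nonneg (sub_nonneg.mpr c4) (sub_nonneg.mpr (c1.le.trans hpr))]
    · linarith [mul_nonneg (sub_nonneg.mpr hr1) (sub_nonneg.mpr (not_le.mp c4).le)]
  push Not at c2 c3
  have h3 := h3 (by linarith) (by linarith)
  have hα0 : (985 / 1000) ^ 2 ≤ α := by rw [← hp]; gcongr
  obtain ⟨q, hq0, hq⟩ : ∃ q : ℝ, 0 ≤ q ∧ q ^ 2 = α + a - b :=
    ⟨√(α + a - b), Real.sqrt_nonneg _, Real.sq_sqrt (by linarith)⟩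
  have hLq : 3619 / 1000 * q ≤ L := le_of_sq_bound hL hq (by linarith)
  have q1 : 973 / 1000 ≤ q := by
    refine le_of_sq_le_sq ?_ hq0
    rw [hq]; linarith
  have q2 : q ≤ 1016 / 1000 := by
    refine le_of_sq_le_sq ?_ (by norm_num)
    rw [hq]; linarith
  linarith [mul_nonneg (sub_nonneg.mpr q1) (sub_nonneg.mpr q2)]

theorem numeric_six {L α a b : ℝ} (hL : 0 ≤ L) (hα : 0 ≤ α) (hα1 : α ≤ 1) (ha : 0 ≤ a)
    (ha1 : a ≤ 12 / 5) (hb : 0 ≤ b) (h1 : 1256 / 100 * (α + 2 * a) ≤ L ^ 2) :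
    18613 / 10000 * (2 * α + a) - 18612 / 10000 * b ≤ L ∨
      (a < 13 / 100 ∧ b < 10 / 100 ∧ 90 / 100 ≤ α) := by
  obtain ⟨p, hp0, hp⟩ : ∃ p : ℝ, 0 ≤ p ∧ p ^ 2 = α :=
    ⟨√α, Real.sqrt_nonneg _, Real.sq_sqrt (by linarith)⟩
  obtain ⟨r, hr0, hr⟩ : ∃ r : ℝ, 0 ≤ r ∧ r ^ 2 = α + 2 * a :=
    ⟨√(α + 2 * a), Real.sqrt_nonneg _, Real.sq_sqrt (by linarith)⟩
  have hLr : 3544 / 1000 * r ≤ L := le_of_sq_bound hL hr (by linarith)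
  have hpr : p ≤ r := le_of_sq_le_sq (by linarith) hr0
  have hp1 : p ≤ 1 := by nlinarith only [hp, hα1]
  have hr1 : r ≤ 241 / 100 := by nlinarith only [hr, hα1, ha1]
  have hgr : 0 ≤ (r - p) * (3544 / 1000 - 18613 / 20000 * (r + p)) := by
    apply mul_nonneg <;> linarith
  by_cases c1 : p ≤ 95 / 100
  · left
    linarith [mul_nonneg hp0 (sub_nonneg.mpr c1)]
  push Not at c1
  have hpp := mul_nonneg (sub_nonneg.mpr c1.le) (sub_nonneg.mpr hp1)
  by_cases c2 : 10 / 100 ≤ b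
  · left; linarith
  by_cases c3 : 13 / 100 ≤ a
  · left
    by_cases c4 : r ≤ 1122 / 1000
    · linarith [mul_nonneg (sub_nonneg.mpr c4) (sub_nonneg.mpr (c1.le.trans hpr))]
    · linarith [mul_nonneg (sub_nonneg.mpr hr1) (sub_nonneg.mpr (not_le.mp c4).le)]
  push Not at c2 c3
  refine Or.inr ⟨c3, c2, ?_⟩
  rw [← hp]
  nlinarith only [c1]

theorem numeric_nine {L α a b : ℝ} (hL : 0 ≤ L) (hα : 0 ≤ α) (hα1 : α ≤ 1) (ha : 0 ≤ a)
    (ha1 : a ≤ 12 / 5) (hb : 0 ≤ b) (h1 : 1256 / 100 * (α + 2 * a) ≤ L ^ 2) :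
    18613 / 10000 * (2 * α + a) - 18612 / 10000 * b - 21 / 100 ≤ L := by
  obtain ⟨p, hp0, hp⟩ : ∃ p : ℝ, 0 ≤ p ∧ p ^ 2 = α :=
    ⟨√α, Real.sqrt_nonneg _, Real.sq_sqrt (by linarith)⟩
  obtain ⟨r, hr0, hr⟩ : ∃ r : ℝ, 0 ≤ r ∧ r ^ 2 = α + 2 * a :=
    ⟨√(α + 2 * a), Real.sqrt_nonneg _, Real.sq_sqrt (by linarith)⟩
  have hLr : 3544 / 1000 * r ≤ L := le_of_sq_bound hL hr (by linarith)
  have hpr : p ≤ r := le_of_sq_le_sq (by linarith) hr0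
  have hp1 : p ≤ 1 := by nlinarith only [hp, hα1]
  have hr1 : r ≤ 241 / 100 := by nlinarith only [hr, hα1, ha1]
  have hgr : 0 ≤ (r - p) * (3544 / 1000 - 18613 / 20000 * (r + p)) := by
    apply mul_nonneg <;> linarith
  linarith [mul_nonneg hp0 (sub_nonneg.mpr hp1)]

theorem numeric_two {L α a b : ℝ} (hL : 0 ≤ L) (hα : 88 / 100 ≤ α) (hα1 : α ≤ 1) (ha : 0 ≤ a)
    (ha1 : a ≤ 12 / 5) (hb : 44 / 100 ≤ b) (h1 : 1256 / 100 * (α + 2 * a) ≤ L ^ 2) :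
    18613 / 10000 * (2 * α + a) - 18612 / 10000 * b + 28 / 100 ≤ L := by
  obtain ⟨p, hp0, hp⟩ : ∃ p : ℝ, 0 ≤ p ∧ p ^ 2 = α :=
    ⟨√α, Real.sqrt_nonneg _, Real.sq_sqrt (by linarith)⟩
  obtain ⟨r, hr0, hr⟩ : ∃ r : ℝ, 0 ≤ r ∧ r ^ 2 = α + 2 * a :=
    ⟨√(α + 2 * a), Real.sqrt_nonneg _, Real.sq_sqrt (by linarith)⟩
  have hLr : 3544 / 1000 * r ≤ L := le_of_sq_bound hL hr (by linarith)
  have hpr : p ≤ r := le_of_sq_le_sq (by linarith) hr0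
  have hp1 : p ≤ 1 := by nlinarith only [hp, hα1]
  have hr1 : r ≤ 241 / 100 := by nlinarith only [hr, hα1, ha1]
  have hgr : 0 ≤ (r - p) * (3544 / 1000 - 18613 / 20000 * (r + p)) := by
    apply mul_nonneg <;> linarith
  linarith [mul_nonneg hp0 (sub_nonneg.mpr hp1)]

theorem numeric_large {L α a b : ℝ} (hα1 : α ≤ 1) (ha1 : 12 / 5 ≤ a) (hb : 0 ≤ b)
    (h1 : 3544 / 1000 * (a + b) ≤ L) :
    18613 / 10000 * (2 * α + a) - 18612 / 10000 * b + 28 / 100 ≤ L := by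
  linarith

/-- Concatenation of the first `k` rotated copies of a path. -/
noncomputable def rotCopies (ω : ℂ) (c : List ℂ) : ℕ → List ℂ
  | 0 => []
  | k + 1 => rotCopies ω c k ++ c.map (ω ^ k * ·)

theorem sum_rotCopies (ω : ℂ) (c : List ℂ) (k : ℕ) :
    (rotCopies ω c k).sum = (∑ j ∈ Finset.range k, ω ^ j) * c.sum := by
  induction k with
  | zero => simp [rotCopies]
  | succ k ih =>
    rw [rotCopies, List.sum_append, ih, List.sum_map_mul_left, Finset.sum_range_succ, add_mul]
    simp

theorem llen_rotCopies {ω : ℂ} (hω : ‖ω‖ = 1) (c : List ℂ) (k : ℕ) :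
    llen (rotCopies ω c k) = k * llen c := by
  induction k with
  | zero => simp [rotCopies]
  | succ k ih => rw [rotCopies, llen_append, ih, llen_map_mul]; simp [hω]; ring

theorem larea_rotCopies {ω : ℂ} (hω : ‖ω‖ = 1) (h1 : ω ≠ 1) (c : List ℂ) (k : ℕ) :
    larea (rotCopies ω c k) = k * larea c + ‖c.sum‖ ^ 2 / 2 *
      (((∑ j ∈ Finset.range k, ω ^ j) - k) / (1 - (starRingEnd ℂ) ω)).im := by
  have hc1 : (1 : ℂ) - (starRingEnd ℂ) ω ≠ 0 := by
    intro h
    apply h1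
    have := congrArg (starRingEnd ℂ) (sub_eq_zero.mp h)
    simpa using this.symm
  have hcc : (starRingEnd ℂ) ω * ω = 1 := by
    rw [mul_comm, Complex.mul_conj, Complex.normSq_eq_norm_sq, hω]; simp
  induction k with
  | zero => simp [rotCopies]
  | succ k ih =>
    rw [rotCopies, larea_append, ih, larea_map_mul, sum_rotCopies, List.sum_map_mul_left]
    have e1 : crossp ((∑ j ∈ Finset.range k, ω ^ j) * c.sum) (ω ^ k * (List.map (fun x => x) c).sum)
        = ‖c.sum‖ ^ 2 * crossp (∑ j ∈ Finset.range k, ω ^ j) (ω ^ k) := by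
      rw [← crossp_mul]; simp [mul_comm]
    have e2 (z w : ℂ) : crossp z w = ((starRingEnd ℂ) z * w).im := by simp [crossp]; ring
    have e3 : (starRingEnd ℂ) (∑ j ∈ Finset.range k, ω ^ j) * ω ^ k =
        (ω ^ k - 1) / (1 - (starRingEnd ℂ) ω) := by
      rw [eq_div_iff hc1, map_sum]
      simp only [map_pow]
      have := geom_sum_mul ((starRingEnd ℂ) ω) k
      have h4 : (starRingEnd ℂ) ω ^ k * ω ^ k = 1 := by rw [← mul_pow, hcc, one_pow]
      linear_combination (-ω ^ k) * this - h4
    rw [e1, e2, e3, Finset.sum_range_succ]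
    have e4 : ((∑ j ∈ Finset.range k, ω ^ j) + ω ^ k - ((k + 1 : ℕ) : ℂ)) / (1 - (starRingEnd ℂ) ω)
        = ((∑ j ∈ Finset.range k, ω ^ j) - k) / (1 - (starRingEnd ℂ) ω)
          + (ω ^ k - 1) / (1 - (starRingEnd ℂ) ω) := by
      rw [← add_div]; push_cast; congr 1; ring
    rw [e4, Complex.add_im, norm_pow, hω]
    push_cast
    ring

theorem dido {M : ℕ} (hM : 2 ≤ M) (c : List ℂ) :
    Real.pi / M * (Real.cos (Real.pi / M) / Real.sin (Real.pi / M)) * ‖c.sum‖ ^ 2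
      + 4 * (Real.pi / M) * larea c ≤ llen c ^ 2 := by
  have hM0 : (0 : ℝ) < M := by positivity
  have hM2 : (2 : ℝ) ≤ M := by exact_mod_cast hM
  set θ := Real.pi / M with hθ
  have hθ0 : 0 < θ := by positivity
  have hθ1 : θ ≤ Real.pi / 2 := by rw [hθ]; gcongr
  have hsin : 0 < Real.sin θ := Real.sin_pos_of_pos_of_lt_pi hθ0 (by linarith [Real.pi_pos])
  set ω : ℂ := ⟨1 - 2 * Real.sin θ ^ 2, 2 * Real.sin θ * Real.cos θ⟩ with hω
  have hωe : ω = Complex.exp (2 * Real.pi * Complex.I / M) := by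
    have : 2 * Real.pi * Complex.I / M = ((2 * θ : ℝ) : ℂ) * Complex.I := by
      rw [hθ]; push_cast; ring
    rw [this]
    apply Complex.ext
    · rw [Complex.exp_ofReal_mul_I_re, Real.cos_two_mul, Real.cos_sq', hω]; ring
    · rw [Complex.exp_ofReal_mul_I_im, Real.sin_two_mul, hω]
  have hprim : IsPrimitiveRoot ω M := hωe ▸ Complex.isPrimitiveRoot_exp M (by omega)
  have hn : ‖ω‖ = 1 := hprim.norm'_eq_one (by omega)
  have h1 : ω ≠ 1 := hprim.ne_one (by omega)
  have hg : ∑ j ∈ Finset.range M, ω ^ j = 0 := hprim.geom_sum_eq_zero (by omega)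
  have hs : (rotCopies ω c M).sum = 0 := by rw [sum_rotCopies, hg, zero_mul]
  have h2 := isoperimetric_pos hs
  rw [larea_rotCopies hn h1, llen_rotCopies hn, hg] at h2
  have h3 : ((0 - (M : ℂ)) / (1 - (starRingEnd ℂ) ω)).im
      = M * (Real.cos θ / Real.sin θ) / 2 := by
    have : (1 - (starRingEnd ℂ) ω) =
        ⟨2 * Real.sin θ ^ 2, 2 * Real.sin θ * Real.cos θ⟩ := by
      apply Complex.ext <;> simp [hω]
    rw [this, Complex.div_im, Complex.normSq_mk]
    have h4 : 2 * Real.sin θ ^ 2 * (2 * Real.sin θ ^ 2) +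
        2 * Real.sin θ * Real.cos θ * (2 * Real.sin θ * Real.cos θ) = 4 * Real.sin θ ^ 2 := by
      nlinarith [Real.sin_sq_add_cos_sq θ]
    rw [h4]
    simp
    field_simp
    ring
  rw [h3] at h2
  have h5 : Real.pi = θ * M := by rw [hθ]; field_simp
  rw [h5] at h2
  have h6 : (M : ℝ) ^ 2 * (θ * (Real.cos θ / Real.sin θ) * ‖c.sum‖ ^ 2 + 4 * θ * larea c)
      ≤ M ^ 2 * llen c ^ 2 := by
    calc _ = _ := ?_
      _ ≤ _ := h2
      _ = _ := by ring
    ring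
  exact le_of_mul_le_mul_left h6 (by positivity)

theorem chain_length_sq_ge {c : List ℂ} (hx : |larea c| ≤ 13 / 100) (hc : ‖c.sum‖ ≤ 14 / 10) :
    ‖c.sum‖ ^ 2 + 2 * √3 * larea c ^ 2 ≤ llen c ^ 2 := by
  wlog hpos : 0 ≤ larea c generalizing c
  · have := this (c := c.reverse) (by simpa [larea_reverse] using hx) (by simpa using hc)
      (by rw [larea_reverse]; linarith)
    simpa [larea_reverse] using this
  rcases hpos.eq_or_lt with h0 | h0
  · rw [← h0]
    have := norm_sum_le_llen c
    have h2 : ‖c.sum‖ ^ 2 ≤ llen c ^ 2 := by gcongr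
    linarith
  rw [abs_of_nonneg hpos] at hx
  set x := larea c with hxd
  have hpi1 := Real.pi_gt_d2
  have hpi2 := Real.pi_lt_d2
  set M := ⌈Real.pi / (283 / 100 * x)⌉₊ with hM
  have hM1 : Real.pi / (283 / 100 * x) ≤ M := Nat.le_ceil _
  have hM2 : (M : ℝ) ≤ Real.pi / (283 / 100 * x) + 1 := (Nat.ceil_lt_add_one (by positivity)).le
  have hMx1 : Real.pi ≤ 283 / 100 * (M * x) := by
    rw [div_le_iff₀ (by positivity)] at hM1; linarith
  have hMx2 : 125 / 100 * (M * x) ≤ Real.pi := by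
    have : (M : ℝ) * x ≤ Real.pi / (283 / 100) + x := by
      calc (M : ℝ) * x ≤ (Real.pi / (283 / 100 * x) + 1) * x := by gcongr
        _ = _ := by field_simp
    rw [div_eq_mul_inv] at this
    norm_num at this
    linarith
  have hMge : 2 ≤ M := by
    have : (1 : ℝ) < M := by nlinarith
    exact_mod_cast this
  have hM0 : (0 : ℝ) < M := by positivity
  have h2 := dido hMge c
  set θ := Real.pi / M with hθ
  have hθM : θ * M = Real.pi := div_mul_cancel₀ _ hM0.ne'
  have hθ0 : 0 < θ := by positivity
  have hθ1 : θ ≤ Real.pi / 2 := by rw [hθ]; gcongr; exact_mod_cast hMge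
  have hsin : 0 < Real.sin θ := Real.sin_pos_of_pos_of_lt_pi hθ0 (by linarith [Real.pi_pos])
  have hu1 : 125 / 100 * x ≤ θ := by
    rw [hθ, le_div_iff₀ hM0]; linarith
  have hu2 : θ ≤ 283 / 100 * x := by
    rw [hθ, div_le_iff₀ hM0]; linarith
  have hcot : 1 - θ ^ 2 / 2 ≤ θ * (Real.cos θ / Real.sin θ) := by
    rw [← mul_div_assoc, le_div_iff₀ hsin]
    have h3 := Real.one_sub_sq_div_two_le_cos (x := θ)
    have h4 := Real.sin_lt hθ0
    have h5 : 0 ≤ Real.cos θ := Real.cos_nonneg_of_mem_Icc ⟨by linarith, hθ1⟩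
    nlinarith
  have hs3 : √3 ≤ 17321 / 10000 := by
    rw [Real.sqrt_le_left (by norm_num)]; norm_num
  have hl : ‖c.sum‖ ^ 2 ≤ 196 / 100 := by nlinarith [norm_nonneg c.sum]
  have h7 : (1 - θ ^ 2 / 2) * ‖c.sum‖ ^ 2 ≤ θ * (Real.cos θ / Real.sin θ) * ‖c.sum‖ ^ 2 := by
    gcongr
  have h8 : θ ^ 2 * ‖c.sum‖ ^ 2 ≤ θ ^ 2 * (196 / 100) := by gcongr
  have h9 : √3 * x ^ 2 ≤ 17321 / 10000 * x ^ 2 := by gcongr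
  nlinarith [mul_nonneg (sub_nonneg.mpr hu1) (sub_nonneg.mpr hu2)]

theorem tan_ge_of_bounds {x y t : ℝ} (hy : 0 < y) (hyx : y ≤ x) (hx : x ≤ 1)
    (h : t * (1 - y ^ 2 / 2 + y ^ 4 * (5 / 96)) ≤ y - y ^ 3 / 6 - y ^ 5 / 100) (ht : 0 ≤ t) :
    t ≤ Real.tan x := by
  have hpi := Real.pi_gt_three
  have hy1 : |y| ≤ 1 := by rw [abs_of_pos hy]; linarith
  have h1 := (abs_le.mp (Real.sin_bound hy1)).1
  have h2 := (abs_le.mp (Real.cos_bound hy1)).2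
  rw [abs_of_pos hy] at h1 h2
  have h3 : Real.sin y ≤ Real.sin x :=
    Real.sin_le_sin_of_le_of_le_pi_div_two (by linarith) (by linarith) hyx
  have h4 : Real.cos x ≤ Real.cos y :=
    Real.cos_le_cos_of_nonneg_of_le_pi hy.le (by linarith) hyx
  have h5 : 0 < Real.cos x := Real.cos_pos_of_mem_Ioo ⟨by linarith, by linarith⟩
  rw [Real.tan_eq_sin_div_cos, le_div_iff₀ h5]
  calc t * Real.cos x ≤ t * (1 - y ^ 2 / 2 + y ^ 4 * (5 / 96)) := by gcongr; linarith
    _ ≤ _ := h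
    _ ≤ _ := by linarith

theorem tan_pi_div_five_ge : 7265 / 10000 ≤ Real.tan (Real.pi / 5) := by
  have hpi := Real.pi_gt_three
  have hpi4 := Real.pi_le_four
  have hc := Real.cos_pi_div_five
  have h5 : √5 ≤ 2236068 / 1000000 := by rw [Real.sqrt_le_left (by norm_num)]; norm_num
  have h50 := Real.sqrt_nonneg 5
  have hs : 0 ≤ Real.sin (Real.pi / 5) :=
    Real.sin_nonneg_of_nonneg_of_le_pi (by positivity) (by linarith)
  have hcs := Real.sin_sq_add_cos_sq (Real.pi / 5)
  have hcp : 0 < Real.cos (Real.pi / 5) := by rw [hc]; positivity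
  rw [Real.tan_eq_sin_div_cos, le_div_iff₀ hcp]
  refine le_of_sq_le_sq ?_ hs
  have : Real.cos (Real.pi / 5) ≤ 80902 / 100000 := by rw [hc]; linarith
  nlinarith

theorem polygon_bound_three {l : List ℂ} (h0 : l.sum = 0) (hn : l.length = 3)
    (hA : 0 ≤ larea l) : 207 / 10 * larea l ≤ llen l ^ 2 := by
  have h := polygon_isoperimetric h0 hn.ge
  rw [hn] at h
  push_cast at h
  rw [Real.tan_pi_div_three] at h
  refine le_trans (mul_le_mul_of_nonneg_right ?_ hA) h
  have : (1725 / 1000 : ℝ) ≤ √3 := Real.le_sqrt_of_sq_le (by norm_num)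
  linarith

theorem polygon_bound_four {l : List ℂ} (h0 : l.sum = 0) (hn : l.length = 4) :
    16 * larea l ≤ llen l ^ 2 := by
  have h := polygon_isoperimetric h0 (by omega)
  rw [hn] at h
  push_cast at h
  rw [Real.tan_pi_div_four] at h
  linarith

theorem polygon_bound_five {l : List ℂ} (h0 : l.sum = 0) (hn : l.length = 5)
    (hA : 0 ≤ larea l) : 1453 / 100 * larea l ≤ llen l ^ 2 := by
  have h := polygon_isoperimetric h0 (by omega)
  rw [hn] at h
  push_cast at h
  refine le_trans (mul_le_mul_of_nonneg_right ?_ hA) h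
  linarith [tan_pi_div_five_ge]

theorem polygon_bound_six {l : List ℂ} (h0 : l.sum = 0) (hn : l.length = 6) :
    8 * √3 * larea l ≤ llen l ^ 2 := by
  have h := polygon_isoperimetric h0 (by omega)
  rw [hn] at h
  push_cast at h
  rw [Real.tan_pi_div_six] at h
  have h3 : √3 * √3 = 3 := Real.mul_self_sqrt (by norm_num)
  have : (4 : ℝ) * 6 * (1 / √3) = 8 * √3 := by
    have : √3 ≠ 0 := by positivity
    field_simp
    linarith
  rwa [this] at h

theorem polygon_bound_seven {l : List ℂ} (h0 : l.sum = 0) (hn : l.length = 7)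
    (hA : 0 ≤ larea l) : 1339 / 100 * larea l ≤ llen l ^ 2 := by
  have h := polygon_isoperimetric h0 (by omega)
  rw [hn] at h
  push_cast at h
  refine le_trans (mul_le_mul_of_nonneg_right ?_ hA) h
  have h1 := Real.pi_gt_d2
  have := tan_ge_of_bounds (x := Real.pi / 7) (y := 3.14 / 7) (t := 1339 / 2800) (by norm_num)
    (by linarith) (by linarith [Real.pi_le_four]) (by norm_num) (by norm_num)
  linarith

theorem polygon_bound_eight {l : List ℂ} (h0 : l.sum = 0) (hn : l.length = 8)
    (hA : 0 ≤ larea l) : 131 / 10 * larea l ≤ llen l ^ 2 := by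
  have h := polygon_isoperimetric h0 (by omega)
  rw [hn] at h
  push_cast at h
  refine le_trans (mul_le_mul_of_nonneg_right ?_ hA) h
  have h1 := Real.pi_gt_d2
  have := tan_ge_of_bounds (x := Real.pi / 8) (y := 3.14 / 8) (t := 131 / 320) (by norm_num)
    (by linarith) (by linarith [Real.pi_le_four]) (by norm_num) (by norm_num)
  linarith

/-- Truncation of a real number to the interval `[-1/2, 1/2]`. -/
noncomputable def trunc (x : ℝ) : ℝ := max (-(1 / 2)) (min (1 / 2) x)

theorem trunc_neg (x : ℝ) : trunc (-x) = -trunc x := by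
  unfold trunc
  rcases le_total (1 / 2) x with h | h <;> rcases le_total x (-(1 / 2)) with h' | h' <;>
    grind

theorem sq_trunc_le (x : ℝ) : 2 * trunc x ^ 2 ≤ |x| := by
  have h1 : |trunc x| ≤ 1 / 2 := by unfold trunc; grind
  have h2 : |trunc x| ≤ |x| := by unfold trunc; grind
  rw [← sq_abs]
  nlinarith [abs_nonneg (trunc x)]

theorem trunc_add_le_abs (x : ℝ) : max 0 (-trunc x) ≤ max 0 (-x) := by
  unfold trunc; grind

theorem trunc_eq_of_lt {x : ℝ} (h1 : max 0 (trunc x) < 1 / 2) (h2 : max 0 (-trunc x) < 1 / 2) :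
    trunc x = x := by
  unfold trunc at *; grind

theorem abs_larea_le_llen_sq (c : List ℂ) : 2 * Real.pi * |larea c| ≤ llen c ^ 2 := by
  have h := isoperimetric (l := c ++ c.map (-·)) (by rw [List.sum_append, sum_map_neg]; simp)
  rw [larea_append, larea_map_neg, llen_append, llen_map_neg, sum_map_neg, crossp_neg_right,
    crossp_self, neg_zero, zero_div, add_zero, ← two_mul, ← two_mul, abs_mul] at h
  norm_num at h
  nlinarith

theorem trunc_larea_le_llen (c : List ℂ) : 3544 / 1000 * |trunc (larea c)| ≤ llen c := by
  refine le_of_sq_le_sq ?_ (llen_nonneg c)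
  have h1 := abs_larea_le_llen_sq c
  have h2 := sq_trunc_le (larea c)
  have h3 := Real.pi_gt_d2
  rw [mul_pow, sq_abs]
  nlinarith [sq_nonneg (trunc (larea c)), abs_nonneg (larea c)]

/-- Half the perimeter of a regular hexagon of unit area. -/
noncomputable def hexK : ℝ := (12 : ℝ) ^ ((1 : ℝ) / 4)

theorem hexK_pos : 0 < hexK := by unfold hexK; positivity

theorem hexK_sq : hexK ^ 2 = 2 * √3 := by
  have h1 : hexK ^ 4 = 12 := by
    unfold hexK
    rw [← Real.rpow_natCast, ← Real.rpow_mul (by norm_num)]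
    norm_num
  have h2 : (2 * √3) ^ 2 = 12 := by rw [mul_pow, Real.sq_sqrt (by norm_num)]; norm_num
  refine (sq_eq_sq₀ (by positivity) (by positivity)).mp ?_
  rw [h2, ← h1]; ring

theorem hexK_gt : 18612 / 10000 ≤ hexK := by
  refine le_of_sq_le_sq ?_ hexK_pos.le
  rw [hexK_sq]
  have : (173205 / 100000 : ℝ) ≤ √3 := Real.le_sqrt_of_sq_le (by norm_num)
  linarith

theorem hexK_lt : hexK ≤ 18613 / 10000 := by
  refine le_of_sq_le_sq ?_ (by norm_num)
  rw [hexK_sq]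
  have : √3 ≤ 173206 / 100000 := by rw [Real.sqrt_le_left (by norm_num)]; norm_num
  linarith

theorem larea_flatten (C : List (List ℂ)) :
    larea C.flatten = larea (C.map List.sum) + (C.map larea).sum := by
  induction C with
  | nil => simp
  | cons c C ih =>
    simp only [List.flatten_cons, larea_append, ih, List.map_cons, larea_cons, List.sum_cons,
      List.sum_flatten]
    ring

theorem llen_flatten (C : List (List ℂ)) : llen C.flatten = (C.map llen).sum := by
  induction C with
  | nil => simp
  | cons c C ih => simp [ih]

theorem flatten_isoperimetric {C : List (List ℂ)} (h0 : C.flatten.sum = 0) :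
    4 * Real.pi * (larea (C.map List.sum) + (C.map fun c => |larea c|).sum)
      ≤ llen C.flatten ^ 2 := by
  set D := C.map fun c => if larea c < 0 then c.reverse else c with hD
  have h1 : D.map List.sum = C.map List.sum := by
    rw [hD, List.map_map]
    refine List.map_congr_left fun c _ => ?_
    simp only [Function.comp]
    split_ifs <;> simp
  have h2 : D.map larea = C.map fun c => |larea c| := by
    rw [hD, List.map_map]
    refine List.map_congr_left fun c _ => ?_
    simp only [Function.comp]
    split_ifs with h
    · rw [larea_reverse, abs_of_neg h]
    · rw [abs_of_nonneg (not_lt.mp h)]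
  have h3 : D.map llen = C.map llen := by
    rw [hD, List.map_map]
    refine List.map_congr_left fun c _ => ?_
    simp only [Function.comp]
    split_ifs <;> simp
  have h4 : D.flatten.sum = 0 := by rw [List.sum_flatten, h1, ← List.sum_flatten, h0]
  have := isoperimetric_pos h4
  rwa [larea_flatten, h1, h2, llen_flatten, h3, ← llen_flatten] at this

theorem sum_map_le_sum_map {ι : Type*} {l : List ι} {f g : ι → ℝ} (h : ∀ i ∈ l, f i ≤ g i) :
    (l.map f).sum ≤ (l.map g).sum := List.sum_le_sum h

theorem sum_map_add_real {ι : Type*} (l : List ι) (f g : ι → ℝ) :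
    (l.map fun i => f i + g i).sum = (l.map f).sum + (l.map g).sum := by
  induction l with
  | nil => simp
  | cons a l ih => simp [ih]; ring

theorem sum_map_sub_real {ι : Type*} (l : List ι) (f g : ι → ℝ) :
    (l.map fun i => f i - g i).sum = (l.map f).sum - (l.map g).sum := by
  induction l with
  | nil => simp
  | cons a l ih => simp [ih]; ring

theorem minkowski_list {ι : Type*} (l : List ι) (f g h : ι → ℝ) (hh : ∀ i ∈ l, 0 ≤ h i)
    (H : ∀ i ∈ l, f i ^ 2 + g i ^ 2 ≤ h i ^ 2) :
    (l.map f).sum ^ 2 + (l.map g).sum ^ 2 ≤ (l.map h).sum ^ 2 := by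
  induction l with
  | nil => simp
  | cons a l ih =>
    simp only [List.map_cons, List.sum_cons]
    have i1 := ih (fun i hi => hh i (List.mem_cons_of_mem _ hi))
      (fun i hi => H i (List.mem_cons_of_mem _ hi))
    have i2 := H a List.mem_cons_self
    have i3 := hh a List.mem_cons_self
    have i4 : 0 ≤ (l.map h).sum := List.sum_nonneg (by
      simp only [List.mem_map]
      rintro _ ⟨i, hi, rfl⟩
      exact hh i (List.mem_cons_of_mem _ hi))
    have i5 : f a * (l.map f).sum + g a * (l.map g).sum ≤ h a * (l.map h).sum := by
      refine le_of_sq_le_sq ?_ (by positivity)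
      rw [mul_pow]
      calc _ ≤ (f a ^ 2 + g a ^ 2) * ((l.map f).sum ^ 2 + (l.map g).sum ^ 2) := by
            nlinarith [sq_nonneg (f a * (l.map g).sum - g a * (l.map f).sum)]
        _ ≤ _ := by gcongr
    nlinarith

theorem llen_sq_ge_of_long_chord {p q : List ℂ} {v : ℂ} (h0 : (p ++ v :: q).sum = 0) :
    2 * Real.pi * larea (p ++ v :: q) ≤ (llen (p ++ v :: q) - ‖v‖) ^ 2 := by
  have h1 : (q ++ p).sum = -v := by
    simp only [List.sum_append, List.sum_cons] at h0 ⊢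
    linear_combination h0
  have h2 : larea (p ++ v :: q) = larea (q ++ p) := by
    simp only [larea_append, larea_cons]
    have h3 : p.sum = -(v + q.sum) := by
      simp only [List.sum_append, List.sum_cons] at h0
      linear_combination h0
    simp only [List.sum_cons, h3, crossp_neg_left, crossp_neg_right, crossp_self,
      crossp_add_left, crossp_add_right, crossp_comm q.sum v]
    ring
  have h3 : llen (p ++ v :: q) - ‖v‖ = llen (q ++ p) := by simp; ring
  rw [h2, h3]
  refine le_trans ?_ (abs_larea_le_llen_sq _)
  gcongr
  exact le_abs_self _

set_option maxHeartbeats 2000000 in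
theorem hexagonal_inequality {C : List (List ℂ)} (h0 : C.flatten.sum = 0)
    (hA : 0 < larea C.flatten)
    (hlen : llen C.flatten ≤ C.length * (188 / 100) * min 1 (larea C.flatten)) :
    2 * hexK * min 1 (larea C.flatten) - hexK * (C.map fun c => trunc (larea c)).sum
      - 7 / 100 * (C.length - 6) ≤ llen C.flatten := by
  set L := llen C.flatten with hL
  have hL0 : 0 ≤ L := llen_nonneg _
  set A := larea C.flatten with hAd
  set α := min 1 A with hα
  have hα0 : 0 < α := lt_min one_pos hA
  have hα1 : α ≤ 1 := min_le_left _ _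
  have hαA : α ≤ A := min_le_right _ _
  set P := larea (C.map List.sum) with hP
  set X := (C.map larea).sum with hX
  have hAP : A = P + X := larea_flatten C
  set a := (C.map fun c => max 0 (-trunc (larea c))).sum with ha
  set b := (C.map fun c => max 0 (trunc (larea c))).sum with hb
  have ha0 : 0 ≤ a := List.sum_nonneg (by simp)
  have hb0 : 0 ≤ b := List.sum_nonneg (by simp)
  have hT : (C.map fun c => trunc (larea c)).sum = b - a := by
    rw [hb, ha, ← sum_map_sub_real]
    congr 1
    refine List.map_congr_left fun c _ => ?_
    rcases le_total (trunc (larea c)) 0 with h | h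
    · rw [max_eq_left h, max_eq_right (by linarith)]; ring
    · rw [max_eq_right h, max_eq_left (by linarith)]; ring
  have hpi := Real.pi_gt_d2
  have hS : X + 2 * a ≤ (C.map fun c => |larea c|).sum := by
    rw [hX, ha, two_mul, ← sum_map_add_real, ← sum_map_add_real]
    refine sum_map_le_sum_map fun c _ => ?_
    have := trunc_add_le_abs (larea c)
    grind
  have hI1 : 1256 / 100 * (α + 2 * a) ≤ L ^ 2 := by
    refine le_trans ?_ (flatten_isoperimetric h0)
    have : α + 2 * a ≤ P + (C.map fun c => |larea c|).sum := by linarith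
    nlinarith
  have hI2 : 3544 / 1000 * (a + b) ≤ L := by
    rw [hL, llen_flatten, ha, hb, ← sum_map_add_real, ← List.sum_map_mul_left]
    refine sum_map_le_sum_map fun c _ => ?_
    refine le_trans ?_ (trunc_larea_le_llen c)
    gcongr
    grind
  have hc0 : (C.map List.sum).sum = 0 := by rw [← List.sum_flatten, h0]
  have hPL : llen (C.map List.sum) ≤ L := by
    rw [hL, llen_flatten, llen, List.map_map]
    exact sum_map_le_sum_map fun c _ => norm_sum_le_llen c
  have hPL2 : llen (C.map List.sum) ^ 2 ≤ L ^ 2 := by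
    have := llen_nonneg (C.map List.sum)
    gcongr
  have hmem : ∀ c ∈ C, max 0 (-trunc (larea c)) ≤ a ∧ max 0 (trunc (larea c)) ≤ b := by
    intro c hc
    constructor
    · exact List.single_le_sum (by simp) _ (List.mem_map_of_mem hc)
    · exact List.single_le_sum (by simp) _ (List.mem_map_of_mem hc)
  have hXT : a < 1 / 2 → b < 1 / 2 → X = b - a := by
    intro h1 h2
    rw [← hT, hX]
    congr 1
    refine List.map_congr_left fun c hc => ?_
    exact (trunc_eq_of_lt ((hmem c hc).2.trans_lt h2) ((hmem c hc).1.trans_lt h1)).symm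
  have hK1 := hexK_gt
  have hK2 := hexK_lt
  rw [hT]
  have hred : ∀ κ : ℝ, 18613 / 10000 * (2 * α + a) - 18612 / 10000 * b + κ ≤ L →
      2 * hexK * α - hexK * (b - a) + κ ≤ L := by
    intro κ h
    nlinarith
  have hN : ∀ k : ℕ, C.length = k → L ^ 2 ≤ (k * (188 / 100)) ^ 2 * α ^ 2 := by
    rintro k rfl
    rw [← mul_pow]
    gcongr
  have hNα : ∀ k : ℕ, C.length = k → 1256 / 100 ≤ (k * (188 / 100)) ^ 2 * α := by
    intro k hk
    have h1 := hN k hk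
    have h2 : 1256 / 100 * α ≤ (k * (188 / 100)) ^ 2 * α * α := by nlinarith
    exact le_of_mul_le_mul_right h2 hα0
  by_cases hal : 12 / 5 ≤ a ∧ 2 ≤ C.length
  · have hl : (2 : ℝ) ≤ C.length := by exact_mod_cast hal.2
    have := hred _ (numeric_large hα1 hal.1 hb0 hI2)
    linarith
  have hpoly : ∀ k : ℝ, (0 ≤ P → k * P ≤ llen (C.map List.sum) ^ 2) → 0 ≤ k →
      a < 1 / 2 → b < 1 / 2 → k * (α + a - b) ≤ L ^ 2 := by
    intro k hk hk0 h1 h2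
    have hy : α + a - b ≤ P := by linarith [hXT h1 h2]
    rcases le_total P 0 with h | h
    · nlinarith [sq_nonneg L]
    · exact (mul_le_mul_of_nonneg_left hy hk0).trans ((hk h).trans hPL2)
  have hlen' : (C.map List.sum).length = C.length := by simp
  rcases Nat.lt_or_ge 8 C.length with h9 | h9
  · have hl : (9 : ℝ) ≤ C.length := by exact_mod_cast h9
    push Not at hal
    have ha1 : a < 12 / 5 := by
      by_contra h
      have := hal (not_lt.mp h)
      omega
    have := hred (-(21 / 100)) (by
      linarith [numeric_nine hL0 hα0.le hα1 ha0 ha1.le hb0 hI1])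
    linarith
  have ha1 : 2 ≤ C.length → a ≤ 12 / 5 := by
    intro h2
    by_contra h
    exact hal ⟨(not_le.mp h).le, h2⟩
  interval_cases hk : C.length
  · have := hNα 0 rfl
    norm_num at this
  · have := hNα 1 rfl
    norm_num at this
    linarith
  · have hα2 := hNα 2 rfl
    have hb2 : 44 / 100 ≤ b := by
      obtain ⟨c1, c2, rfl⟩ : ∃ c1 c2, C = [c1, c2] := List.length_eq_two.mp hk
      have hP0 : P = 0 := by
        simp only [List.map_cons, List.map_nil, List.sum_cons, List.sum_nil, add_zero] at hc0
        rw [hP]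
        simp [larea_cons, eq_neg_of_add_eq_zero_left hc0, crossp_neg_left]
      have hX2 : X = larea c1 + larea c2 := by simp [hX]
      have hb2 : b = max 0 (trunc (larea c1)) + max 0 (trunc (larea c2)) := by simp [hb]
      have : 88 / 100 ≤ larea c1 + larea c2 := by
        norm_num at hα2
        linarith
      rw [hb2]
      simp only [trunc, max_def, min_def]
      split_ifs <;> linarith
    have := hred _ (numeric_two hL0 (by norm_num at hα2; linarith) hα1 ha0 (ha1 le_rfl) hb2 hI1)
    push_cast
    linarith
  · have h1 := hNα 3 rfl
    have := hred _ (numeric_three hL0 (by norm_num at h1; linarith) hα1 ha0 (ha1 (by norm_num))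
      hb0 hI1 (hpoly _ (polygon_bound_three hc0 hlen') (by norm_num)))
    push_cast
    linarith
  · have h1 := hNα 4 rfl
    have := hred _ (numeric_four hL0 (by norm_num at h1; linarith) hα1 ha0 (ha1 (by norm_num))
      hb0 hI1 (hpoly _ (fun _ => polygon_bound_four hc0 hlen') (by norm_num)))
    push_cast
    linarith
  · have h1 := hNα 5 rfl
    have := hred _ (numeric_five hL0 (by norm_num at h1; linarith) hα1 ha0 (ha1 (by norm_num))
      hb0 hI1 (hpoly _ (polygon_bound_five hc0 hlen') (by norm_num)))
    push_cast
    linarith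
  · rcases numeric_six hL0 hα0.le hα1 ha0 (ha1 (by norm_num)) hb0 hI1 with h | ⟨h1, h2, h3⟩
    · have := hred 0 (by linarith)
      push_cast
      linarith
    have hXe := hXT (by linarith) (by linarith)
    have hPy : α + a - b ≤ P := by linarith
    suffices hexK * (α + a - b + α) ≤ L by push_cast; linarith
    by_cases hch : ∃ c ∈ C, 14 / 10 ≤ ‖c.sum‖
    · obtain ⟨c, hc, hcl⟩ := hch
      obtain ⟨p, q, hpq⟩ := List.append_of_mem (List.mem_map_of_mem (f := List.sum) hc)
      have h5 := llen_sq_ge_of_long_chord (hpq ▸ hc0)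
      rw [← hpq, ← hP] at h5
      obtain ⟨q', hq0, hq⟩ : ∃ q' : ℝ, 0 ≤ q' ∧ q' ^ 2 = α + a - b :=
        ⟨√(α + a - b), Real.sqrt_nonneg _, Real.sq_sqrt (by linarith)⟩
      have hge : 0 ≤ llen (C.map List.sum) - ‖c.sum‖ := by
        rw [hpq]; simp
        linarith [llen_nonneg p, llen_nonneg q]
      have h6 : 25 / 10 * q' ≤ llen (C.map List.sum) - ‖c.sum‖ := by
        refine le_of_sq_bound hge hq (le_trans ?_ h5)
        nlinarith
      have q1 : 89 / 100 ≤ q' := by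
        refine le_of_sq_le_sq ?_ hq0
        rw [hq]; linarith
      have q2 : q' ≤ 107 / 100 := by
        refine le_of_sq_le_sq ?_ (by norm_num)
        rw [hq]; linarith
      have h7 : hexK * (α + a - b + α) ≤ 18613 / 10000 * (α + a - b + 1) := by
        gcongr
        linarith
      linarith [mul_nonneg (sub_nonneg.mpr q1) (sub_nonneg.mpr q2)]
    · push Not at hch
      have hs3 : 0 ≤ √3 := Real.sqrt_nonneg _
      have hm : (C.map fun c => ‖c.sum‖).sum ^ 2 + (C.map fun c => hexK * larea c).sum ^ 2 ≤
          (C.map llen).sum ^ 2 := by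
        refine minkowski_list C _ _ _ (fun c _ => llen_nonneg c) fun c hc => ?_
        rw [mul_pow, hexK_sq]
        refine chain_length_sq_ge ?_ (hch c hc).le
        have h5 := hmem c hc
        have h6 := trunc_eq_of_lt (h5.2.trans_lt (by linarith)) (h5.1.trans_lt (by linarith))
        rw [h6] at h5
        rw [abs_le]
        constructor
        · linarith [h5.1, le_max_right 0 (-larea c)]
        · linarith [h5.2, le_max_right 0 (larea c)]
      rw [← llen_flatten, ← hL, List.sum_map_mul_left, mul_pow] at hm
      have h8 := polygon_bound_six hc0 hlen'
      rw [← hP, llen, List.map_map] at h8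
      have h9 : 8 * √3 * (α + a - b) ≤ 8 * √3 * P := by gcongr
      have h10 : (C.map larea).sum ^ 2 = (b - a) ^ 2 := by rw [← hX, hXe]
      have h11 : (List.map (fun c => larea c) C).sum ^ 2 = (b - a) ^ 2 := h10
      rw [h11] at hm
      refine le_of_sq_le_sq ?_ hL0
      rw [mul_pow]
      have h12 : (List.map (norm ∘ List.sum) C).sum ^ 2
        = (List.map (fun c : List ℂ => ‖c.sum‖) C).sum ^ 2 := rfl
      rw [h12] at h8
      rw [hexK_sq] at hm ⊢
      have h13 : (α + a - b + α) ^ 2 ≤ 4 * (α + a - b) + (b - a) ^ 2 := by nlinarith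
      nlinarith
  · have := hred _ (numeric_seven hL0 hα0.le hα1 ha0 (ha1 (by norm_num))
      hb0 hI1 (hpoly _ (polygon_bound_seven hc0 hlen') (by norm_num)))
    push_cast
    linarith
  · have := hred _ (numeric_eight hL0 hα0.le hα1 ha0 (ha1 (by norm_num))
      hb0 hI1 (hpoly _ (polygon_bound_eight hc0 hlen') (by norm_num)))
    push_cast
    linarith

/-! ### First-return chains of a permutation -/

section FirstReturn

variable {D : Type*} [Fintype D] (φ : Equiv.Perm D) (M : Set D)

open Classical in
/-- The first positive time at which the orbit of `d` meets `M`. -/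
noncomputable def returnTime (d : D) : ℕ :=
  if h : ∃ n, 0 < n ∧ (φ ^ n) d ∈ M then Nat.find h else 0

variable {φ M}

omit [Fintype D] in
theorem returnTime_spec {d : D} (h : ∃ n, 0 < n ∧ (φ ^ n) d ∈ M) :
    0 < returnTime φ M d ∧ (φ ^ returnTime φ M d) d ∈ M := by
  classical
  rw [returnTime, dif_pos h]
  exact Nat.find_spec h

omit [Fintype D] in
theorem returnTime_min {d : D} {n : ℕ} (h0 : 0 < n) (hn : n < returnTime φ M d) :
    (φ ^ n) d ∉ M := by
  classical
  intro hM
  rw [returnTime, dif_pos ⟨n, h0, hM⟩] at hn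
  exact Nat.find_min _ hn ⟨h0, hM⟩

omit [Fintype D] in
theorem returnTime_eq {d : D} {n : ℕ} (h0 : 0 < n) (hn : (φ ^ n) d ∈ M)
    (hlt : ∀ i, 0 < i → i < n → (φ ^ i) d ∉ M) : returnTime φ M d = n := by
  have h := returnTime_spec (φ := φ) ⟨n, h0, hn⟩
  rcases lt_trichotomy (returnTime φ M d) n with h1 | h1 | h1
  · exact absurd h.2 (hlt _ h.1 h1)
  · exact h1
  · exact absurd hn (returnTime_min h0 h1)

omit [Fintype D] in
theorem exists_return (hM : ∀ d, ∃ n : ℕ, (φ ^ n) d ∈ M) (d : D) :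
    ∃ n, 0 < n ∧ (φ ^ n) d ∈ M := by
  obtain ⟨n, hn⟩ := hM (φ d)
  exact ⟨n + 1, n.succ_pos, by rwa [pow_succ]⟩

omit [Fintype D] in
/-- A point is reached from at most one marked point before the return time. -/
theorem chain_unique {d d' : D} (hd : d ∈ M) (hd' : d' ∈ M) {i i' : ℕ}
    (hi : i < returnTime φ M d) (hi' : i' < returnTime φ M d')
    (h : (φ ^ i) d = (φ ^ i') d') : d = d' ∧ i = i' := by
  wlog hii : i ≤ i' generalizing d d' i i'
  · obtain ⟨h1, h2⟩ := this hd' hd hi' hi h.symm (le_of_not_ge hii)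
    exact ⟨h1.symm, h2.symm⟩
  obtain ⟨k, rfl⟩ := Nat.exists_eq_add_of_le hii
  rw [pow_add, Equiv.Perm.mul_apply, (φ ^ i).injective.eq_iff] at h
  rcases Nat.eq_zero_or_pos k with rfl | hk
  · simpa using h
  · exact absurd (h ▸ hd) (returnTime_min hk (by omega))

theorem exists_chain (hM : ∀ d, ∃ n : ℕ, (φ ^ n) d ∈ M) (x : D) :
    ∃ d ∈ M, ∃ i < returnTime φ M d, (φ ^ i) d = x := by
  classical
  have h1 : ∃ n : ℕ, (φ⁻¹ ^ n) x ∈ M := by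
    obtain ⟨n, hn⟩ := hM x
    have h2 : Equiv.Perm.SameCycle φ⁻¹ x ((φ ^ n) x) := ⟨-n, by simp⟩
    obtain ⟨k, hk⟩ := h2.exists_nat_pow_eq
    exact ⟨k, by rwa [hk]⟩
  have h2 := Nat.find_spec h1
  set i := Nat.find h1
  refine ⟨_, h2, i, ?_, by simp⟩
  by_contra hlt
  push Not at hlt
  have h3 := returnTime_spec (exists_return hM ((φ⁻¹ ^ i) x))
  set k := returnTime φ M ((φ⁻¹ ^ i) x)
  refine Nat.find_min h1 (m := i - k) (by omega) ?_
  convert h3.2 using 1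
  obtain ⟨j, hj⟩ := Nat.exists_eq_add_of_le hlt
  rw [hj, Nat.add_sub_cancel_left, pow_add]
  simp

omit [Fintype D] in
theorem returnTime_pos (hM : ∀ d, ∃ n : ℕ, (φ ^ n) d ∈ M) (d : D) : 0 < returnTime φ M d :=
  (returnTime_spec (exists_return hM d)).1

omit [Fintype D] in
theorem pow_returnTime_mem (hM : ∀ d, ∃ n : ℕ, (φ ^ n) d ∈ M) (d : D) :
    (φ ^ returnTime φ M d) d ∈ M :=
  (returnTime_spec (exists_return hM d)).2

open Classical in
/-- Chains starting at marked points partition every invariant set. -/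
theorem sum_chain (hM : ∀ d, ∃ n : ℕ, (φ ^ n) d ∈ M) {S : Finset D}
    (hS : ∀ d, φ d ∈ S ↔ d ∈ S) {β : Type*} [AddCommMonoid β] (h : D → β) :
    ∑ d ∈ S with d ∈ M, ∑ i ∈ Finset.range (returnTime φ M d), h ((φ ^ i) d) =
      ∑ d ∈ S, h d := by
  have hS' : ∀ (n : ℕ) d, (φ ^ n) d ∈ S ↔ d ∈ S := by
    intro n
    induction n with
    | zero => simp
    | succ n ih => intro d; rw [pow_succ', Equiv.Perm.mul_apply, hS, ih]
  rw [Finset.sum_sigma']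
  refine Finset.sum_nbij (fun p => (φ ^ p.2) p.1) ?_ ?_ ?_ (fun _ _ => rfl)
  · rintro ⟨d, i⟩ hp
    simp only [Finset.mem_sigma, Finset.mem_filter] at hp
    exact (hS' i d).2 hp.1.1
  · rintro ⟨d, i⟩ hp ⟨d', i'⟩ hp' heq
    simp only [Finset.coe_sigma, Set.mem_sigma_iff, Finset.mem_coe, Finset.mem_filter,
      Finset.mem_range] at hp hp'
    obtain ⟨rfl, rfl⟩ := chain_unique hp.1.2 hp'.1.2 hp.2 hp'.2 heq
    rfl
  · intro x hx
    obtain ⟨d, hd, i, hi, rfl⟩ := exists_chain hM x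
    refine ⟨⟨d, i⟩, ?_, rfl⟩
    simp only [Finset.coe_sigma, Set.mem_sigma_iff, Finset.mem_coe, Finset.mem_filter,
      Finset.mem_range]
    exact ⟨⟨(hS' i d).1 hx, hd⟩, hi⟩

end FirstReturn

section Cycles

variable {D : Type*} [Fintype D]

/-- An invariant finite set of a permutation is a union of cycles. -/
theorem exists_cycle_lists (ψ : Equiv.Perm D) (T : Finset D) (hT : ∀ d, d ∈ T → ψ d ∈ T) :
    ∃ Ls : List (ℕ × D), (∀ p ∈ Ls, (ψ ^ p.1) p.2 = p.2) ∧
      ∀ {β : Type} [AddCommMonoid β] (h : D → β),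
        ∑ d ∈ T, h d =
          (Ls.map fun p => ((List.range p.1).map fun i => h ((ψ ^ i) p.2)).sum).sum := by
  classical
  induction T using Finset.strongInduction with
  | H T ih =>
    rcases T.eq_empty_or_nonempty with rfl | ⟨x, hx⟩
    · exact ⟨[], by simp, by simp⟩
    set n := Function.minimalPeriod ψ x with hn
    have hper : x ∈ Function.periodicPts ψ :=
      Function.Injective.mem_periodicPts ψ.injective x
    have hn0 : 0 < n := Function.minimalPeriod_pos_of_mem_periodicPts hper
    set O : Finset D := (Finset.range n).image fun i => (ψ ^ i) x with hO
    have hpow : ∀ i, (ψ ^ i) x ∈ T := by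
      intro i
      induction i with
      | zero => simpa
      | succ i ih => rw [pow_succ', Equiv.Perm.mul_apply]; exact hT _ ih
    have hOT : O ⊆ T := by
      intro y hy
      obtain ⟨i, -, rfl⟩ := Finset.mem_image.mp hy
      exact hpow i
    have hcl : (ψ ^ n) x = x := by
      rw [Equiv.Perm.coe_pow ψ n]
      exact Function.iterate_minimalPeriod
    have hxO : x ∈ O := Finset.mem_image.mpr ⟨0, Finset.mem_range.mpr hn0, rfl⟩
    have hinj : Set.InjOn (fun i => (ψ ^ i) x) (Finset.range n) := by
      intro i hi j hj hij
      simp only [Equiv.Perm.coe_pow] at hij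
      exact Function.iterate_injOn_Iio_minimalPeriod (f := ψ) (x := x)
        (by simpa using hi) (by simpa using hj) hij
    have hback : ∀ d, ψ d ∈ O → d ∈ O := by
      intro d hd
      obtain ⟨i, hi, hid⟩ := Finset.mem_image.mp hd
      rw [Finset.mem_range] at hi
      rcases i with _ | i
      · refine Finset.mem_image.mpr ⟨n - 1, Finset.mem_range.mpr (by omega), ?_⟩
        apply ψ.injective
        rw [← hid, ← Equiv.Perm.mul_apply, ← pow_succ', Nat.sub_add_cancel hn0, hcl]
        rfl
      · refine Finset.mem_image.mpr ⟨i, Finset.mem_range.mpr (by omega), ?_⟩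
        apply ψ.injective
        rw [← hid, ← Equiv.Perm.mul_apply, ← pow_succ']
    obtain ⟨Ls, h1, h2⟩ := ih (T \ O)
      (Finset.ssubset_iff_subset_ne.mpr ⟨Finset.sdiff_subset, fun h => by
        have := h ▸ hx
        exact (Finset.mem_sdiff.mp this).2 hxO⟩)
      (fun d hd => by
        rw [Finset.mem_sdiff] at hd ⊢
        exact ⟨hT d hd.1, fun h => hd.2 (hback d h)⟩)
    refine ⟨(n, x) :: Ls, ?_, ?_⟩
    · simpa using ⟨hcl, fun a b h => h1 (a, b) h⟩
    · intro β _ h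
      rw [List.map_cons, List.sum_cons, ← h2 h, ← Finset.sum_sdiff hOT, add_comm]
      congr 1
      rw [hO, Finset.sum_image hinj, ← List.sum_toFinset _ (List.nodup_range)]
      congr 1
      ext; simp

end Cycles

section Chains

variable {D : Type*} [Fintype D] (φ : Equiv.Perm D) (M : Set D) (vec : D → ℂ)

/-- The list of edge vectors from `d` up to the next marked dart. -/
noncomputable def chainList (d : D) : List ℂ :=
  (List.range (returnTime φ M d)).map fun i => vec ((φ ^ i) d)

variable {φ M vec}

omit [Fintype D] in
theorem sum_map_range_pow {p : D → ℂ} (hp : ∀ d, p (φ d) = p d + vec d) (d : D) (n : ℕ) :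
    ((List.range n).map fun i => vec ((φ ^ i) d)).sum = p ((φ ^ n) d) - p d := by
  induction n with
  | zero => simp
  | succ n ih =>
    rw [List.range_succ, List.map_append, List.sum_append, ih, pow_succ', Equiv.Perm.mul_apply,
      hp]
    simp
    ring

omit [Fintype D] in
theorem larea_map_range_pow {p : D → ℂ} (hp : ∀ d, p (φ d) = p d + vec d) (d : D) (n : ℕ) :
    larea ((List.range n).map fun i => vec ((φ ^ i) d)) =
      (∑ i ∈ Finset.range n, crossp (p ((φ ^ i) d)) (vec ((φ ^ i) d))) / 2
        - crossp (p d) (p ((φ ^ n) d)) / 2 := by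
  induction n with
  | zero => simp [crossp_self]
  | succ n ih =>
    rw [List.range_succ, List.map_append, larea_append, ih, Finset.sum_range_succ,
      sum_map_range_pow hp, pow_succ', Equiv.Perm.mul_apply, hp]
    simp [crossp_add_right, sub_eq_add_neg, crossp_add_left, crossp_neg_left]
    ring

omit [Fintype D] in
theorem sum_flatten_chains {c : D → List ℂ} {ψ : Equiv.Perm D} {p : D → ℂ}
    (hc : ∀ d, (c d).sum = p (ψ d) - p d) (d : D) (n : ℕ) :
    (((List.range n).map fun i => c ((ψ ^ i) d)).flatten).sum = p ((ψ ^ n) d) - p d := by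
  induction n with
  | zero => simp
  | succ n ih =>
    rw [List.range_succ, List.map_append, List.flatten_append, List.sum_append, ih, pow_succ',
      Equiv.Perm.mul_apply]
    simp [hc]

omit [Fintype D] in
theorem larea_flatten_chains {c : D → List ℂ} {ψ : Equiv.Perm D} {p : D → ℂ} {a : D → ℝ}
    (hc : ∀ d, (c d).sum = p (ψ d) - p d)
    (ha : ∀ d, larea (c d) = a d - crossp (p d) (p (ψ d)) / 2) (d : D) (n : ℕ) :
    larea (((List.range n).map fun i => c ((ψ ^ i) d)).flatten) =
      ((List.range n).map fun i => a ((ψ ^ i) d)).sum - crossp (p d) (p ((ψ ^ n) d)) / 2 := by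
  induction n with
  | zero => simp [crossp_self]
  | succ n ih =>
    rw [List.range_succ, List.map_append, List.flatten_append, larea_append, ih,
      sum_flatten_chains hc, pow_succ', Equiv.Perm.mul_apply]
    simp [hc, ha, crossp_add_right, sub_eq_add_neg, crossp_add_left, crossp_neg_left,
      crossp_neg_right]
    ring

theorem larea_flatten_of_closed {C : List (List ℂ)} (h : ∀ c ∈ C, c.sum = 0) :
    larea C.flatten = (C.map larea).sum := by
  induction C with
  | nil => simp
  | cons c C ih =>
    have h1 : c.sum = 0 := h c (by simp)
    rw [List.flatten_cons, larea_append, ih fun c hc => h c (by simp [hc]), h1]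
    simp

open Classical in
/-- The first-return permutation of the marked points. -/
noncomputable def firstReturn (hM : ∀ d, ∃ n : ℕ, (φ ^ n) d ∈ M) : Equiv.Perm M :=
  Equiv.ofBijective (fun d => ⟨(φ ^ returnTime φ M d.1) d, pow_returnTime_mem hM d.1⟩) <| by
    refine Function.Injective.bijective_of_finite ?_
    rintro ⟨d, hd⟩ ⟨d', hd'⟩ h
    simp only [Subtype.mk.injEq] at h ⊢
    obtain ⟨k, hk⟩ := Nat.exists_eq_succ_of_ne_zero (returnTime_pos hM d).ne'
    obtain ⟨k', hk'⟩ := Nat.exists_eq_succ_of_ne_zero (returnTime_pos hM d').ne'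
    rw [hk, hk', pow_succ', pow_succ', Equiv.Perm.mul_apply, Equiv.Perm.mul_apply,
      φ.injective.eq_iff] at h
    exact (chain_unique hd hd' (by omega) (by omega) h).1

theorem firstReturn_apply (hM : ∀ d, ∃ n : ℕ, (φ ^ n) d ∈ M) (d : M) :
    (firstReturn hM d : D) = (φ ^ returnTime φ M d.1) d := rfl

open Classical in
/-- The darts of an invariant set can be listed as closed sequences of chains. -/
theorem exists_chain_lists (hM : ∀ d, ∃ n : ℕ, (φ ^ n) d ∈ M) {p : D → ℂ}
    (hp : ∀ d, p (φ d) = p d + vec d) {S : Finset D} (hS : ∀ d, φ d ∈ S ↔ d ∈ S) :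
    ∃ C : List (List ℂ), C.flatten.sum = 0 ∧ llen C.flatten = ∑ d ∈ S, ‖vec d‖ ∧
      larea C.flatten = (∑ d ∈ S, crossp (p d) (vec d)) / 2 ∧
      C.length = {d ∈ S | d ∈ M}.card ∧
      (C.map fun c => trunc (larea c)).sum =
        ∑ d ∈ S with d ∈ M, trunc (larea (chainList φ M vec d)) := by
  have hS' : ∀ (n : ℕ) d, (φ ^ n) d ∈ S ↔ d ∈ S := by
    intro n
    induction n with
    | zero => simp
    | succ n ih => intro d; rw [pow_succ', Equiv.Perm.mul_apply, hS, ih]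
  set ψ := firstReturn hM
  set c : M → List ℂ := fun d => chainList φ M vec d
  obtain ⟨Ls, h1, h2⟩ := exists_cycle_lists ψ (S.subtype (· ∈ M)) (by
    rintro ⟨d, hd⟩ h
    simp only [Finset.mem_subtype] at h ⊢
    rw [firstReturn_apply]
    exact (hS' _ _).2 h)
  have h2' : ∀ {β : Type} [AddCommMonoid β] (h : D → β),
      ∑ d ∈ S with d ∈ M, h d = (Ls.map fun q => ((List.range q.1).map fun i =>
        h ((ψ ^ i) q.2 : M)).sum).sum := by
    intro β _ h
    rw [← h2 (fun d : M => h d), Finset.sum_subtype_eq_sum_filter]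
  have hc : ∀ d : M, (c d).sum = p (ψ d) - p d := fun d => sum_map_range_pow hp d.1 _
  have hcl : ∀ q ∈ Ls, (((List.range q.1).map fun i => c ((ψ ^ i) q.2)).flatten).sum = 0 := by
    intro q hq
    rw [sum_flatten_chains (p := fun d : M => p d) hc, h1 q hq, sub_self]
  refine ⟨(Ls.map fun q => (List.range q.1).map fun i => c ((ψ ^ i) q.2)).flatten, ?_, ?_, ?_,
    ?_, ?_⟩
  · rw [List.flatten_flatten, List.map_map, List.sum_flatten, List.map_map]
    refine List.sum_eq_zero ?_
    intro x hx
    obtain ⟨q, hq, rfl⟩ := List.mem_map.mp hx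
    exact hcl q hq
  · rw [← sum_chain hM hS (fun d => ‖vec d‖), h2' fun d =>
      ∑ i ∈ Finset.range (returnTime φ M d), ‖vec ((φ ^ i) d)‖]
    rw [List.flatten_flatten, List.map_map, llen_flatten, List.map_map]
    congr 1
    refine List.map_congr_left fun q hq => ?_
    simp only [Function.comp]
    rw [llen_flatten, List.map_map]
    congr 1
    refine List.map_congr_left fun i hi => ?_
    simp only [Function.comp, c, chainList, llen, List.map_map]
    rw [← List.sum_toFinset _ (List.nodup_range)]
    refine Finset.sum_congr (by ext; simp) fun _ _ => rfl
  · rw [← sum_chain hM hS, h2' fun d =>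
      ∑ i ∈ Finset.range (returnTime φ M d), crossp (p ((φ ^ i) d)) (vec ((φ ^ i) d))]
    rw [List.flatten_flatten, List.map_map, larea_flatten_of_closed, List.map_map]
    · rw [div_eq_mul_inv, ← List.sum_map_mul_right]
      congr 1
      refine List.map_congr_left fun q hq => ?_
      simp only [Function.comp]
      rw [larea_flatten_chains (p := fun d : M => p d) (a := fun d : M =>
        (∑ i ∈ Finset.range (returnTime φ M d.1),
          crossp (p ((φ ^ i) d)) (vec ((φ ^ i) d))) / 2) hc
        (fun d => larea_map_range_pow hp d.1 _), h1 q hq, crossp_self, zero_div, sub_zero,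
        ← List.sum_map_mul_right]
      simp only [div_eq_mul_inv]
    · intro x hx
      obtain ⟨q, hq, rfl⟩ := List.mem_map.mp hx
      exact hcl q hq
  · rw [Finset.card_eq_sum_ones, h2' fun _ => 1, List.length_flatten, List.map_map]
    congr 1
    refine List.map_congr_left fun q hq => ?_
    simp
  · rw [h2' fun d => trunc (larea (chainList φ M vec d)), List.map_flatten, List.map_map,
      List.sum_flatten, List.map_map]
    congr 1
    refine List.map_congr_left fun q hq => ?_
    simp only [Function.comp, List.map_map]
    rfl

omit [Fintype D] in
theorem pow_rev {rev : D → D} (hrev : ∀ d ∉ M, φ (rev d) = rev (φ⁻¹ d)) (d : D) {i : ℕ}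
    (hi : i < returnTime φ M d) :
    (φ ^ i) (rev ((φ ^ (returnTime φ M d - 1)) d)) =
      rev ((φ ^ (returnTime φ M d - 1 - i)) d) := by
  induction i with
  | zero => simp
  | succ i ih =>
    rw [pow_succ', Equiv.Perm.mul_apply, ih (by omega),
      hrev _ (returnTime_min (by omega) (by omega))]
    obtain ⟨k, hk⟩ : ∃ k, returnTime φ M d - 1 - i = k + 1 := ⟨returnTime φ M d - 2 - i, by omega⟩
    rw [hk, show returnTime φ M d - 1 - (i + 1) = k by omega, pow_succ', Equiv.Perm.mul_apply]
    simp

/-- The signed areas of the chains cancel when each chain can be traversed backwards. -/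
theorem sum_trunc_chain_eq_zero [DecidablePred (· ∈ M)] (hM : ∀ d, ∃ n : ℕ, (φ ^ n) d ∈ M)
    {rev : D → D}
    (hinv : ∀ d, rev (rev d) = d) (hvec : ∀ d, vec (rev d) = -vec d)
    (hrev : ∀ d ∉ M, φ (rev d) = rev (φ⁻¹ d)) (hmark : ∀ d, rev d ∈ M ↔ φ d ∈ M) :
    ∑ d with d ∈ M, trunc (larea (chainList φ M vec d)) = 0 := by
  classical
  set e : D → D := fun d => rev ((φ ^ (returnTime φ M d - 1)) d) with he
  have hlast : ∀ d, φ ((φ ^ (returnTime φ M d - 1)) d) ∈ M := by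
    intro d
    rw [← Equiv.Perm.mul_apply, ← pow_succ', Nat.sub_add_cancel (returnTime_pos hM d)]
    exact pow_returnTime_mem hM d
  have heM : ∀ d, e d ∈ M := fun d => (hmark _).2 (hlast d)
  have hret : ∀ d ∈ M, returnTime φ M (e d) = returnTime φ M d := by
    intro d hd
    have h0 := returnTime_pos hM d
    refine returnTime_eq h0 ?_ ?_
    · obtain ⟨k, hk⟩ := Nat.exists_eq_succ_of_ne_zero h0.ne'
      have h1 := pow_rev hrev d (i := k) (by omega)
      rw [hk, pow_succ', Equiv.Perm.mul_apply, h1, hk, ← hmark, hinv]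
      simpa using hd
    · intro i hi0 hi h1
      obtain ⟨k, rfl⟩ := Nat.exists_eq_succ_of_ne_zero hi0.ne'
      rw [pow_rev hrev d hi, hmark, ← Equiv.Perm.mul_apply, ← pow_succ'] at h1
      exact returnTime_min (by omega) (by omega) h1
  have hee : ∀ d ∈ M, e (e d) = d := by
    intro d hd
    have h0 := returnTime_pos hM d
    have h1 := pow_rev hrev d (i := returnTime φ M d - 1) (by omega)
    change rev ((φ ^ (returnTime φ M (e d) - 1)) (e d)) = d
    rw [hret d hd, h1, Nat.sub_self, pow_zero, Equiv.Perm.one_apply, hinv]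
  have hlist : ∀ d ∈ M, chainList φ M vec (e d) = ((chainList φ M vec d).map (-·)).reverse := by
    intro d hd
    rw [chainList, chainList, hret d hd]
    refine List.ext_getElem (by simp) fun i h1 h2 => ?_
    simp only [List.length_map, List.length_range] at h1
    simp only [List.getElem_map, List.getElem_range, List.getElem_reverse, List.length_map,
      List.length_range]
    rw [← hvec, pow_rev hrev d h1]
  have hsum : ∑ d with d ∈ M, trunc (larea (chainList φ M vec d)) =
      ∑ d with d ∈ M, trunc (larea (chainList φ M vec (e d))) := by
    symm
    refine Finset.sum_nbij' e e ?_ ?_ ?_ ?_ ?_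
    · intro d _; simpa using heM d
    · intro d _; simpa using heM d
    · intro d hd; exact hee d (by simpa using hd)
    · intro d hd; exact hee d (by simpa using hd)
    · intro d hd; rfl
  have hneg : ∑ d with d ∈ M, trunc (larea (chainList φ M vec (e d))) =
      -∑ d with d ∈ M, trunc (larea (chainList φ M vec d)) := by
    rw [← Finset.sum_neg_distrib]
    refine Finset.sum_congr rfl fun d hd => ?_
    rw [hlist d (by simpa using hd), larea_reverse, larea_map_neg, trunc_neg]
  linarith

end Chains

/-! ### Combinatorial plane complexes -/

/-- A finite planar cell complex with straight edges, given by the incidences of its edges.  The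
field `exact` says that every cycle is a combination of face boundaries. -/
structure PlaneComplex (F E V : Type) [Fintype F] [Fintype E] [Fintype V] [DecidableEq F]
    [DecidableEq V] where
  src : E → V
  tgt : E → V
  left : E → F
  right : E → F
  pos : V → ℂ
  outer : F
  balanced : ∀ f ≠ outer, ∀ g : V → ℝ, ∑ e, ((if left e = f then g (tgt e) - g (src e) else 0) -
    (if right e = f then g (tgt e) - g (src e) else 0)) = 0
  exact : ∀ z : E → ℝ, (∀ v, ∑ e, z e * ((if src e = v then 1 else 0) -
    (if tgt e = v then 1 else 0)) = 0) → ∃ u : F → ℝ, ∀ e, z e = u (left e) - u (right e)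
  connected : ∀ S : Set F, outer ∈ S → (∀ e, left e ∈ S ↔ right e ∈ S) → ∀ f, f ∈ S
  area_nonneg : ∀ f ≠ outer, 0 ≤ ∑ e, ((if left e = f then crossp (pos (src e)) (pos (tgt e))
    else 0) - (if right e = f then crossp (pos (src e)) (pos (tgt e)) else 0))

theorem exists_perm_of_fiber_card {D T : Type*} [Fintype D] [DecidableEq T] (p q : D → T)
    (h : ∀ t, Fintype.card {d // p d = t} = Fintype.card {d // q d = t}) :
    ∃ φ : Equiv.Perm D, ∀ d, q (φ d) = p d := by
  have e := fun t => Fintype.equivOfCardEq (h t)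
  refine ⟨(Equiv.sigmaFiberEquiv p).symm.trans
    ((Equiv.sigmaCongrRight e).trans (Equiv.sigmaFiberEquiv q)), fun d => ?_⟩
  exact (e (p d) ⟨d, rfl⟩).2

namespace PlaneComplex

variable {F E V : Type} [Fintype F] [Fintype E] [Fintype V] [DecidableEq F] [DecidableEq V]
  (X : PlaneComplex F E V)

/-- The reversed dart. -/
def rev (d : E × Bool) : E × Bool := (d.1, !d.2)

/-- The initial vertex of a dart. -/
def tail (d : E × Bool) : V := bif d.2 then X.src d.1 else X.tgt d.1

/-- The face on the left of a dart. -/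
def face (d : E × Bool) : F := bif d.2 then X.left d.1 else X.right d.1

/-- The displacement along a dart. -/
def vec (d : E × Bool) : ℂ := X.pos (X.tail (rev d)) - X.pos (X.tail d)

/-- The signed area of a face. -/
noncomputable def area (f : F) : ℝ :=
  (∑ d, if X.face d = f then crossp (X.pos (X.tail d)) (X.vec d) else 0) / 2

omit [Fintype E] in
@[simp] theorem rev_rev (d : E × Bool) : rev (rev d) = d := by simp [rev]

theorem sum_rev (h : E × Bool → ℝ) : ∑ d, h (rev d) = ∑ d, h d :=
  Equiv.sum_comp (Function.Involutive.toPerm rev rev_rev) h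

theorem vec_rev (d : E × Bool) : X.vec (rev d) = -X.vec d := by simp [vec]

theorem sum_eq_zero_of_antisymm {h : E × Bool → ℝ} (hh : ∀ d, h (rev d) = -h d) :
    ∑ d, h d = 0 := by
  have h1 := sum_rev h
  simp only [hh, Finset.sum_neg_distrib] at h1
  linarith

theorem crossp_antisymm (d : E × Bool) :
    crossp (X.pos (X.tail (rev d))) (X.vec (rev d)) = -crossp (X.pos (X.tail d)) (X.vec d) := by
  simp only [vec, rev_rev, crossp]
  simp
  ring

theorem area_nonneg' {f : F} (hf : f ≠ X.outer) : 0 ≤ X.area f := by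
  have h := X.area_nonneg f hf
  refine div_nonneg (h.trans_eq ?_) zero_le_two
  rw [Fintype.sum_prod_type]
  refine Finset.sum_congr rfl fun e _ => ?_
  rw [Fintype.sum_bool]
  simp only [face, tail, vec, rev, crossp, Bool.not_true, Bool.not_false, cond_true, cond_false]
  split_ifs <;> simp <;> ring

theorem sum_face_eq_zero (f : F) (g : V → ℝ) :
    ∑ d, (if X.face d = f then g (X.tail (rev d)) - g (X.tail d) else 0) = 0 := by
  have key : ∀ f ≠ X.outer,
      ∑ d, (if X.face d = f then g (X.tail (rev d)) - g (X.tail d) else 0) = 0 := by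
    intro f hf
    refine Eq.trans ?_ (X.balanced f hf g)
    rw [Fintype.sum_prod_type]
    refine Finset.sum_congr rfl fun e _ => ?_
    rw [Fintype.sum_bool]
    simp only [face, tail, rev, Bool.not_true, Bool.not_false, cond_true, cond_false]
    split_ifs <;> simp
  by_cases hf : f = X.outer
  · have h0 : ∑ f, ∑ d, (if X.face d = f then g (X.tail (rev d)) - g (X.tail d) else 0) = 0 := by
      rw [Finset.sum_comm]
      simp only [Finset.sum_ite_eq, Finset.mem_univ, if_true]
      exact sum_eq_zero_of_antisymm fun d => by simp
    rw [← Finset.add_sum_erase _ _ (Finset.mem_univ f),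
      Finset.sum_eq_zero fun f' hf' => key f' (hf ▸ Finset.ne_of_mem_erase hf'), add_zero] at h0
    exact h0
  · exact key f hf

section Labeling

variable {T : Type} [DecidableEq T] (c : F → T)

/-- The boundary darts of the class labelled `j`, with the class on their left. -/
def classDarts (j : T) : Finset (E × Bool) := {d | c (X.face d) = j ∧ c (X.face (rev d)) ≠ j}

/-- The area of the class labelled `j`. -/
noncomputable def classArea (j : T) : ℝ := ∑ f with c f = j, X.area f

/-- The perimeter of the class labelled `j`. -/
noncomputable def classLength (j : T) : ℝ := ∑ d ∈ X.classDarts c j, ‖X.vec d‖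

theorem sum_classDarts {h : E × Bool → ℝ} (hh : ∀ d, h (rev d) = -h d) (j : T) :
    ∑ d ∈ X.classDarts c j, h d =
      ∑ f with c f = j, ∑ d, if X.face d = f then h d else 0 := by
  have h1 : ∑ d with c (X.face d) = j ∧ c (X.face (rev d)) = j, h d = 0 := by
    rw [Finset.sum_filter]
    refine sum_eq_zero_of_antisymm fun d => ?_
    by_cases h1 : c (X.face d) = j <;> by_cases h2 : c (X.face (rev d)) = j <;> simp [h1, h2, hh]
  rw [Finset.sum_comm]
  have h2 : ∀ d, (∑ f with c f = j, if X.face d = f then h d else 0) =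
      if c (X.face d) = j then h d else 0 := by
    intro d
    rw [Finset.sum_ite_eq]
    simp
  simp only [h2]
  rw [← Finset.sum_filter, ← Finset.sum_filter_add_sum_filter_not
    ({d | c (X.face d) = j} : Finset (E × Bool)) (fun d => c (X.face (rev d)) = j), Finset.filter_filter, Finset.filter_filter, h1, zero_add]
  rfl

theorem sum_classDarts_eq_zero (g : V → ℝ) (j : T) :
    ∑ d ∈ X.classDarts c j, (g (X.tail (rev d)) - g (X.tail d)) = 0 := by
  rw [X.sum_classDarts c (h := fun d => g (X.tail (rev d)) - g (X.tail d)) (fun d => by simp)]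
  exact Finset.sum_eq_zero fun f _ => X.sum_face_eq_zero f g

theorem classArea_eq (j : T) :
    X.classArea c j = (∑ d ∈ X.classDarts c j, crossp (X.pos (X.tail d)) (X.vec d)) / 2 := by
  rw [X.sum_classDarts c X.crossp_antisymm, classArea, Finset.sum_div]
  rfl

/-- The darts separating two classes. -/
abbrev Interface := {d : E × Bool // c (X.face d) ≠ c (X.face (rev d))}

/-- Reversal of interface darts. -/
def irev (d : X.Interface c) : X.Interface c := ⟨rev d.1, by simpa using d.2.symm⟩

omit [DecidableEq T] in
@[simp] theorem irev_irev (d : X.Interface c) : X.irev c (X.irev c d) = d := by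
  simp [irev]

theorem exists_next : ∃ φ : Equiv.Perm (X.Interface c), ∀ d,
    X.tail (φ d).1 = X.tail (rev d.1) ∧ c (X.face (φ d).1) = c (X.face d.1) := by
  obtain ⟨φ, hφ⟩ := exists_perm_of_fiber_card
    (fun d : X.Interface c => (X.tail (rev d.1), c (X.face d.1)))
    (fun d : X.Interface c => (X.tail d.1, c (X.face d.1))) (by
      rintro ⟨v, j⟩
      have h := X.sum_classDarts_eq_zero c (fun w => if w = v then 1 else 0) j
      rw [Finset.sum_sub_distrib, sub_eq_zero, Finset.sum_boole, Finset.sum_boole,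
        Nat.cast_inj] at h
      have key : ∀ t : E × Bool → V,
          Fintype.card {d : X.Interface c // (t d.1, c (X.face d.1)) = (v, j)} =
            ({d ∈ X.classDarts c j | t d = v}).card := by
        intro t
        rw [← Fintype.card_coe]
        refine Fintype.card_congr
          ⟨fun d => ⟨d.1.1, ?_⟩, fun d => ⟨⟨d.1, ?_⟩, ?_⟩, fun d => rfl, fun d => rfl⟩
        · have h1 := d.2
          have h2 := d.1.2
          simp only [Prod.mk.injEq] at h1
          simp only [classDarts, Finset.mem_filter, Finset.mem_univ, true_and]
          exact ⟨⟨h1.2, fun h => h2 (h1.2.trans h.symm)⟩, h1.1⟩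
        · have := d.2
          simp only [classDarts, Finset.mem_filter, Finset.mem_univ, true_and] at this
          rw [this.1.1]
          exact this.1.2.symm
        · have := d.2
          simp only [classDarts, Finset.mem_filter, Finset.mem_univ, true_and] at this
          exact Prod.ext this.2 this.1.1
      rw [key fun d => X.tail (rev d), key X.tail, h])
  exact ⟨φ, fun d => by simpa using hφ d⟩

end Labeling

end PlaneComplex

namespace PlaneComplex

variable {F E V : Type} [Fintype F] [Fintype E] [Fintype V] [DecidableEq F] [DecidableEq V]
  (X : PlaneComplex F E V) {T : Type} [DecidableEq T] (c : F → T)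

/-- A labelling has connected classes when functions that are constant across the edges inside
the classes are constant on the classes. -/
def ConnectedClasses : Prop :=
  ∀ u : F → ℝ, (∀ e, c (X.left e) = c (X.right e) → u (X.left e) = u (X.right e)) →
    ∀ f f', c f = c f' → u f = u f'

/-- The boundary of a real chain of edges. -/
noncomputable def bdry (z : E → ℝ) (v : V) : ℝ :=
  ∑ e, z e * ((if X.src e = v then 1 else 0) - (if X.tgt e = v then 1 else 0))

/-- The edges separating two classes. -/
def ifaceEdges : Finset E := {e | c (X.left e) ≠ c (X.right e)}

/-- The labels of the classes not containing the outer face. -/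
def innerLabels : Finset T := (Finset.univ.image c).erase (c X.outer)

/-- The number of interface darts issuing from a vertex. -/
def deg (v : V) : ℕ := ({d | X.tail d.1 = v} : Finset (X.Interface c)).card

variable {c}

theorem card_ifaceEdges_le (hc : X.ConnectedClasses c) {W : Finset V}
    (hW : ∀ z : E → ℝ, (∀ e ∉ X.ifaceEdges c, z e = 0) → (∀ v ∈ W, X.bdry z v = 0) →
      ∀ v, X.bdry z v = 0) :
    (X.ifaceEdges c).card ≤ W.card + (X.innerLabels c).card := by
  classical
  let ext : (X.ifaceEdges c → ℝ) →ₗ[ℝ] (E → ℝ) :=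
    { toFun := fun z e => if h : e ∈ X.ifaceEdges c then z ⟨e, h⟩ else 0
      map_add' := fun z w => by ext e; dsimp; split_ifs <;> simp
      map_smul' := fun r z => by ext e; dsimp; split_ifs <;> simp }
  let A : (X.ifaceEdges c → ℝ) →ₗ[ℝ] (W → ℝ) :=
    { toFun := fun z v => X.bdry (ext z) v
      map_add' := fun z w => by
        ext v
        simp only [map_add, bdry, Pi.add_apply, add_mul, Finset.sum_add_distrib]
      map_smul' := fun r z => by
        ext v
        simp only [map_smul, bdry, Pi.smul_apply, smul_eq_mul, mul_assoc, Finset.mul_sum,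
          RingHom.id_apply] }
  let ext' : (X.innerLabels c → ℝ) →ₗ[ℝ] (T → ℝ) :=
    { toFun := fun y j => if h : j ∈ X.innerLabels c then y ⟨j, h⟩ else 0
      map_add' := fun z w => by ext e; dsimp; split_ifs <;> simp
      map_smul' := fun r z => by ext e; dsimp; split_ifs <;> simp }
  let B : (X.innerLabels c → ℝ) →ₗ[ℝ] (X.ifaceEdges c → ℝ) :=
    { toFun := fun y e => ext' y (c (X.left e)) - ext' y (c (X.right e))
      map_add' := fun z w => by ext e; simp only [map_add, Pi.add_apply]; ring
      map_smul' := fun r z => by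
        ext e
        simp only [map_smul, Pi.smul_apply, smul_eq_mul, RingHom.id_apply]
        ring }
  have hle : LinearMap.ker A ≤ LinearMap.range B := by
    intro z hz
    have h0 : ∀ e ∉ X.ifaceEdges c, ext z e = 0 := fun e he => dif_neg he
    have h1 := hW (ext z) h0 fun v hv => congrFun (LinearMap.mem_ker.mp hz) ⟨v, hv⟩
    obtain ⟨u, hu⟩ := X.exact _ h1
    have h2 := hc u fun e he => by
      have := hu e
      rw [h0 e (by simpa [ifaceEdges] using he)] at this
      linarith
    have h3 : ∀ j ∈ X.innerLabels c, ∃ f, c f = j := by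
      intro j hj
      obtain ⟨f, -, hf⟩ := Finset.mem_image.mp (Finset.mem_of_mem_erase hj)
      exact ⟨f, hf⟩
    have : Nonempty F := ⟨X.outer⟩
    choose! rep hrep using h3
    refine ⟨fun j => u (rep j) - u X.outer, ?_⟩
    have h4 : ∀ f, ext' (fun j => u (rep j) - u X.outer) (c f) = u f - u X.outer := by
      intro f
      by_cases hf : c f ∈ X.innerLabels c
      · change (if h : c f ∈ X.innerLabels c then u (rep (c f)) - u X.outer else 0) = _
        rw [dif_pos hf, h2 _ _ (hrep _ hf)]
      · change (if h : c f ∈ X.innerLabels c then u (rep (c f)) - u X.outer else 0) = _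
        rw [dif_neg hf, h2 f X.outer, sub_self]
        simpa [innerLabels] using hf
    ext e
    change ext' _ (c (X.left e)) - ext' _ (c (X.right e)) = z e
    rw [h4, h4, sub_sub_sub_cancel_right, ← hu]
    exact dif_pos e.2
  have h1 := LinearMap.finrank_range_add_finrank_ker A
  have h2 := Submodule.finrank_mono hle
  have h3 := LinearMap.finrank_range_le B
  have h4 := Submodule.finrank_le (LinearMap.range A)
  simp only [Module.finrank_fintype_fun_eq_card, Fintype.card_coe] at h1 h3 h4
  omega

theorem sum_mul_bdry (z : E → ℝ) (g : V → ℝ) :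
    ∑ v, g v * X.bdry z v = ∑ e, z e * (g (X.src e) - g (X.tgt e)) := by
  simp only [bdry, Finset.mul_sum]
  rw [Finset.sum_comm]
  refine Finset.sum_congr rfl fun e _ => ?_
  have : ∀ v, g v * (z e * ((if X.src e = v then 1 else 0) - if X.tgt e = v then 1 else 0)) =
      (if X.src e = v then z e * g v else 0) - (if X.tgt e = v then z e * g v else 0) := by
    intro v
    split_ifs <;> ring
  simp only [this, Finset.sum_sub_distrib, Finset.sum_ite_eq, Finset.mem_univ, if_true]
  ring

theorem sum_deg : ∑ v, X.deg c v = 2 * (X.ifaceEdges c).card := by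
  have h1 : ∑ v, X.deg c v = Fintype.card (X.Interface c) := by
    rw [← Finset.card_univ]
    exact (Finset.card_eq_sum_card_fiberwise fun _ _ => Finset.mem_univ _).symm
  rw [h1, Fintype.card_subtype, mul_comm, ← Fintype.card_bool, ← Finset.card_univ,
    ← Finset.card_product]
  congr 1
  ext ⟨e, b⟩
  cases b <;> simp [ifaceEdges, face, rev, eq_comm]

theorem bdry_eq_zero_of_deg {z : E → ℝ} (hz : ∀ e ∉ X.ifaceEdges c, z e = 0) {v : V}
    (hv : X.deg c v = 0) : X.bdry z v = 0 := by
  refine Finset.sum_eq_zero fun e _ => ?_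
  by_cases he : e ∈ X.ifaceEdges c
  · have he' : c (X.left e) ≠ c (X.right e) := by simpa [ifaceEdges] using he
    rw [deg, Finset.card_eq_zero, Finset.filter_eq_empty_iff] at hv
    have h1 := @hv ⟨(e, true), he'⟩ (Finset.mem_univ _)
    have h2 := @hv ⟨(e, false), he'.symm⟩ (Finset.mem_univ _)
    simp only [tail, cond_true, cond_false] at h1 h2
    simp [h1, h2]
  · simp [hz e he]

/-- The set of vertices `B` meets every component of the interface graph. -/
def MeetsComponents (X : PlaneComplex F E V) (c : F → T) (B : Finset V) : Prop :=
  ∀ g : V → ℝ, (∀ e ∈ X.ifaceEdges c, g (X.src e) = g (X.tgt e)) → (∀ v ∈ B, g v = 0) →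
    ∀ v, X.deg c v ≠ 0 → g v = 0

/-- Branch vertices together with one vertex on each component without branch vertices. -/
theorem exists_marks (hc : X.ConnectedClasses c) (h2 : ∀ v, X.deg c v ≠ 1) :
    ∃ B : Finset V, X.MeetsComponents c B ∧ (∀ v, 3 ≤ X.deg c v → v ∈ B) ∧
      ∑ v ∈ B, X.deg c v ≤ 6 * (X.innerLabels c).card := by
  classical
  set V' : Finset V := {v | X.deg c v ≠ 0} with hV'
  set B3 : Finset V := {v | 3 ≤ X.deg c v} with hB3
  obtain ⟨B, hB, hmin⟩ := Finset.exists_min_image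
    (V'.powerset.filter fun B => B3 ⊆ B ∧ X.MeetsComponents c B) Finset.card ⟨V', by
      simp only [Finset.mem_filter, Finset.mem_powerset, subset_rfl, true_and]
      refine ⟨fun v hv => ?_, fun g _ h v hv => h v (by simpa [hV'] using hv)⟩
      simp only [hB3, hV', Finset.mem_filter, Finset.mem_univ, true_and] at hv ⊢
      omega⟩
  simp only [Finset.mem_filter, Finset.mem_powerset] at hB hmin
  obtain ⟨hBV, hB3B, hBM⟩ := hB
  refine ⟨B, hBM, fun v hv => hB3B (by simpa [hB3] using hv), ?_⟩
  have hr : ∀ r ∈ B \ B3, ∃ g : V → ℝ, (∀ e ∈ X.ifaceEdges c, g (X.src e) = g (X.tgt e)) ∧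
      (∀ v ∈ B, v ≠ r → g v = 0) ∧ g r ≠ 0 := by
    intro r hrB
    rw [Finset.mem_sdiff] at hrB
    have h1 : ¬ X.MeetsComponents c (B.erase r) := by
      intro h
      have := hmin (B.erase r) ⟨(Finset.erase_subset _ _).trans hBV, fun v hv =>
        Finset.mem_erase.mpr ⟨fun h => hrB.2 (h ▸ hv), hB3B hv⟩, h⟩
      have := Finset.card_erase_lt_of_mem hrB.1
      omega
    simp only [MeetsComponents, not_forall] at h1
    obtain ⟨g, hg1, hg2, v, hv, hgv⟩ := h1
    refine ⟨g, hg1, fun v hv hvr => hg2 v (Finset.mem_erase.mpr ⟨hvr, hv⟩), fun h => ?_⟩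
    refine hgv (hBM g hg1 (fun w hw => ?_) v hv)
    by_cases hwr : w = r
    · rw [hwr, h]
    · exact hg2 w (Finset.mem_erase.mpr ⟨hwr, hw⟩)
  have hE := X.card_ifaceEdges_le hc (W := V' \ (B \ B3)) fun z hz hW v => by
    by_cases hv : v ∈ V'
    swap
    · exact X.bdry_eq_zero_of_deg hz (by simpa [hV'] using hv)
    by_cases hvr : v ∈ B \ B3
    swap
    · exact hW v (Finset.mem_sdiff.mpr ⟨hv, hvr⟩)
    obtain ⟨g, hg1, hg2, hg3⟩ := hr v hvr
    have h1 := X.sum_mul_bdry z g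
    rw [Finset.sum_eq_zero (s := (Finset.univ : Finset E)), Finset.sum_eq_single v] at h1
    · exact (mul_eq_zero.mp h1).resolve_left hg3
    · intro w _ hwv
      by_cases hw : w ∈ V'
      · by_cases hwr : w ∈ B \ B3
        · rw [hg2 w (Finset.mem_sdiff.mp hwr).1 hwv, zero_mul]
        · rw [hW w (Finset.mem_sdiff.mpr ⟨hw, hwr⟩), mul_zero]
      · rw [X.bdry_eq_zero_of_deg hz (by simpa [hV'] using hw), mul_zero]
    · simp
    · intro e _
      by_cases he : e ∈ X.ifaceEdges c
      · rw [hg1 e he, sub_self, mul_zero]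
      · rw [hz e he, zero_mul]
  have hcard : (V' \ (B \ B3)).card + (B \ B3).card = V'.card :=
    Finset.card_sdiff_add_card_eq_card (Finset.sdiff_subset.trans hBV)
  have hsum : ∑ v ∈ V', X.deg c v = 2 * (X.ifaceEdges c).card := by
    rw [← X.sum_deg (c := c), hV', Finset.sum_filter_ne_zero]
  have hB3V : B3 ⊆ V' := hB3B.trans hBV
  have h3 : ∑ v ∈ V' \ B3, 2 ≤ ∑ v ∈ V' \ B3, X.deg c v := by
    refine Finset.sum_le_sum fun v hv => ?_
    have := h2 v
    simp only [hV', Finset.mem_sdiff, Finset.mem_filter, Finset.mem_univ, true_and] at hv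
    omega
  have h4 := Finset.sum_sdiff (f := X.deg c) hB3V
  have h5 := Finset.card_sdiff_add_card_eq_card hB3V
  have h6 := Finset.sum_sdiff (f := X.deg c) hB3B
  have h7 : ∑ v ∈ B \ B3, X.deg c v ≤ ∑ v ∈ B \ B3, 2 := by
    refine Finset.sum_le_sum fun v hv => ?_
    simp only [hB3, Finset.mem_sdiff, Finset.mem_filter, Finset.mem_univ, true_and] at hv
    omega
  have h8 : ∑ v ∈ B3, 3 ≤ ∑ v ∈ B3, X.deg c v :=
    Finset.sum_le_sum fun v hv => by simpa [hB3] using hv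
  simp only [Finset.sum_const, smul_eq_mul] at h3 h7 h8
  omega

end PlaneComplex

namespace PlaneComplex

variable {F E V : Type} [Fintype F] [Fintype E] [Fintype V] [DecidableEq F] [DecidableEq V]
  (X : PlaneComplex F E V) {T : Type} [DecidableEq T] {c : F → T}

theorem sum_interface (h : E × Bool → ℝ) (j : T) :
    ∑ d : X.Interface c with c (X.face d.1) = j, h d.1 = ∑ d ∈ X.classDarts c j, h d := by
  classical
  refine Finset.sum_bij (fun d _ => d.1) (fun d hd => ?_) (fun d _ d' _ h => Subtype.ext h)
    (fun d hd => ?_) fun _ _ => rfl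
  · have h1 := d.2
    simp only [Finset.mem_filter, Finset.mem_univ, true_and] at hd
    simp only [classDarts, Finset.mem_filter, Finset.mem_univ, true_and]
    exact ⟨hd, fun h => h1 (hd.trans h.symm)⟩
  · simp only [classDarts, Finset.mem_filter, Finset.mem_univ, true_and] at hd
    refine ⟨⟨d, fun h => hd.2 (h ▸ hd.1)⟩, ?_, rfl⟩
    simpa using hd.1

/-- A permutation of the interface darts walking around the classes. -/
def IsNext (φ : Equiv.Perm (X.Interface c)) : Prop :=
  ∀ d, X.tail (φ d).1 = X.tail (rev d.1) ∧ c (X.face (φ d).1) = c (X.face d.1)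

variable {X} {φ : Equiv.Perm (X.Interface c)}

omit [DecidableEq T] in
theorem IsNext.tail_irev (hφ : X.IsNext φ) (d : X.Interface c) :
    X.tail (X.irev c (φ⁻¹ d)).1 = X.tail d.1 := by
  have := (hφ (φ⁻¹ d)).1
  rw [show φ (φ⁻¹ d) = d from φ.apply_symm_apply d] at this
  exact this.symm

omit [DecidableEq T] in
theorem IsNext.face_inv (hφ : X.IsNext φ) (d : X.Interface c) :
    c (X.face (φ⁻¹ d).1) = c (X.face d.1) := by
  have := (hφ (φ⁻¹ d)).2
  rw [show φ (φ⁻¹ d) = d from φ.apply_symm_apply d] at this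
  exact this.symm

omit [DecidableEq T] in
theorem IsNext.irev_ne (hφ : X.IsNext φ) (d : X.Interface c) : X.irev c (φ⁻¹ d) ≠ d := by
  intro h
  refine (φ⁻¹ d).2 ?_
  rw [hφ.face_inv]
  exact congrArg (fun d => c (X.face d.1)) h.symm

theorem IsNext.deg_ne_one (hφ : X.IsNext φ) (v : V) : X.deg c v ≠ 1 := by
  intro h
  obtain ⟨d, hd⟩ := Finset.card_eq_one.mp h
  have h1 : X.tail d.1 = v := by
    have : d ∈ ({d | X.tail d.1 = v} : Finset (X.Interface c)) := by rw [hd]; simp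
    simpa using this
  have h2 : X.irev c (φ⁻¹ d) ∈ ({d | X.tail d.1 = v} : Finset (X.Interface c)) := by
    rw [Finset.mem_filter, hφ.tail_irev]
    exact ⟨Finset.mem_univ _, h1⟩
  rw [hd, Finset.mem_singleton] at h2
  exact hφ.irev_ne d h2

theorem IsNext.eq_or_eq (hφ : X.IsNext φ) {d y : X.Interface c} (h : X.tail d.1 = X.tail y.1)
    (h3 : ¬ 3 ≤ X.deg c (X.tail y.1)) : d = y ∨ d = X.irev c (φ⁻¹ y) := by
  classical
  by_contra! hd
  refine h3 ?_
  have h1 : ({d, y, X.irev c (φ⁻¹ y)} : Finset (X.Interface c)).card = 3 :=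
    Finset.card_eq_three.mpr ⟨_, _, _, hd.1, hd.2, (hφ.irev_ne y).symm, rfl⟩
  rw [← h1]
  refine Finset.card_le_card fun z hz => ?_
  simp only [Finset.mem_insert, Finset.mem_singleton] at hz
  simp only [Finset.mem_filter, Finset.mem_univ, true_and]
  rcases hz with rfl | rfl | rfl
  · exact h
  · rfl
  · exact hφ.tail_irev y

theorem IsNext.meets (hφ : X.IsNext φ) {B : Finset V} (hB : X.MeetsComponents c B)
    (h3 : ∀ v, 3 ≤ X.deg c v → v ∈ B) (x : X.Interface c) :
    ∃ n : ℕ, X.tail ((φ ^ n) x).1 ∈ B := by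
  classical
  by_contra! hx
  have hO : ∀ y, φ.SameCycle x y → X.tail y.1 ∉ B := by
    intro y hy
    obtain ⟨n, -, hn⟩ := hy.exists_pow_eq''
    exact hn.2 ▸ hx n
  have hstep : ∀ d : X.Interface c, (∃ y, φ.SameCycle x y ∧ X.tail y.1 = X.tail d.1) →
      ∃ y, φ.SameCycle x y ∧ X.tail y.1 = X.tail (rev d.1) := by
    rintro d ⟨y, hy, hyd⟩
    rcases hφ.eq_or_eq hyd.symm fun h => hO y hy (h3 _ h) with rfl | rfl
    · exact ⟨φ d, by simpa using hy, (hφ d).1⟩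
    · refine ⟨φ⁻¹ y, by simpa using hy, ?_⟩
      simp [irev]
  have h := hB (fun v => if ∃ y, φ.SameCycle x y ∧ X.tail y.1 = v then 1 else 0) (fun e he => by
    have he' : c (X.left e) ≠ c (X.right e) := by simpa [ifaceEdges] using he
    have h1 := hstep ⟨(e, true), he'⟩
    have h2 := hstep ⟨(e, false), he'.symm⟩
    have h4 : (∃ y, φ.SameCycle x y ∧ X.tail y.1 = X.src e) ↔
      ∃ y, φ.SameCycle x y ∧ X.tail y.1 = X.tgt e := ⟨h1, h2⟩
    simp only [h4]) (fun v hv => by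
      rw [if_neg]
      rintro ⟨y, hy, rfl⟩
      exact hO y hy hv) (X.tail x.1) (by
        refine Finset.card_ne_zero_of_mem (a := x) ?_
        simp)
  rw [if_pos ⟨x, Equiv.Perm.SameCycle.refl _ _, rfl⟩] at h
  exact one_ne_zero h

theorem IsNext.apply_irev (hφ : X.IsNext φ) {d : X.Interface c}
    (h3 : ¬ 3 ≤ X.deg c (X.tail d.1)) : φ (X.irev c d) = X.irev c (φ⁻¹ d) := by
  have h1 := hφ (X.irev c d)
  have h2 : X.tail (φ (X.irev c d)).1 = X.tail d.1 := by
    rw [h1.1]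
    simp [irev]
  refine (hφ.eq_or_eq h2 h3).resolve_left fun h => d.2 ?_
  rw [h] at h1
  exact h1.2

variable (X)

/-- The labels of the classes adjacent to the class labelled `j`. -/
def neighbors (c : F → T) (j : T) : Finset T :=
  (X.classDarts c j).image fun d => c (X.face (rev d))

variable {X}

/-- The boundaries of the classes, cut into chains at the branch vertices. -/
theorem exists_chains (hc : X.ConnectedClasses c) : ∃ C : T → List (List ℂ),
    (∀ j, (C j).flatten.sum = 0 ∧ llen (C j).flatten = X.classLength c j ∧
      larea (C j).flatten = X.classArea c j ∧ (X.neighbors c j).card ≤ (C j).length) ∧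
    ∑ j ∈ Finset.univ.image c, (C j).length ≤ 6 * (X.innerLabels c).card ∧
    ∑ j ∈ Finset.univ.image c, ((C j).map fun l => trunc (larea l)).sum = 0 := by
  classical
  obtain ⟨φ, hφ⟩ := X.exists_next c
  change X.IsNext φ at hφ
  obtain ⟨B, hB, hB3, hB6⟩ := X.exists_marks hc hφ.deg_ne_one
  set M : Set (X.Interface c) := {d | X.tail d.1 ∈ B} with hMdef
  have hM : ∀ d, ∃ n : ℕ, (φ ^ n) d ∈ M := hφ.meets hB hB3
  have hM3 : ∀ d ∉ M, ¬ 3 ≤ X.deg c (X.tail d.1) := fun d hd h => hd (hB3 _ h)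
  have hp : ∀ d : X.Interface c, X.pos (X.tail (φ d).1) = X.pos (X.tail d.1) + X.vec d.1 := by
    intro d
    rw [(hφ d).1, vec]
    ring
  have key := fun j : T => exists_chain_lists (φ := φ) (M := M) hM
    (p := fun d => X.pos (X.tail d.1)) (vec := fun d => X.vec d.1) hp
    (S := ({d | c (X.face d.1) = j} : Finset (X.Interface c))) (fun d => by simp [(hφ d).2])
  choose C hC using key
  have hmaps : ∀ d ∈ (Finset.univ : Finset (X.Interface c)),
      c (X.face d.1) ∈ Finset.univ.image c := fun d _ =>
    Finset.mem_image_of_mem _ (Finset.mem_univ _)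
  refine ⟨C, fun j => ⟨(hC j).1, (hC j).2.1.trans ?_, (hC j).2.2.1.trans ?_, ?_⟩, ?_, ?_⟩
  · exact X.sum_interface (fun d => ‖X.vec d‖) j
  · rw [X.classArea_eq]
    exact congrArg (· / 2)
      (X.sum_interface (fun d => crossp (X.pos (X.tail d)) (X.vec d)) j)
  · rw [(hC j).2.2.2.1]
    refine (Finset.card_le_card ?_).trans
      (Finset.card_image_le (f := fun d : X.Interface c => c (X.face (rev d.1))))
    intro j' hj'
    obtain ⟨x, hx, rfl⟩ := Finset.mem_image.mp hj'
    simp only [classDarts, Finset.mem_filter, Finset.mem_univ, true_and] at hx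
    obtain ⟨d, hd, i, hi, hdx⟩ := exists_chain hM
      (⟨x, fun h => hx.2 (h ▸ hx.1)⟩ : X.Interface c)
    have hopp : ∀ k, k < returnTime φ M d →
        c (X.face (rev ((φ ^ k) d).1)) = c (X.face (rev d.1)) := by
      intro k
      induction k with
      | zero => intro _; rfl
      | succ k ih =>
        intro hk
        rw [← ih (by omega)]
        have h1 : (φ ^ (k + 1)) d ∉ M := returnTime_min (by omega) hk
        have h2 := hφ.apply_irev (hM3 _ h1)
        rw [pow_succ', Equiv.Perm.mul_apply,
          show φ⁻¹ (φ ((φ ^ k) d)) = (φ ^ k) d from φ.symm_apply_apply _] at h2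
        have h3 := (hφ (X.irev c (φ ((φ ^ k) d)))).2
        rw [h2] at h3
        rw [pow_succ', Equiv.Perm.mul_apply]
        exact h3.symm
    have hcl : ∀ k, c (X.face ((φ ^ k) d).1) = c (X.face d.1) := by
      intro k
      induction k with
      | zero => rfl
      | succ k ih => rw [pow_succ', Equiv.Perm.mul_apply, (hφ _).2, ih]
    refine Finset.mem_image.mpr ⟨d, ?_, ?_⟩
    · simp only [Finset.mem_filter, Finset.mem_univ, true_and]
      refine ⟨?_, hd⟩
      rw [← hcl i, hdx]
      exact hx.1
    · rw [← hopp i hi, hdx]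
  · refine le_trans (le_of_eq ?_) hB6
    simp only [(hC _).2.2.2.1]
    have h1 := Finset.card_eq_sum_card_fiberwise
      (s := ({d | d ∈ M} : Finset (X.Interface c))) (t := Finset.univ.image c)
      (f := fun d => c (X.face d.1)) fun d _ => hmaps d (Finset.mem_univ _)
    have h2 := Finset.card_eq_sum_card_fiberwise
      (s := ({d | d ∈ M} : Finset (X.Interface c))) (t := B)
      (f := fun d => X.tail d.1) fun d hd => by simpa [hMdef] using hd
    refine (Finset.sum_congr rfl fun j _ => ?_).trans (h1.symm.trans (h2.trans
      (Finset.sum_congr rfl fun v hv => ?_)))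
    · congr 1
      ext d
      simp [and_comm]
    · rw [deg]
      congr 1
      ext d
      simp only [Finset.mem_filter, Finset.mem_univ, true_and, hMdef, Set.mem_ofPred_eq]
      exact ⟨fun h => h.2, fun h => ⟨h ▸ hv, h⟩⟩
  · simp only [(hC _).2.2.2.2]
    have h1 := sum_trunc_chain_eq_zero (φ := φ) (M := M) hM (vec := fun d => X.vec d.1)
      (rev := X.irev c) (X.irev_irev c) (fun d => X.vec_rev d.1)
      (fun d hd => hφ.apply_irev (hM3 d hd)) (fun d => by
        simp only [hMdef, Set.mem_ofPred_eq, (hφ d).1]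
        rfl)
    rw [← h1, ← Finset.sum_fiberwise_of_maps_to fun d _ => hmaps d (Finset.mem_univ d)]
    refine Finset.sum_congr rfl fun j _ => Finset.sum_congr ?_ fun _ _ => rfl
    ext d
    simp [and_comm]

end PlaneComplex

namespace PlaneComplex

variable {F E V : Type} [Fintype F] [Fintype E] [Fintype V] [DecidableEq F] [DecidableEq V]
  (X : PlaneComplex F E V)

section Weights

variable {T : Type} [DecidableEq T]

/-- The weight of a dart between faces labelled `a` and `b`, where `o` is the label of the
outer face. -/
noncomputable def dartWeight (o a b : T) : ℝ :=
  if a = b then 0 else if a = o ∨ b = o then 199 / 400 else 1 / 2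

theorem dartWeight_merge {o a b j j' : T} (hj : j ≠ o) (hjj : j ≠ j') :
    dartWeight o (if a = j then j' else a) (if b = j then j' else b) +
      ((if a = j ∧ b = j' then 199 / 400 else 0) + (if b = j ∧ a = j' then 199 / 400 else 0)) ≤
      dartWeight o a b := by
  unfold dartWeight
  by_cases h1 : a = j <;> by_cases h2 : b = j <;> by_cases h3 : a = j' <;> by_cases h4 : b = j' <;>
    by_cases h5 : a = o <;> by_cases h6 : b = o <;> by_cases h7 : j' = o <;>
    by_cases h8 : a = b <;> simp_all <;>
    first | norm_num; done | (split_ifs <;> norm_num)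

variable (c : F → T)

/-- The weighted length of the interface. -/
noncomputable def weightedLength : ℝ :=
  ∑ d, dartWeight (c X.outer) (c (X.face d)) (c (X.face (rev d))) * ‖X.vec d‖

/-- The length of the interface between two classes. -/
noncomputable def sharedLength (j j' : T) : ℝ :=
  ∑ d, if c (X.face d) = j ∧ c (X.face (rev d)) = j' then ‖X.vec d‖ else 0

theorem norm_vec_rev (d : E × Bool) : ‖X.vec (rev d)‖ = ‖X.vec d‖ := by rw [vec_rev, norm_neg]

theorem classLength_eq (j : T) : X.classLength c j =
    ∑ d, if c (X.face d) = j ∧ c (X.face (rev d)) ≠ j then ‖X.vec d‖ else 0 := by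
  rw [classLength, classDarts, Finset.sum_filter]

theorem sum_classLength : ∑ j ∈ Finset.univ.image c, X.classLength c j =
    ∑ d, if c (X.face d) = c (X.face (rev d)) then 0 else ‖X.vec d‖ := by
  simp only [classLength_eq]
  rw [Finset.sum_comm]
  refine Finset.sum_congr rfl fun d _ => ?_
  rw [Finset.sum_eq_single (c (X.face d))]
  · by_cases h : c (X.face d) = c (X.face (rev d)) <;> simp [h, Ne.symm]
  · intro j _ hj
    rw [if_neg fun h => hj h.1.symm]
  · intro h
    exact absurd (Finset.mem_image_of_mem _ (Finset.mem_univ _)) h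

theorem sum_ifaceEdges : ∑ e ∈ X.ifaceEdges c, ‖X.vec (e, true)‖ =
    (∑ j ∈ Finset.univ.image c, X.classLength c j) / 2 := by
  rw [sum_classLength, Fintype.sum_prod_type, ifaceEdges, Finset.sum_filter, Finset.sum_div]
  refine Finset.sum_congr rfl fun e _ => ?_
  rw [Fintype.sum_bool]
  have h1 : ‖X.vec (e, false)‖ = ‖X.vec (e, true)‖ := X.norm_vec_rev (e, true)
  by_cases h : c (X.left e) = c (X.right e)
  · simp [face, rev, h]
  · simp [face, rev, h, Ne.symm h, h1]

theorem weightedLength_eq : X.weightedLength c =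
    (∑ j ∈ Finset.univ.image c, X.classLength c j) / 2 - X.classLength c (c X.outer) / 200 := by
  have h1 : ∑ d, (if c (X.face (rev d)) = c X.outer ∧ c (X.face d) ≠ c X.outer then ‖X.vec d‖
      else 0) = X.classLength c (c X.outer) := by
    rw [classLength_eq, ← sum_rev]
    simp only [rev_rev, norm_vec_rev]
  have h2 : X.classLength c (c X.outer) / 200 = (∑ d, ((if c (X.face d) = c X.outer ∧
      c (X.face (rev d)) ≠ c X.outer then ‖X.vec d‖ else 0) +
      if c (X.face (rev d)) = c X.outer ∧ c (X.face d) ≠ c X.outer then ‖X.vec d‖ else 0)) / 400 := by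
    rw [Finset.sum_add_distrib, h1, ← classLength_eq]
    ring
  rw [h2, sum_classLength, weightedLength, Finset.sum_div, Finset.sum_div,
    ← Finset.sum_sub_distrib]
  refine Finset.sum_congr rfl fun d _ => ?_
  unfold dartWeight
  by_cases h3 : c (X.face d) = c X.outer <;> by_cases h4 : c (X.face (rev d)) = c X.outer <;>
    by_cases h5 : c (X.face d) = c (X.face (rev d)) <;> simp_all <;> ring

theorem classLength_eq_sum (j : T) : X.classLength c j =
    ∑ j' ∈ X.neighbors c j, X.sharedLength c j j' := by
  simp only [sharedLength]
  rw [Finset.sum_comm, classLength, classDarts, Finset.sum_filter]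
  refine Finset.sum_congr rfl fun d _ => ?_
  by_cases h : c (X.face d) = j
  · simp only [h, true_and, Finset.sum_ite_eq]
    by_cases h' : c (X.face (rev d)) = j
    · rw [if_neg (not_not.mpr h'), if_neg]
      intro h2
      obtain ⟨x, hx, hx'⟩ := Finset.mem_image.mp h2
      simp only [classDarts, Finset.mem_filter, Finset.mem_univ, true_and] at hx
      exact hx.2 (hx'.trans h')
    · rw [if_pos h', if_pos]
      exact Finset.mem_image_of_mem _ (by simp [classDarts, h, h'])
  · simp [h]

theorem neighbors_nonempty {j : T} (hj : j ∈ X.innerLabels c) : (X.neighbors c j).Nonempty := by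
  by_contra hne
  rw [neighbors, Finset.image_nonempty, Finset.not_nonempty_iff_eq_empty] at hne
  have hne' : ∀ d, c (X.face d) = j → c (X.face (rev d)) = j := by
    intro d hd
    by_contra hd'
    have : d ∈ X.classDarts c j := by simp [classDarts, hd, hd']
    rw [hne] at this
    simp at this
  obtain ⟨hj1, hj2⟩ := Finset.mem_erase.mp hj
  obtain ⟨f, -, hf⟩ := Finset.mem_image.mp hj2
  refine X.connected {f | c f ≠ j} hj1.symm (fun e => ?_) f hf
  have h1 := hne' (e, true)
  have h2 := hne' (e, false)
  simp only [face, rev, cond_true, cond_false, Bool.not_true, Bool.not_false] at h1 h2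
  exact not_congr ⟨h1, h2⟩

theorem classArea_nonneg {j : T} (hj : j ≠ c X.outer) : 0 ≤ X.classArea c j := by
  refine Finset.sum_nonneg fun f hf => X.area_nonneg' fun h => hj ?_
  rw [← (Finset.mem_filter.mp hf).2, h]

/-- The truncated area enclosed by the classes. -/
noncomputable def truncArea : ℝ := ∑ j ∈ X.innerLabels c, min 1 (X.classArea c j)

/-- The labelling obtained by adding the class `j` to the class `j'`. -/
def merge (j j' : T) (f : F) : T := if c f = j then j' else c f

theorem weightedLength_merge {j j' : T} (hj : j ≠ c X.outer) (hjj : j ≠ j') :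
    X.weightedLength (merge c j j') + 199 / 200 * X.sharedLength c j j' ≤ X.weightedLength c := by
  have h1 : 199 / 200 * X.sharedLength c j j' = ∑ d,
      ((if c (X.face d) = j ∧ c (X.face (rev d)) = j' then 199 / 400 else 0) +
      (if c (X.face (rev d)) = j ∧ c (X.face d) = j' then 199 / 400 else 0)) * ‖X.vec d‖ := by
    simp only [add_mul, Finset.sum_add_distrib]
    rw [← sum_rev (fun d => (if c (X.face (rev d)) = j ∧ c (X.face d) = j' then 199 / 400 else 0) *
      ‖X.vec d‖)]
    simp only [rev_rev, norm_vec_rev]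
    rw [← two_mul, sharedLength, Finset.mul_sum, Finset.mul_sum]
    refine Finset.sum_congr rfl fun d _ => ?_
    split_ifs <;> ring
  rw [h1, weightedLength, weightedLength, ← Finset.sum_add_distrib]
  refine Finset.sum_le_sum fun d _ => ?_
  rw [← add_mul]
  refine mul_le_mul_of_nonneg_right ?_ (norm_nonneg _)
  have := dartWeight_merge (o := c X.outer) (a := c (X.face d)) (b := c (X.face (rev d))) hj hjj
  rwa [merge, if_neg hj.symm]

theorem classArea_merge {j j' k : T} (hk : k ≠ j) :
    X.classArea (merge c j j') k =
      X.classArea c k + if k = j' then X.classArea c j else 0 := by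
  simp only [classArea, Finset.sum_filter]
  rw [show (if k = j' then ∑ f, (if c f = j then X.area f else 0) else 0) =
    ∑ f, if k = j' then (if c f = j then X.area f else 0) else 0 by split_ifs <;> simp,
    ← Finset.sum_add_distrib]
  refine Finset.sum_congr rfl fun f _ => ?_
  unfold merge
  by_cases h1 : c f = j <;> by_cases h2 : k = j' <;> by_cases h3 : c f = k <;> simp_all
  exact fun h => absurd h.symm h2

omit [DecidableEq F] in
theorem image_merge {j j' : T} (hj' : j' ∈ Finset.univ.image c)
    (hjj : j ≠ j') : Finset.univ.image (merge c j j') = (Finset.univ.image c).erase j := by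
  ext k
  simp only [Finset.mem_image, Finset.mem_univ, true_and, Finset.mem_erase] at hj' ⊢
  constructor
  · rintro ⟨f, rfl⟩
    unfold merge
    split_ifs with h
    · exact ⟨hjj.symm, hj'⟩
    · exact ⟨h, f, rfl⟩
  · rintro ⟨hk, f, rfl⟩
    exact ⟨f, if_neg hk⟩

theorem truncArea_merge {j j' : T} (hj : j ∈ X.innerLabels c) (hj' : j' ∈ Finset.univ.image c)
    (hjj : j ≠ j') :
    X.truncArea c ≤ X.truncArea (merge c j j') + min 1 (X.classArea c j) := by
  have hj0 := Finset.mem_erase.mp hj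
  have h1 : X.innerLabels (merge c j j') = (X.innerLabels c).erase j := by
    rw [innerLabels, image_merge c hj' hjj, merge, if_neg hj0.1.symm, innerLabels,
      Finset.erase_right_comm]
  rw [truncArea, truncArea, h1, ← Finset.sum_erase_add _ _ hj]
  refine add_le_add_left (Finset.sum_le_sum fun k hk => min_le_min_left _ ?_) _
  rw [X.classArea_merge c (Finset.ne_of_mem_erase hk)]
  have := X.classArea_nonneg c hj0.1
  split_ifs <;> linarith

theorem connectedClasses_merge (hc : X.ConnectedClasses c) {j j' : T}
    (h : j' ∈ X.neighbors c j) : X.ConnectedClasses (merge c j j') := by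
  intro u hu
  have h1 := hc u fun e he => hu e (by simp only [merge, he])
  obtain ⟨d, hd, hd'⟩ := Finset.mem_image.mp h
  simp only [classDarts, Finset.mem_filter, Finset.mem_univ, true_and] at hd
  have h2 : u (X.face d) = u (X.face (rev d)) := by
    have h3 := hu d.1 (by
      obtain ⟨e, b⟩ := d
      cases b <;> simp_all [merge, face, rev])
    obtain ⟨e, b⟩ := d
    cases b
    · exact h3.symm
    · exact h3
  have h3 : ∀ f, c f = j → ∀ f', c f' = j' → u f = u f' := fun f hf f' hf' => by
    rw [h1 f (X.face d) (hf.trans hd.1.symm), h2, h1 f' (X.face (rev d)) (hf'.trans hd'.symm)]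
  intro f f' hff
  unfold merge at hff
  split_ifs at hff with h4 h5 h5
  · exact h1 _ _ (h4.trans h5.symm)
  · exact h3 _ h4 _ hff.symm
  · exact (h3 _ h5 _ hff).symm
  · exact h1 _ _ hff

end Weights

end PlaneComplex

namespace PlaneComplex

variable {F E V : Type} [Fintype F] [Fintype E] [Fintype V] [DecidableEq F] [DecidableEq V]
  (X : PlaneComplex F E V)

section Minimal

variable {T : Type} [DecidableEq T] {c : F → T}

theorem truncArea_le_of_sharedLength (hc : X.ConnectedClasses c)
    (hmin : ∀ j ∈ X.innerLabels c, ∀ j' ∈ X.neighbors c j,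
      199 / 200 * X.sharedLength c j j' < hexK * min 1 (X.classArea c j)) :
    hexK * X.truncArea c ≤ X.weightedLength c := by
  obtain ⟨C, hC, hC6, hC0⟩ := exists_chains hc
  have ho : c X.outer ∈ Finset.univ.image c := Finset.mem_image_of_mem _ (Finset.mem_univ _)
  have hK := hexK_pos
  have hK2 := hexK_lt
  have key : ∀ j ∈ X.innerLabels c, 2 * hexK * min 1 (X.classArea c j) -
      hexK * ((C j).map fun c => trunc (larea c)).sum - 7 / 100 * ((C j).length - 6) ≤
      X.classLength c j := by
    intro j hj
    obtain ⟨h1, h2, h3, h4⟩ := hC j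
    have hpos : 0 < min 1 (X.classArea c j) := by
      obtain ⟨j', hj'⟩ := X.neighbors_nonempty c hj
      have h5 : 0 ≤ X.sharedLength c j j' :=
        Finset.sum_nonneg fun d _ => by split_ifs <;> simp
      have h6 := hmin j hj j' hj'
      by_contra! h7
      nlinarith
    have hA := (lt_min_iff.mp hpos).2
    rw [← h2, ← h3]
    refine hexagonal_inequality h1 (h3 ▸ hA) ?_
    rw [h2, h3, X.classLength_eq_sum]
    have h5 : ∑ j' ∈ X.neighbors c j, X.sharedLength c j j' ≤
        ∑ j' ∈ X.neighbors c j, 188 / 100 * min 1 (X.classArea c j) :=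
      Finset.sum_le_sum fun j' hj' => by
        have := hmin j hj j' hj'
        nlinarith
    refine h5.trans ?_
    rw [Finset.sum_const, nsmul_eq_mul, mul_assoc]
    have : ((X.neighbors c j).card : ℝ) ≤ (C j).length := by exact_mod_cast h4
    exact mul_le_mul_of_nonneg_right this (by positivity)
  have hsum := Finset.sum_le_sum key
  rw [Finset.sum_sub_distrib, Finset.sum_sub_distrib, ← Finset.mul_sum, ← Finset.mul_sum,
    ← Finset.mul_sum, Finset.sum_sub_distrib, Finset.sum_const, nsmul_eq_mul] at hsum
  have hlen : (∑ j ∈ X.innerLabels c, ((C j).length : ℝ)) ≤ 6 * (X.innerLabels c).card := by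
    have h1 : ∑ j ∈ X.innerLabels c, (C j).length ≤ ∑ j ∈ Finset.univ.image c, (C j).length :=
      Finset.sum_le_sum_of_subset (Finset.erase_subset _ _)
    exact_mod_cast h1.trans hC6
  rw [← Finset.sum_erase_add _ _ ho] at hC0
  have hout : 3544 / 1000 * |((C (c X.outer)).map fun l => trunc (larea l)).sum| ≤
      X.classLength c (c X.outer) := by
    rw [← (hC _).2.1, llen_flatten]
    induction C (c X.outer) with
    | nil => simp
    | cons l L ih =>
      simp only [List.map_cons, List.sum_cons]
      have h1 := abs_add_le (trunc (larea l)) (L.map fun l => trunc (larea l)).sum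
      have h2 := trunc_larea_le_llen l
      linarith
  rw [X.weightedLength_eq, ← Finset.sum_erase_add _ _ ho, truncArea]
  change _ ≤ ((∑ j ∈ X.innerLabels c, _) + _) / 2 - _
  change (∑ j ∈ X.innerLabels c, _) + _ = _ at hC0
  set S := ((C (c X.outer)).map fun l => trunc (larea l)).sum
  set L := X.classLength c (c X.outer)
  have h1 := le_abs_self S
  have h2 := neg_abs_le S
  have h3 : hexK * |S| ≤ 99 / 100 * L := by
    nlinarith [abs_nonneg S]
  have h4 : -(hexK * |S|) ≤ hexK * S := by nlinarith
  have h5 : ∑ j ∈ X.innerLabels c, ((C j).map fun c => trunc (larea c)).sum = -S := by linarith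
  rw [h5] at hsum
  linarith

end Minimal

theorem truncArea_le (c : F → F) (hc : X.ConnectedClasses c) :
    hexK * X.truncArea c ≤ X.weightedLength c := by
  classical
  obtain ⟨m, hm, hmin⟩ := Finset.exists_min_image
    (Finset.univ.filter fun c : F → F => X.ConnectedClasses c)
    (fun c => toLex (X.weightedLength c - hexK * X.truncArea c, (Finset.univ.image c).card))
    ⟨c, by simpa using hc⟩
  simp only [Finset.mem_filter, Finset.mem_univ, true_and, Prod.Lex.toLex_le_toLex] at hm hmin
  have h1 := X.truncArea_le_of_sharedLength hm fun j hj j' hj' => by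
    by_contra! hlt
    obtain ⟨d, hd, hd'⟩ := Finset.mem_image.mp hj'
    simp only [classDarts, Finset.mem_filter, Finset.mem_univ, true_and] at hd
    have hjj : j ≠ j' := fun h => hd.2 (hd'.trans h.symm)
    have hj'2 : j' ∈ Finset.univ.image m := Finset.mem_image.mpr ⟨_, Finset.mem_univ _, hd'⟩
    have hj0 := Finset.mem_erase.mp hj
    have h2 := X.weightedLength_merge m hj0.1 hjj
    have h3 := X.truncArea_merge m hj hj'2 hjj
    have h4 := hmin _ (X.connectedClasses_merge m hm hj')
    rw [image_merge m hj'2 hjj] at h4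
    have h5 := Finset.card_erase_lt_of_mem hj0.2
    have h6 := hexK_pos
    rcases h4 with h4 | h4
    · nlinarith
    · omega
  have h2 := hmin c hc
  rcases h2 with h2 | h2 <;> linarith

theorem isoperimetric_class {T : Type} [DecidableEq T] {c : F → T} (hc : X.ConnectedClasses c)
    (j : T) : 4 * Real.pi * |X.classArea c j| ≤ X.classLength c j ^ 2 := by
  obtain ⟨C, hC, -, -⟩ := exists_chains hc
  obtain ⟨h1, h2, h3, -⟩ := hC j
  rw [← h2, ← h3]
  exact isoperimetric h1

theorem sum_area : ∑ f, X.area f = 0 := by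
  simp only [area]
  rw [← Finset.sum_div, Finset.sum_comm]
  simp only [Finset.sum_ite_eq, Finset.mem_univ, if_true]
  rw [sum_eq_zero_of_antisymm X.crossp_antisymm, zero_div]

/-- The labels of the classes of the coarsest connected labelling refining a labelling. -/
theorem exists_connected_refinement {T : Type} [DecidableEq T] (l : F → T) :
    ∃ c : F → F, X.ConnectedClasses c ∧ (∀ f f', c f = c f' → l f = l f') ∧
      ∀ e, c (X.left e) = c (X.right e) ↔ l (X.left e) = l (X.right e) := by
  classical
  let P : (F → ℝ) → Prop := fun u =>
    ∀ e, l (X.left e) = l (X.right e) → u (X.left e) = u (X.right e)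
  let s : Setoid F :=
    ⟨fun f f' => ∀ u, P u → u f = u f', fun _ _ _ => rfl, fun h u hu => (h u hu).symm,
      fun h h' u hu => (h u hu).trans (h' u hu)⟩
  have hs : ∀ f f', (Quotient.mk s f).out = (Quotient.mk s f').out ↔ ∀ u, P u → u f = u f' :=
    fun f f' => by rw [Quotient.out_inj]; exact Quotient.eq
  have h1 : ∀ f f', (Quotient.mk s f).out = (Quotient.mk s f').out → l f = l f' := by
    intro f f' h
    by_contra hne
    have := (hs f f').mp h (fun g => if l g = l f then 1 else 0) fun e he => by simp only [he]
    simp [Ne.symm hne] at this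
  refine ⟨fun f => (Quotient.mk s f).out, fun u hu f f' hff => ?_, h1, fun e => ⟨h1 _ _, ?_⟩⟩
  · refine (hs f f').mp hff u fun e he => hu e ((hs _ _).mpr fun v hv => hv e he)
  · exact fun he => (hs _ _).mpr fun u hu => hu e he

theorem min_one_sum_le {S : Type*} (s : Finset S) {a : S → ℝ} (ha : ∀ i ∈ s, 0 ≤ a i) :
    min 1 (∑ i ∈ s, a i) ≤ ∑ i ∈ s, min 1 (a i) := by
  classical
  induction s using Finset.induction_on with
  | empty => simp
  | insert i s hi ih =>
    rw [Finset.sum_insert hi, Finset.sum_insert hi]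
    have h1 := ih fun k hk => ha k (Finset.mem_insert_of_mem hk)
    have h2 := ha i (Finset.mem_insert_self _ _)
    have h3 := Finset.sum_nonneg fun k hk => ha k (Finset.mem_insert_of_mem hk)
    rcases min_cases 1 (∑ i ∈ s, a i) with h | h <;> rcases min_cases 1 (a i) with h' | h' <;>
      rcases min_cases 1 (a i + ∑ i ∈ s, a i) with h'' | h'' <;> linarith

/-- The length of the interfaces of a labelled plane complex. -/
theorem hexK_mul_sum_le {ι : Type} [Fintype ι] [DecidableEq ι] (l : F → Option ι)
    (hl : l X.outer = none) : ∃ L : ℝ, 0 ≤ L ∧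
      4 * Real.pi * ∑ i, X.classArea l (some i) ≤ L ^ 2 ∧
      hexK * ∑ i, min 1 (X.classArea l (some i)) + L / 200 ≤
        ∑ e ∈ X.ifaceEdges l, ‖X.vec (e, true)‖ := by
  obtain ⟨c, hc, hcl, hce⟩ := X.exists_connected_refinement l
  have hin : ∀ i f, l f = some i → c f ∈ X.innerLabels c := by
    intro i f hf
    refine Finset.mem_erase.mpr ⟨fun h => ?_, Finset.mem_image_of_mem _ (Finset.mem_univ _)⟩
    rw [hcl _ _ h, hl] at hf
    simp at hf
  have hI : ∀ i, X.classArea l (some i) =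
      ∑ j ∈ (Finset.univ.filter fun f => l f = some i).image c, X.classArea c j := by
    intro i
    rw [classArea, ← Finset.sum_fiberwise_of_maps_to (t := (Finset.univ.filter fun f =>
      l f = some i).image c) (g := c) fun f hf => Finset.mem_image_of_mem _ hf]
    refine Finset.sum_congr rfl fun j hj => Finset.sum_congr ?_ fun _ _ => rfl
    obtain ⟨f, hf, rfl⟩ := Finset.mem_image.mp hj
    ext f'
    simp only [Finset.mem_filter, Finset.mem_univ, true_and] at hf ⊢
    exact ⟨fun h => h.2, fun h => ⟨(hcl _ _ h).trans hf, h⟩⟩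
  have hdisj : ∀ i ∈ (Finset.univ : Finset ι), ∀ i' ∈ (Finset.univ : Finset ι), i ≠ i' →
      Disjoint ((Finset.univ.filter fun f => l f = some i).image c)
        ((Finset.univ.filter fun f => l f = some i').image c) := by
    intro i _ i' _ hii
    rw [Finset.disjoint_left]
    intro j hj hj'
    obtain ⟨f, hf, rfl⟩ := Finset.mem_image.mp hj
    obtain ⟨f', hf', hff⟩ := Finset.mem_image.mp hj'
    simp only [Finset.mem_filter, Finset.mem_univ, true_and] at hf hf'
    have := hcl _ _ hff
    rw [hf, hf'] at this
    exact hii (Option.some.inj this).symm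
  have hsub : (Finset.univ.biUnion fun i => (Finset.univ.filter fun f => l f = some i).image c) ⊆
      X.innerLabels c := by
    intro j hj
    simp only [Finset.mem_biUnion, Finset.mem_univ, true_and, Finset.mem_image,
      Finset.mem_filter] at hj
    obtain ⟨i, f, hf, rfl⟩ := hj
    exact hin i f hf
  have hnn : ∀ j ∈ X.innerLabels c, 0 ≤ X.classArea c j := fun j hj =>
    X.classArea_nonneg c (Finset.ne_of_mem_erase hj)
  have hmaps : ∀ i, ((Finset.univ.filter fun f => l f = some i).image c) ⊆ X.innerLabels c :=
    fun i => (Finset.subset_biUnion_of_mem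
      (fun i => (Finset.univ.filter fun f => l f = some i).image c) (Finset.mem_univ i)).trans hsub
  refine ⟨X.classLength c (c X.outer), Finset.sum_nonneg fun _ _ => norm_nonneg _, ?_, ?_⟩
  · refine le_trans ?_ (X.isoperimetric_class hc _)
    refine mul_le_mul_of_nonneg_left ?_ (by positivity)
    have h1 : ∑ j ∈ Finset.univ.image c, X.classArea c j = 0 := by
      exact (Finset.sum_fiberwise_of_maps_to (f := X.area)
        fun f _ => Finset.mem_image_of_mem c (Finset.mem_univ f)).trans X.sum_area
    rw [← Finset.sum_erase_add _ _ (Finset.mem_image_of_mem c (Finset.mem_univ X.outer))] at h1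
    have h2 : X.classArea c (c X.outer) = -∑ j ∈ X.innerLabels c, X.classArea c j :=
      eq_neg_of_add_eq_zero_right h1
    rw [h2, abs_neg, abs_of_nonneg (Finset.sum_nonneg hnn)]
    simp only [hI]
    rw [← Finset.sum_biUnion hdisj]
    exact Finset.sum_le_sum_of_subset_of_nonneg hsub fun j hj _ => hnn j hj
  · have h1 := X.truncArea_le c hc
    rw [X.weightedLength_eq, ← X.sum_ifaceEdges] at h1
    have h2 : X.ifaceEdges c = X.ifaceEdges l := by
      ext e
      simp [ifaceEdges, hce]
    rw [h2] at h1
    have h3 : ∑ i, min 1 (X.classArea l (some i)) ≤ X.truncArea c := by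
      simp only [hI]
      refine (Finset.sum_le_sum fun i _ => min_one_sum_le _ fun j hj => hnn j (hmaps i hj)).trans ?_
      rw [← Finset.sum_biUnion hdisj]
      exact Finset.sum_le_sum_of_subset_of_nonneg hsub fun j hj _ => le_min zero_le_one (hnn j hj)
    have h4 := mul_le_mul_of_nonneg_left h3 hexK_pos.le
    linarith

end PlaneComplex

/-! ### Grid complexes -/

section Grid

variable {M n : ℕ}

/-- The label of the strip position below `i`, or `none`. -/
def belowFace (k : Fin M) (i : Fin (n + 1)) : Option (Fin M × Fin n) :=
  Fin.cases none (fun i => some (k, i)) i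

/-- The label of the strip position above `i`, or `none`. -/
def aboveFace (k : Fin M) (i : Fin (n + 1)) : Option (Fin M × Fin n) :=
  Fin.lastCases none (fun i => some (k, i)) i

/-- The face to the left of a vertical edge, or `none`. -/
def beforeFace (k : Fin (M + 1)) (i : Fin n) : Option (Fin M × Fin n) :=
  Fin.cases none (fun k => some (k, i)) k

/-- The face to the right of a vertical edge, or `none`. -/
def afterFace (k : Fin (M + 1)) (i : Fin n) : Option (Fin M × Fin n) :=
  Fin.lastCases none (fun k => some (k, i)) k

theorem sum_left_eq (k : Fin M) (i : Fin n) (h : Fin M × Fin (n + 1) ⊕ Fin (M + 1) × Fin n → ℝ) :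
    (∑ e, if Sum.elim (fun e => aboveFace e.1 e.2) (fun e => beforeFace e.1 e.2) e = some (k, i)
      then h e else 0) = h (.inl (k, i.castSucc)) + h (.inr (k.succ, i)) := by
  rw [Fintype.sum_sum_type, Fintype.sum_prod_type_right, Fintype.sum_prod_type,
    Fin.sum_univ_castSucc, Fin.sum_univ_succ]
  simp only [Sum.elim_inl, Sum.elim_inr, aboveFace, beforeFace, Fin.lastCases_castSucc,
    Fin.lastCases_last, Fin.cases_zero, Fin.cases_succ, reduceCtorEq, if_false, Option.some.injEq,
    Prod.mk.injEq, ite_and, Finset.sum_ite_eq', Finset.mem_univ, if_true,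
    Finset.sum_const_zero, add_zero, zero_add]
  congr 1
  simp

theorem sum_right_eq (k : Fin M) (i : Fin n) (h : Fin M × Fin (n + 1) ⊕ Fin (M + 1) × Fin n → ℝ) :
    (∑ e, if Sum.elim (fun e => belowFace e.1 e.2) (fun e => afterFace e.1 e.2) e = some (k, i)
      then h e else 0) = h (.inl (k, i.succ)) + h (.inr (k.castSucc, i)) := by
  rw [Fintype.sum_sum_type, Fintype.sum_prod_type_right, Fintype.sum_prod_type,
    Fin.sum_univ_succ, Fin.sum_univ_castSucc]
  simp only [Sum.elim_inl, Sum.elim_inr, belowFace, afterFace, Fin.lastCases_castSucc,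
    Fin.lastCases_last, Fin.cases_zero, Fin.cases_succ, reduceCtorEq, if_false, Option.some.injEq,
    Prod.mk.injEq, ite_and, Finset.sum_ite_eq', Finset.mem_univ, if_true,
    Finset.sum_const_zero, add_zero, zero_add]
  congr 1
  simp

theorem sum_castSucc_eq {W : Fin M → ℝ} (i : Fin n) (k : Fin (M + 1))
    {u : Option (Fin M × Fin n) → ℝ} (h0 : u none = 0) (hu : ∀ k, u (some (k, i)) = W k) :
    (∑ k', if k'.castSucc = k then W k' else 0) = u (afterFace k i) := by
  induction k using Fin.lastCases with
  | last => simp [afterFace, h0, (Fin.castSucc_lt_last _).ne]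
  | cast k => simp [afterFace, hu]

theorem sum_succ_eq {W : Fin M → ℝ} (i : Fin n) (k : Fin (M + 1))
    {u : Option (Fin M × Fin n) → ℝ} (h0 : u none = 0) (hu : ∀ k, u (some (k, i)) = W k) :
    (∑ k', if k'.succ = k then W k' else 0) = u (beforeFace k i) := by
  induction k using Fin.cases with
  | zero => simp [beforeFace, h0, Fin.succ_ne_zero]
  | succ k => simp [beforeFace, hu]

/-- Every cycle of a grid is a combination of face boundaries. -/
theorem exists_potential (z : Fin M × Fin (n + 1) ⊕ Fin (M + 1) × Fin n → ℝ)
    (hz : ∀ g : Fin (M + 1) → Fin (n + 1) → ℝ,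
      ∑ k, ∑ i, z (.inl (k, i)) * (g k.castSucc i - g k.succ i) +
        ∑ k, ∑ i, z (.inr (k, i)) * (g k i.castSucc - g k i.succ) = 0) :
    ∃ u : Option (Fin M × Fin n) → ℝ,
      (∀ k i, z (.inl (k, i)) = u (aboveFace k i) - u (belowFace k i)) ∧
      ∀ k i, z (.inr (k, i)) = u (beforeFace k i) - u (afterFace k i) := by
  set W : Fin M → Fin (n + 1) → ℝ := fun k i => ∑ i', if i' ≤ i then z (.inl (k, i')) else 0
    with hW
  have key : ∀ k i, (∑ k', if k'.castSucc = k then W k' i else 0) -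
      (∑ k', if k'.succ = k then W k' i else 0) +
      (∑ i', if i'.castSucc = i then z (.inr (k, i')) else 0) = 0 := by
    intro k i
    refine Eq.trans ?_ (hz fun k' i' => if k' = k ∧ i' ≤ i then 1 else 0)
    congr 1
    · rw [← Finset.sum_sub_distrib]
      refine Finset.sum_congr rfl fun k' _ => ?_
      have h1 : ∀ p : Prop, [Decidable p] → (if p then W k' i else 0) =
          ∑ i', if p ∧ i' ≤ i then z (.inl (k', i')) else 0 := by
        intro p _
        split_ifs with h <;> simp [h, hW]
      rw [h1, h1, ← Finset.sum_sub_distrib]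
      refine Finset.sum_congr rfl fun i' _ => ?_
      split_ifs <;> simp
    · rw [Finset.sum_eq_single k]
      · refine Finset.sum_congr rfl fun i' _ => ?_
        by_cases h : i'.castSucc = i
        · subst h
          simp [(Fin.castSucc_lt_succ (i := i')).not_ge]
        · have : i'.castSucc ≤ i ↔ i'.succ ≤ i := by
            have h' : i'.1 ≠ i.1 := fun h' => h (Fin.ext h')
            rw [Fin.le_def, Fin.le_def, Fin.val_castSucc, Fin.val_succ]
            omega
          simp [h, this]
      · intro k' _ hk
        simp [hk]
      · simp
  have hlast : ∀ k, W k (Fin.last n) = 0 := by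
    have h1 : ∀ m, ∀ k : Fin M, k.1 = m → W k (Fin.last n) = 0 := by
      intro m
      induction m with
      | zero =>
        intro k hk
        have h := key k.castSucc (Fin.last n)
        have h2 : ∀ k' : Fin M, ¬ k'.succ = k.castSucc := by
          intro k' h
          have := congrArg Fin.val h
          simp at this
          omega
        simpa [h2, (Fin.castSucc_lt_last _).ne] using h
      | succ m ih =>
        intro k hk
        have h := key k.castSucc (Fin.last n)
        have h2 : ∀ k' : Fin M, (if k'.succ = k.castSucc then W k' (Fin.last n) else 0) = 0 := by
          intro k'
          split_ifs with h
          · refine ih k' ?_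
            have := congrArg Fin.val h
            simp at this
            omega
          · rfl
        simpa [h2, (Fin.castSucc_lt_last _).ne] using h
    exact fun k => h1 _ k rfl
  refine ⟨fun f => f.elim 0 fun f => W f.1 f.2.castSucc, fun k i => ?_, fun k i => ?_⟩
  · have h1 : ((aboveFace k i).elim 0 fun f => W f.1 f.2.castSucc) = W k i := by
      induction i using Fin.lastCases with
      | last => simp [aboveFace, hlast]
      | cast i => simp [aboveFace]
    have h2 : ((belowFace k i).elim 0 fun f => W f.1 f.2.castSucc) =
        ∑ i', if i' < i then z (.inl (k, i')) else 0 := by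
      induction i using Fin.cases with
      | zero => simp [belowFace]
      | succ i => 
        have h3 : ∀ i' : Fin (n + 1), i' < i.succ ↔ i' ≤ i.castSucc := fun i' => by
          rw [Fin.lt_def, Fin.le_def, Fin.val_succ, Fin.val_castSucc, Nat.lt_succ_iff]
        simp only [belowFace, Fin.cases_succ, hW, h3, Option.elim_some]
    beta_reduce
    rw [h1, h2, hW, ← Finset.sum_sub_distrib, Finset.sum_eq_single i]
    · simp
    · intro i' _ hi
      have : i' ≤ i ↔ i' < i := ⟨fun h => lt_of_le_of_ne h hi, le_of_lt⟩
      simp [this]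
    · simp
  · have h := key k i.castSucc
    rw [sum_castSucc_eq (W := fun k => W k i.castSucc) (u := fun f => f.elim 0 fun f => W f.1 f.2.castSucc) i k rfl fun k => rfl,
      sum_succ_eq (W := fun k => W k i.castSucc) (u := fun f => f.elim 0 fun f => W f.1 f.2.castSucc) i k rfl fun k => rfl] at h
    simp only [Fin.castSucc_inj, Finset.sum_ite_eq', Finset.mem_univ, if_true] at h
    linarith

/-- The grid complex of points `(x k, y k i)`. -/
def gridComplex (x : Fin (M + 1) → ℝ) (y : Fin (M + 1) → Fin (n + 1) → ℝ) (hx : Monotone x)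
    (hy : ∀ k, Monotone (y k)) :
    PlaneComplex (Option (Fin M × Fin n)) (Fin M × Fin (n + 1) ⊕ Fin (M + 1) × Fin n)
      (Fin (M + 1) × Fin (n + 1)) where
  src := Sum.elim (fun e => (e.1.castSucc, e.2)) (fun e => (e.1, e.2.castSucc))
  tgt := Sum.elim (fun e => (e.1.succ, e.2)) (fun e => (e.1, e.2.succ))
  left := Sum.elim (fun e => aboveFace e.1 e.2) (fun e => beforeFace e.1 e.2)
  right := Sum.elim (fun e => belowFace e.1 e.2) (fun e => afterFace e.1 e.2)
  pos := fun v => ⟨x v.1, y v.1 v.2⟩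
  outer := none
  balanced := by
    rintro (_ | ⟨k, i⟩) hf g
    · exact absurd rfl hf
    rw [Finset.sum_sub_distrib, sum_left_eq, sum_right_eq]
    simp
  exact := by
    intro z hz
    obtain ⟨u, hu1, hu2⟩ := exists_potential z (by
      intro g
      have h1 : ∑ v : Fin (M + 1) × Fin (n + 1), g v.1 v.2 * ∑ e, z e *
          ((if Sum.elim (fun e : Fin M × Fin (n + 1) => (e.1.castSucc, e.2))
            (fun e : Fin (M + 1) × Fin n => (e.1, e.2.castSucc)) e = v then 1 else 0) -
          (if Sum.elim (fun e : Fin M × Fin (n + 1) => (e.1.succ, e.2))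
            (fun e : Fin (M + 1) × Fin n => (e.1, e.2.succ)) e = v then 1 else 0)) = 0 :=
        Finset.sum_eq_zero fun v _ => by rw [hz v, mul_zero]
      simp only [Finset.mul_sum] at h1
      rw [Finset.sum_comm] at h1
      have h2 : ∀ (a b : Fin (M + 1) × Fin (n + 1)) (r : ℝ),
          ∑ v : Fin (M + 1) × Fin (n + 1), g v.1 v.2 * (r * ((if a = v then 1 else 0) -
            (if b = v then 1 else 0))) = r * (g a.1 a.2 - g b.1 b.2) := by
        intro a b r
        simp only [mul_sub, mul_ite, mul_one, mul_zero, Finset.sum_sub_distrib,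
          Finset.sum_ite_eq, Finset.mem_univ, if_true]
        ring
      simp only [h2, Fintype.sum_sum_type, Fintype.sum_prod_type, Sum.elim_inl,
        Sum.elim_inr] at h1
      exact h1)
    exact ⟨u, by rintro (⟨k, i⟩ | ⟨k, i⟩); exacts [hu1 k i, hu2 k i]⟩
  connected := by
    intro S h0 hS
    have h1 : ∀ m, ∀ (k : Fin M) (i : Fin n), i.1 = m → some (k, i) ∈ S := by
      intro m
      induction m with
      | zero =>
        intro k i hi
        have h := hS (.inl (k, i.castSucc))
        have h2 : i.castSucc = 0 := Fin.ext hi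
        simp only [Sum.elim_inl, aboveFace, Fin.lastCases_castSucc] at h
        rw [h, h2]
        exact h0
      | succ m ih =>
        intro k i hi
        have h := hS (.inl (k, i.castSucc))
        have h2 : i.castSucc = Fin.succ ⟨m, by omega⟩ := Fin.ext hi
        simp only [Sum.elim_inl, aboveFace, Fin.lastCases_castSucc] at h
        rw [h, h2]
        exact ih k ⟨m, by omega⟩ rfl
    rintro (_ | ⟨k, i⟩)
    · exact h0
    · exact h1 _ k i rfl
  area_nonneg := by
    rintro (_ | ⟨k, i⟩) hf
    · exact absurd rfl hf
    rw [Finset.sum_sub_distrib, sum_left_eq, sum_right_eq]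
    simp only [Sum.elim_inl, Sum.elim_inr, crossp]
    have h1 := hx (Fin.castSucc_lt_succ (i := k)).le
    have h2 := hy k.castSucc (Fin.castSucc_lt_succ (i := i)).le
    have h3 := hy k.succ (Fin.castSucc_lt_succ (i := i)).le
    nlinarith [mul_nonneg (sub_nonneg.mpr h1) (sub_nonneg.mpr h2),
      mul_nonneg (sub_nonneg.mpr h1) (sub_nonneg.mpr h3)]

theorem gridComplex_area (x : Fin (M + 1) → ℝ) (y : Fin (M + 1) → Fin (n + 1) → ℝ)
    (hx : Monotone x) (hy : ∀ k, Monotone (y k)) (k : Fin M) (i : Fin n) :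
    (gridComplex x y hx hy).area (some (k, i)) = (x k.succ - x k.castSucc) *
      ((y k.castSucc i.succ - y k.castSucc i.castSucc) +
        (y k.succ i.succ - y k.succ i.castSucc)) / 2 := by
  have h : ∀ e, (∑ b, if (gridComplex x y hx hy).face (e, b) = some (k, i) then
      crossp ((gridComplex x y hx hy).pos ((gridComplex x y hx hy).tail (e, b)))
        ((gridComplex x y hx hy).vec (e, b)) else 0) =
      (if (gridComplex x y hx hy).left e = some (k, i) then
        crossp ((gridComplex x y hx hy).pos ((gridComplex x y hx hy).src e))
          ((gridComplex x y hx hy).pos ((gridComplex x y hx hy).tgt e)) else 0) -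
      (if (gridComplex x y hx hy).right e = some (k, i) then
        crossp ((gridComplex x y hx hy).pos ((gridComplex x y hx hy).src e))
          ((gridComplex x y hx hy).pos ((gridComplex x y hx hy).tgt e)) else 0) := by
    intro e
    rw [Fintype.sum_bool]
    simp only [PlaneComplex.face, PlaneComplex.tail, PlaneComplex.vec, PlaneComplex.rev, crossp,
      Bool.not_true, Bool.not_false, cond_true, cond_false]
    split_ifs <;> simp <;> ring
  rw [PlaneComplex.area, Fintype.sum_prod_type]
  simp only [h]
  rw [Finset.sum_sub_distrib]
  congr 1
  refine (congrArg₂ (· - ·) (sum_left_eq k i _) (sum_right_eq k i _)).trans ?_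
  simp only [gridComplex, Sum.elim_inl, Sum.elim_inr, crossp]
  ring

end Grid

/-! ### Slab decompositions of finite families of segments -/

/-- A decomposition of the plane into vertical slabs, each cut by affine functions
`y t 0 ≤ ⋯ ≤ y t n`, adapted to a set `D` and a bound `R`. -/
structure SlabDecomposition (D : Set ℂ) (R : ℝ) where
  M : ℕ
  n : ℕ
  x : Fin (M + 1) → ℝ
  y : ℝ → Fin (n + 1) → ℝ
  strictMono_x : StrictMono x
  monotone_y : ∀ t, Monotone (y t)
  slope : Fin M → Fin (n + 1) → ℝ
  icept : Fin M → Fin (n + 1) → ℝ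
  y_eq : ∀ k : Fin M, ∀ t ∈ Set.Icc (x k.castSucc) (x k.succ), ∀ i, y t i = slope k i * t + icept k i
  strictMono_y : ∀ k : Fin M, ∀ t ∈ Set.Ioo (x k.castSucc) (x k.succ), StrictMono (y t)
  mem_range : ∀ k : Fin M, ∀ z ∈ D, z.re ∈ Set.Ioo (x k.castSucc) (x k.succ) →
    z.im ∈ Set.range (y z.re)
  x_zero_le : x 0 ≤ -R
  le_x_last : R ≤ x (Fin.last M)
  y_zero_le : ∀ t, y t 0 ≤ -R
  le_y_last : ∀ t, R ≤ y t (Fin.last n)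

theorem exists_slabDecomposition_of_lines (L : Finset (ℝ × ℝ)) (X : Finset ℝ) {R : ℝ}
    (hLR : (0, R) ∈ L) (hLR' : (0, -R) ∈ L) (hXR : R ∈ X) (hXR' : -R ∈ X)
    (hcross : ∀ p ∈ L, ∀ q ∈ L, (p.2 - q.2) / (q.1 - p.1) ∈ X) {D : Set ℂ}
    (hD : ∀ z ∈ D, z.re ∉ X → ∃ p ∈ L, z.im = p.1 * z.re + p.2) :
    Nonempty (SlabDecomposition D R) := by
  obtain ⟨n, hn⟩ : ∃ n, L.card = n + 1 :=
    Nat.exists_eq_add_one_of_ne_zero (Finset.card_ne_zero_of_mem hLR)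
  obtain ⟨M, hM⟩ : ∃ M, X.card = M + 1 :=
    Nat.exists_eq_add_one_of_ne_zero (Finset.card_ne_zero_of_mem hXR)
  set x : Fin (M + 1) → ℝ := fun i => X.orderEmbOfFin hM i with hx
  have hxm : StrictMono x := (X.orderEmbOfFin hM).strictMono
  have hxr : ∀ t ∈ X, ∃ k, x k = t := by
    intro t ht
    have := X.range_orderEmbOfFin hM
    exact (Set.ext_iff.mp this t).mpr ht
  set l : Fin (n + 1) → ℝ × ℝ := fun i => (L.equivFinOfCardEq hn).symm i with hl
  have hlL : ∀ i, l i ∈ L := fun i => ((L.equivFinOfCardEq hn).symm i).2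
  have hlinj : Function.Injective l :=
    Subtype.val_injective.comp (L.equivFinOfCardEq hn).symm.injective
  have hlr : ∀ p ∈ L, ∃ i, l i = p := fun p hp =>
    ⟨L.equivFinOfCardEq hn ⟨p, hp⟩, by simp [hl]⟩
  set v : ℝ → Fin (n + 1) → ℝ := fun t i => (l i).1 * t + (l i).2 with hv
  set y : ℝ → Fin (n + 1) → ℝ := fun t i => v t (Tuple.sort (v t) i) with hy
  have hym : ∀ t, Monotone (y t) := fun t => Tuple.monotone_sort (v t)
  have hyr : ∀ t i, ∃ j, y t j = v t i := fun t i =>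
    ⟨(Tuple.sort (v t)).symm i, by simp [hy]⟩
  have hnot : ∀ k : Fin M, ∀ t ∈ Set.Ioo (x k.castSucc) (x k.succ), t ∉ X := by
    intro k t ht htX
    obtain ⟨j, rfl⟩ := hxr t htX
    have h1 := hxm.lt_iff_lt.mp ht.1
    have h2 := hxm.lt_iff_lt.mp ht.2
    rw [Fin.lt_def] at h1 h2
    simp at h1 h2
    omega
  have hne : ∀ k : Fin M, ∀ t ∈ Set.Ioo (x k.castSucc) (x k.succ), ∀ i j, i ≠ j →
      v t i ≠ v t j := by
    intro k t ht i j hij h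
    by_cases hs : (l i).1 = (l j).1
    · refine hij (hlinj (Prod.ext hs ?_))
      simp only [hv, hs] at h
      linarith
    · refine hnot k t ht ?_
      convert hcross _ (hlL i) _ (hlL j) using 1
      rw [eq_div_iff (sub_ne_zero.mpr (Ne.symm hs))]
      simp only [hv] at h
      linarith
  have hσ : ∀ k : Fin M, ∃ σ : Equiv.Perm (Fin (n + 1)),
      (∀ t ∈ Set.Ioo (x k.castSucc) (x k.succ), StrictMono (v t ∘ σ)) ∧
      ∀ t ∈ Set.Icc (x k.castSucc) (x k.succ), ∀ i, y t i = v t (σ i) := by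
    intro k
    have hlt : x k.castSucc < x k.succ := hxm Fin.castSucc_lt_succ
    set m := (x k.castSucc + x k.succ) / 2 with hm
    have hmI : m ∈ Set.Ioo (x k.castSucc) (x k.succ) := ⟨by linarith, by linarith⟩
    set σ := Tuple.sort (v m)
    have hstrict : ∀ t ∈ Set.Ioo (x k.castSucc) (x k.succ), StrictMono (v t ∘ σ) := by
      intro t ht i j hij
      have h1 : v m (σ i) < v m (σ j) :=
        lt_of_le_of_ne (Tuple.monotone_sort (v m) hij.le)
          (hne k m hmI _ _ fun h => hij.ne (σ.injective h))
      by_contra! h2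
      change v t (σ j) ≤ v t (σ i) at h2
      set A := (l (σ j)).1 - (l (σ i)).1 with hA
      set C := (l (σ j)).2 - (l (σ i)).2 with hC
      have h3 : 0 < A * m + C := by
        simp only [hv] at h1
        simp only [hA, hC]
        linarith
      have h4 : A * t + C ≤ 0 := by
        simp only [hv] at h2
        simp only [hA, hC]
        linarith
      obtain ⟨w, hw, hw0⟩ : ∃ w ∈ Set.Ioo (x k.castSucc) (x k.succ), A * w + C = 0 := by
        have hcont : Continuous fun w : ℝ => A * w + C := by fun_prop
        have := isPreconnected_Ioo.intermediate_value₂ (f := fun w : ℝ => A * w + C)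
          (g := fun _ => 0) ht hmI hcont.continuousOn continuousOn_const h4 h3.le
        exact this
      refine hne k w hw _ _ (fun h => hij.ne (σ.injective h)) ?_
      simp only [hv]
      simp only [hA, hC] at hw0
      linarith
    refine ⟨σ, hstrict, fun t ht i => ?_⟩
    have hmono : Monotone (v t ∘ σ) := by
      intro i j hij
      rcases hij.eq_or_lt with rfl | hij
      · rfl
      have hcl : t ∈ closure (Set.Ioo (x k.castSucc) (x k.succ)) := by
        rwa [closure_Ioo hlt.ne]
      have hc1 : Continuous fun t => (v t ∘ σ) i := by simp only [hv, Function.comp]; fun_prop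
      have hc2 : Continuous fun t => (v t ∘ σ) j := by simp only [hv, Function.comp]; fun_prop
      exact closure_minimal (s := Set.Ioo (x k.castSucc) (x k.succ))
        (t := {t | (v t ∘ σ) i ≤ (v t ∘ σ) j}) (fun t ht => (hstrict t ht hij).le)
        (isClosed_le hc1 hc2) hcl
    exact congrFun (Tuple.unique_monotone (Tuple.monotone_sort (v t)) hmono) i
  choose σ hσ1 hσ2 using hσ
  refine ⟨⟨M, n, x, y, hxm, hym, fun k i => (l (σ k i)).1, fun k i => (l (σ k i)).2,
    fun k t ht i => hσ2 k t ht i, fun k t ht => ?_, fun k z hz hzk => ?_, ?_, ?_, ?_, ?_⟩⟩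
  · have : y t = v t ∘ σ k := funext (hσ2 k t (Set.Ioo_subset_Icc_self ht))
    rw [this]
    exact hσ1 k t ht
  · obtain ⟨p, hp, hzp⟩ := hD z hz (hnot k _ hzk)
    obtain ⟨i, rfl⟩ := hlr p hp
    obtain ⟨j, hj⟩ := hyr z.re i
    exact ⟨j, hj.trans hzp.symm⟩
  · obtain ⟨k, hk⟩ := hxr _ hXR'
    rw [← hk]
    exact hxm.monotone (Fin.zero_le _)
  · obtain ⟨k, hk⟩ := hxr _ hXR
    rw [← hk]
    exact hxm.monotone (Fin.le_last _)
  · intro t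
    obtain ⟨i, hi⟩ := hlr _ hLR'
    obtain ⟨j, hj⟩ := hyr t i
    have h1 := hym t (Fin.zero_le j)
    simp only [hv, hi] at hj
    linarith
  · intro t
    obtain ⟨i, hi⟩ := hlr _ hLR
    obtain ⟨j, hj⟩ := hyr t i
    have h1 := hym t (Fin.le_last j)
    simp only [hv, hi] at hj
    linarith

theorem exists_slabDecomposition {S : Type*} [Fintype S] (a b : S → ℂ) (R : ℝ) :
    Nonempty (SlabDecomposition (⋃ s, segment ℝ (a s) (b s)) R) := by
  classical
  set m : S → ℝ := fun s => ((b s).im - (a s).im) / ((b s).re - (a s).re) with hm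
  set L : Finset (ℝ × ℝ) :=
    insert (0, R) (insert (0, -R) (Finset.univ.image fun s => (m s, (a s).im - m s * (a s).re)))
    with hL
  set X : Finset ℝ := insert R (insert (-R) ((Finset.univ.image fun s => (a s).re) ∪
    (L ×ˢ L).image fun p => (p.1.2 - p.2.2) / (p.2.1 - p.1.1))) with hX
  refine exists_slabDecomposition_of_lines L X (by simp [hL]) (by simp [hL]) (by simp [hX])
    (by simp [hX]) (fun p hp q hq => ?_) fun z hz hzX => ?_
  · simp only [hX, Finset.mem_insert, Finset.mem_union]
    exact Or.inr (Or.inr (Or.inr (Finset.mem_image.mpr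
      ⟨(p, q), Finset.mem_product.mpr ⟨hp, hq⟩, rfl⟩)))
  · obtain ⟨s, hs⟩ := Set.mem_iUnion.mp hz
    refine ⟨(m s, (a s).im - m s * (a s).re), Finset.mem_insert_of_mem (Finset.mem_insert_of_mem
      (Finset.mem_image_of_mem _ (Finset.mem_univ s))), ?_⟩
    rw [segment_eq_image'] at hs
    obtain ⟨t, -, rfl⟩ := hs
    have hne : (b s).re - (a s).re ≠ 0 := by
      intro h
      refine hzX ?_
      simp [hX, h]
    simp only [hm, Complex.add_re, Complex.add_im, Complex.real_smul, Complex.mul_re,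
      Complex.mul_im, Complex.ofReal_re, Complex.ofReal_im, Complex.sub_re, Complex.sub_im]
    field_simp
    ring

/-! ### The length of a labelled segment arrangement -/

section Intervals

variable {n : ℕ} {f : Fin (n + 1) → ℝ}

theorem exists_mem_Ioo_of_notMem_range {t : ℝ} (h0 : f 0 < t) (h1 : t < f (Fin.last n))
    (ht : t ∉ Set.range f) : ∃ k : Fin n, t ∈ Set.Ioo (f k.castSucc) (f k.succ) := by
  by_contra! h
  have key : ∀ k : Fin (n + 1), f k < t := by
    intro k
    induction k using Fin.induction with
    | zero => exact h0
    | succ k ih =>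
      refine lt_of_le_of_ne (not_lt.mp fun h2 => h k ⟨ih, h2⟩) fun h2 => ht ⟨_, h2⟩
  exact (key _).not_gt h1

theorem Monotone.eq_of_mem_Ioo (hf : Monotone f) {t : ℝ} {k k' : Fin n}
    (h : t ∈ Set.Ioo (f k.castSucc) (f k.succ)) (h' : t ∈ Set.Ioo (f k'.castSucc) (f k'.succ)) :
    k = k' := by
  have h1 := hf.reflect_lt (h.1.trans h'.2)
  have h2 := hf.reflect_lt (h'.1.trans h.2)
  rw [Fin.lt_def] at h1 h2
  simp only [Fin.val_castSucc, Fin.val_succ] at h1 h2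
  exact Fin.ext (by omega)

theorem Monotone.notMem_Ioo (hf : Monotone f) {k : Fin n} {j : Fin (n + 1)} :
    f j ∉ Set.Ioo (f k.castSucc) (f k.succ) := by
  intro h
  have h1 := hf.reflect_lt h.1
  have h2 := hf.reflect_lt h.2
  rw [Fin.lt_def] at h1 h2
  simp only [Fin.val_castSucc, Fin.val_succ] at h1 h2
  omega

end Intervals

namespace SlabDecomposition

variable {D : Set ℂ} {R : ℝ} (d : SlabDecomposition D R)

/-- The open cells of a slab decomposition. -/
def cell (k : Fin d.M) (i : Fin d.n) : Set ℂ :=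
  {z | z.re ∈ Set.Ioo (d.x k.castSucc) (d.x k.succ) ∧
    z.im ∈ Set.Ioo (d.y z.re i.castSucc) (d.y z.re i.succ)}

theorem y_eq' {k : Fin d.M} {t : ℝ} (ht : t ∈ Set.Ioo (d.x k.castSucc) (d.x k.succ))
    (i : Fin (d.n + 1)) : d.y t i = d.slope k i * t + d.icept k i :=
  d.y_eq k t (Set.Ioo_subset_Icc_self ht) i

theorem cell_eq (k : Fin d.M) (i : Fin d.n) :
    d.cell k i = {z | z.re ∈ Set.Ioo (d.x k.castSucc) (d.x k.succ) ∧
      z.im ∈ Set.Ioo (d.slope k i.castSucc * z.re + d.icept k i.castSucc)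
        (d.slope k i.succ * z.re + d.icept k i.succ)} := by
  ext z
  refine and_congr_right fun hz => ?_
  rw [d.y_eq' hz, d.y_eq' hz]

theorem convex_cell (k : Fin d.M) (i : Fin d.n) : Convex ℝ (d.cell k i) := by
  rw [cell_eq]
  rintro z ⟨⟨h1, h2⟩, h3, h4⟩ w ⟨⟨h5, h6⟩, h7, h8⟩ s t hs ht hst
  have hcomb : ∀ u v p q : ℝ, u < p → v < q → s * u + t * v < s * p + t * q := by
    intro u v p q hu hv
    rcases hs.eq_or_lt with rfl | hs
    · rw [zero_add] at hst
      subst hst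
      linarith
    · have := mul_lt_mul_of_pos_left hu hs
      have := mul_le_mul_of_nonneg_left hv.le ht
      linarith
  obtain rfl : t = 1 - s := by linarith
  simp only [Set.mem_ofPred_eq, Complex.add_re, Complex.add_im, Complex.real_smul, Complex.mul_re,
    Complex.mul_im, Complex.ofReal_re, Complex.ofReal_im, zero_mul, sub_zero, add_zero, Set.mem_Ioo]
  have a1 := hcomb _ _ _ _ h1 h5
  have a2 := hcomb _ _ _ _ h2 h6
  have a3 := hcomb _ _ _ _ h3 h7
  have a4 := hcomb _ _ _ _ h4 h8
  refine ⟨⟨?_, ?_⟩, ?_, ?_⟩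
  all_goals ring_nf at a1 a2 a3 a4 ⊢; linarith

theorem disjoint_cell (k : Fin d.M) (i : Fin d.n) : Disjoint (d.cell k i) D := by
  rw [Set.disjoint_left]
  rintro z ⟨hz, hz2⟩ hD
  obtain ⟨j, hj⟩ := d.mem_range k z hD hz
  exact (d.monotone_y z.re).notMem_Ioo (hj ▸ hz2)

/-- The centre of an open cell. -/
noncomputable def center (k : Fin d.M) (i : Fin d.n) : ℂ :=
  let t := (d.x k.castSucc + d.x k.succ) / 2
  ⟨t, (d.y t i.castSucc + d.y t i.succ) / 2⟩

theorem center_mem_cell (k : Fin d.M) (i : Fin d.n) : d.center k i ∈ d.cell k i := by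
  have h1 : d.x k.castSucc < d.x k.succ := d.strictMono_x Fin.castSucc_lt_succ
  have hm : (d.x k.castSucc + d.x k.succ) / 2 ∈ Set.Ioo (d.x k.castSucc) (d.x k.succ) :=
    ⟨by linarith, by linarith⟩
  have h2 := d.strictMono_y k _ hm (Fin.castSucc_lt_succ (i := i))
  refine ⟨hm, ?_, ?_⟩
  · simp only [center]; linarith
  · simp only [center]; linarith

/-- The grid complex of a slab decomposition. -/
noncomputable abbrev complex : PlaneComplex (Option (Fin d.M × Fin d.n))
    (Fin d.M × Fin (d.n + 1) ⊕ Fin (d.M + 1) × Fin d.n) (Fin (d.M + 1) × Fin (d.n + 1)) :=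
  gridComplex d.x (fun k => d.y (d.x k)) d.strictMono_x.monotone fun _ => d.monotone_y _

theorem volume_cell (k : Fin d.M) (i : Fin d.n) :
    MeasureTheory.volume (d.cell k i) = ENNReal.ofReal (d.complex.area (some (k, i))) := by
  have h1 : d.x k.castSucc ≤ d.x k.succ := (d.strictMono_x Fin.castSucc_lt_succ).le
  set f : Fin (d.n + 1) → ℝ → ℝ := fun j t => d.slope k j * t + d.icept k j with hf
  have hcell : d.cell k i = Complex.measurableEquivRealProd ⁻¹'
      regionBetween (f i.castSucc) (f i.succ) (Set.Ioo (d.x k.castSucc) (d.x k.succ)) := by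
    rw [cell_eq]
    rfl
  have hc : ∀ j, Continuous (f j) := fun j => by simp only [hf]; fun_prop
  have hint : ∀ j, MeasureTheory.IntegrableOn (f j) (Set.Ioo (d.x k.castSucc) (d.x k.succ)) :=
    fun j => ((hc j).integrableOn_Icc).mono_set Set.Ioo_subset_Icc_self
  rw [hcell, Complex.volume_preserving_equiv_real_prod.measure_preimage_equiv,
    MeasureTheory.Measure.volume_eq_prod,
    volume_regionBetween_eq_integral (hint _) (hint _) measurableSet_Ioo, gridComplex_area]
  · congr 1
    rw [← MeasureTheory.integral_Ioc_eq_integral_Ioo, ← intervalIntegral.integral_of_le h1]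
    have e1 := fun j => d.y_eq k _ (Set.left_mem_Icc.mpr h1) j
    have e2 := fun j => d.y_eq k _ (Set.right_mem_Icc.mpr h1) j
    rw [e1, e1, e2, e2]
    have hd : ∀ t, HasDerivAt (fun t => (d.slope k i.succ - d.slope k i.castSucc) * (t ^ 2 / 2) +
        (d.icept k i.succ - d.icept k i.castSucc) * t) ((f i.succ - f i.castSucc) t) t := by
      intro t
      have h1 : HasDerivAt (fun t : ℝ => (d.slope k i.succ - d.slope k i.castSucc) * (t ^ 2 / 2)) _
          t := ((hasDerivAt_pow 2 t).div_const 2).const_mul _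
      have h2 : HasDerivAt (fun t : ℝ => (d.icept k i.succ - d.icept k i.castSucc) * t) _ t :=
        (hasDerivAt_id t).const_mul _
      refine (h1.add h2).congr_deriv ?_
      change _ = (d.slope k i.succ * t + d.icept k i.succ) -
        (d.slope k i.castSucc * t + d.icept k i.castSucc)
      push_cast
      ring
    rw [intervalIntegral.integral_eq_sub_of_hasDerivAt (fun t _ => hd t)
      (((hc _).sub (hc _)).intervalIntegrable _ _)]
    ring
  · intro t ht
    have h := d.monotone_y t (Fin.castSucc_lt_succ (i := i)).le
    rwa [d.y_eq' ht, d.y_eq' ht] at h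

/-- The open edges of a slab decomposition. -/
def openEdge : Fin d.M × Fin (d.n + 1) ⊕ Fin (d.M + 1) × Fin d.n → Set ℂ
  | .inl e => {z | z.re ∈ Set.Ioo (d.x e.1.castSucc) (d.x e.1.succ) ∧ z.im = d.y z.re e.2}
  | .inr e => {z | z.re = d.x e.1 ∧ z.im ∈ Set.Ioo (d.y z.re e.2.castSucc) (d.y z.re e.2.succ)}

theorem pairwise_disjoint_openEdge : Pairwise (Function.onFun Disjoint d.openEdge) := by
  rintro (⟨k, i⟩ | ⟨k, i⟩) (⟨k', i'⟩ | ⟨k', i'⟩) hne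
  all_goals
    rw [Function.onFun, Set.disjoint_left]
    rintro z ⟨h1, h2⟩ ⟨h3, h4⟩
    dsimp only at h1 h2 h3 h4
  · obtain rfl := d.strictMono_x.monotone.eq_of_mem_Ioo h1 h3
    obtain rfl := (d.strictMono_y k _ h1).injective (h2.symm.trans h4)
    exact hne rfl
  · exact d.strictMono_x.monotone.notMem_Ioo (h3 ▸ h1)
  · exact d.strictMono_x.monotone.notMem_Ioo (h1 ▸ h3)
  · obtain rfl := d.strictMono_x.injective (h1.symm.trans h3)
    obtain rfl := (d.monotone_y _).eq_of_mem_Ioo h2 h4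
    exact hne rfl

theorem measurableSet_openEdge (e) : MeasurableSet (d.openEdge e) := by
  rcases e with ⟨k, i⟩ | ⟨k, i⟩
  · have : d.openEdge (.inl (k, i)) =
        Complex.re ⁻¹' Set.Ioo (d.x k.castSucc) (d.x k.succ) ∩
          {z | z.im = d.slope k i * z.re + d.icept k i} := by
      ext z
      refine and_congr_right fun hz => ?_
      rw [d.y_eq' hz, Set.mem_ofPred_eq]
    rw [this]
    refine (measurableSet_Ioo.preimage Complex.measurable_re).inter
      (measurableSet_eq_fun Complex.measurable_im ?_)
    exact (Complex.measurable_re.const_mul _).add_const _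
  · have : d.openEdge (.inr (k, i)) = {z | z.re = d.x k} ∩
        Complex.im ⁻¹' Set.Ioo (d.y (d.x k) i.castSucc) (d.y (d.x k) i.succ) := by
      ext z
      refine and_congr_right fun hz => ?_
      rw [hz, Set.mem_preimage]
    rw [this]
    exact (measurableSet_eq_fun Complex.measurable_re measurable_const).inter
      (measurableSet_Ioo.preimage Complex.measurable_im)

theorem segment_subset_openEdge (e) : segment ℝ (d.complex.pos (d.complex.src e))
    (d.complex.pos (d.complex.tgt e)) ⊆
      d.openEdge e ∪ {d.complex.pos (d.complex.src e), d.complex.pos (d.complex.tgt e)} := by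
  intro z hz
  rw [← insert_endpoints_openSegment] at hz
  rcases hz with rfl | rfl | hz
  · simp
  · simp
  rw [openSegment_eq_image'] at hz
  obtain ⟨t, ⟨ht0, ht1⟩, rfl⟩ := hz
  rcases e with ⟨k, i⟩ | ⟨k, i⟩
  · left
    have h1 : d.x k.castSucc < d.x k.succ := d.strictMono_x Fin.castSucc_lt_succ
    have e1 := d.y_eq k _ (Set.left_mem_Icc.mpr h1.le) i
    have e2 := d.y_eq k _ (Set.right_mem_Icc.mpr h1.le) i
    have hre : d.x k.castSucc + t * (d.x k.succ - d.x k.castSucc) ∈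
        Set.Ioo (d.x k.castSucc) (d.x k.succ) := by
      constructor <;> nlinarith
    simp only [openEdge, gridComplex, Set.mem_ofPred_eq, Sum.elim_inl, Complex.add_re,
      Complex.add_im, Complex.real_smul, Complex.mul_re, Complex.mul_im, Complex.ofReal_re,
      Complex.ofReal_im, Complex.sub_re, Complex.sub_im, zero_mul, sub_zero, add_zero]
    refine ⟨hre, ?_⟩
    rw [d.y_eq' hre, e1, e2]
    ring
  · by_cases hy : d.y (d.x k) i.castSucc = d.y (d.x k) i.succ
    · right
      left
      simp [gridComplex, hy]
    left
    have h1 : d.y (d.x k) i.castSucc < d.y (d.x k) i.succ :=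
      lt_of_le_of_ne (d.monotone_y _ Fin.castSucc_lt_succ.le) hy
    simp only [openEdge, gridComplex, Set.mem_ofPred_eq, Sum.elim_inr, Complex.add_re,
      Complex.add_im, Complex.real_smul, Complex.mul_re, Complex.mul_im, Complex.ofReal_re,
      Complex.ofReal_im, Complex.sub_re, Complex.sub_im, zero_mul, add_zero, sub_self,
      mul_zero, true_and]
    constructor <;> nlinarith

theorem norm_vec_le (e) :
    ENNReal.ofReal ‖d.complex.vec (e, true)‖ ≤ MeasureTheory.Measure.hausdorffMeasure 1
      (d.openEdge e) := by
  have h1 : ENNReal.ofReal ‖d.complex.vec (e, true)‖ = MeasureTheory.Measure.hausdorffMeasure 1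
      (segment ℝ (d.complex.pos (d.complex.src e)) (d.complex.pos (d.complex.tgt e))) := by
    rw [MeasureTheory.hausdorffMeasure_segment, edist_comm, edist_dist, dist_eq_norm]
    rfl
  have : MeasureTheory.NullSingletonClass (MeasureTheory.Measure.hausdorffMeasure 1 :
      MeasureTheory.Measure ℂ) := MeasureTheory.Measure.nullSingletonClass_hausdorff ℂ one_pos
  rw [h1]
  refine (MeasureTheory.measure_mono (d.segment_subset_openEdge e)).trans
    ((MeasureTheory.measure_union_le _ _).trans ?_)
  rw [(Set.toFinite {d.complex.pos (d.complex.src e), d.complex.pos (d.complex.tgt e)}).measure_zero,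
    add_zero]

theorem mem_closure_cell {k : Fin d.M} {i : Fin d.n} {z : ℂ}
    (hz : z.re ∈ Set.Icc (d.x k.castSucc) (d.x k.succ))
    (hi : z.im ∈ Set.Ioo (d.y z.re i.castSucc) (d.y z.re i.succ)) : z ∈ closure (d.cell k i) := by
  rw [d.y_eq k _ hz, d.y_eq k _ hz] at hi
  have h1 : d.x k.castSucc < d.x k.succ := d.strictMono_x Fin.castSucc_lt_succ
  set m := (d.x k.castSucc + d.x k.succ) / 2 with hm
  have hc : Continuous fun s : ℝ => z + ((s * (m - z.re) : ℝ) : ℂ) := by fun_prop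
  have ht : Filter.Tendsto (fun s : ℝ => z + ((s * (m - z.re) : ℝ) : ℂ))
      (nhdsWithin 0 (Set.Ioi 0)) (nhds z) := by
    have h2 := (hc.tendsto 0).mono_left (nhdsWithin_le_nhds (s := Set.Ioi 0))
    simpa using h2
  refine mem_closure_of_tendsto ht ?_
  have hopen : IsOpen {w : ℂ | w.im ∈ Set.Ioo (d.slope k i.castSucc * w.re + d.icept k i.castSucc)
      (d.slope k i.succ * w.re + d.icept k i.succ)} :=
    (isOpen_lt (by fun_prop) (by fun_prop)).and (isOpen_lt (by fun_prop) (by fun_prop))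
  filter_upwards [Ioo_mem_nhdsGT one_pos, ht.eventually_mem (hopen.mem_nhds hi)] with s hs hs2
  rw [cell_eq]
  refine ⟨?_, hs2⟩
  simp only [Complex.add_re, Complex.ofReal_re]
  obtain ⟨h3, h4⟩ := hz
  obtain ⟨h5, h6⟩ := hs
  constructor
  · nlinarith
  · nlinarith

theorem mem_closure_openEdge_cells {ι : Type*} (lab : ℂ → Option ι)
    (hR : ∀ z, R ≤ ‖z‖ → lab z = none) (l : Option (Fin d.M × Fin d.n) → Option ι)
    (hl : l none = none) (hcell : ∀ k i, ∀ z ∈ d.cell k i, lab z = l (some (k, i))) (e) (z : ℂ)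
    (hz : z ∈ d.openEdge e) : z ∈ closure {w | lab w = l (d.complex.left e)} ∧
      z ∈ closure {w | lab w = l (d.complex.right e)} := by
  have hout : (R ≤ |z.re| ∨ R ≤ |z.im|) → z ∈ closure {w | lab w = l none} := fun h =>
    subset_closure <| (hR z <| h.elim (fun h => h.trans (Complex.abs_re_le_norm z))
      fun h => h.trans (Complex.abs_im_le_norm z)).trans hl.symm
  have hin : ∀ {k i}, z ∈ closure (d.cell k i) →
      z ∈ closure {w | lab w = l (some (k, i))} := fun {k i} h => closure_mono (hcell k i) h
  rcases e with ⟨k, i⟩ | ⟨k, i⟩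
  · obtain ⟨hz1, hz2⟩ := hz
    dsimp only at hz1 hz2
    constructor
    · change z ∈ closure {w | lab w = l (aboveFace k i)}
      cases i using Fin.lastCases with
      | last =>
        rw [aboveFace, Fin.lastCases_last]
        exact hout (.inr ((d.le_y_last _).trans (hz2.symm.le.trans (le_abs_self _))))
      | cast i =>
        rw [aboveFace, Fin.lastCases_castSucc]
        refine hin ?_
        have h1 := d.strictMono_y k _ hz1 (Fin.castSucc_lt_succ (i := i))
        have ht : Filter.Tendsto (fun s : ℝ => z + s * Complex.I) (nhdsWithin 0 (Set.Ioi 0))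
            (nhds z) := by
          have : Continuous fun s : ℝ => z + s * Complex.I := by fun_prop
          have h2 := (this.tendsto 0).mono_left (nhdsWithin_le_nhds (s := Set.Ioi 0))
          simpa using h2
        refine mem_closure_of_tendsto ht ?_
        filter_upwards [Ioo_mem_nhdsGT (sub_pos.mpr h1)] with s hs
        have : (z + s * Complex.I).re = z.re := by simp
        refine ⟨this ▸ hz1, ?_⟩
        rw [this]
        simp only [Complex.add_im, Complex.mul_im, Complex.ofReal_re, Complex.I_im,
          Complex.ofReal_im, Complex.I_re, hz2]
        constructor <;> linarith [hs.1, hs.2]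
    · change z ∈ closure {w | lab w = l (belowFace k i)}
      cases i using Fin.cases with
      | zero =>
        rw [belowFace, Fin.cases_zero]
        refine hout (.inr ?_)
        have := d.y_zero_le z.re
        rw [← hz2] at this
        linarith [neg_le_abs z.im]
      | succ i =>
        rw [belowFace, Fin.cases_succ]
        refine hin ?_
        have h1 := d.strictMono_y k _ hz1 (Fin.castSucc_lt_succ (i := i))
        have ht : Filter.Tendsto (fun s : ℝ => z - s * Complex.I) (nhdsWithin 0 (Set.Ioi 0))
            (nhds z) := by
          have : Continuous fun s : ℝ => z - s * Complex.I := by fun_prop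
          have h2 := (this.tendsto 0).mono_left (nhdsWithin_le_nhds (s := Set.Ioi 0))
          simpa using h2
        refine mem_closure_of_tendsto ht ?_
        filter_upwards [Ioo_mem_nhdsGT (sub_pos.mpr h1)] with s hs
        have : (z - s * Complex.I).re = z.re := by simp
        refine ⟨this ▸ hz1, ?_⟩
        rw [this]
        simp only [Complex.sub_im, Complex.mul_im, Complex.ofReal_re, Complex.I_im,
          Complex.ofReal_im, Complex.I_re, hz2]
        constructor <;> linarith [hs.1, hs.2]
  · obtain ⟨hz1, hz2⟩ := hz
    dsimp only at hz1 hz2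
    constructor
    · change z ∈ closure {w | lab w = l (beforeFace k i)}
      cases k using Fin.cases with
      | zero =>
        rw [beforeFace, Fin.cases_zero]
        refine hout (.inl ?_)
        have := d.x_zero_le
        rw [← hz1] at this
        linarith [neg_le_abs z.re]
      | succ k =>
        rw [beforeFace, Fin.cases_succ]
        have h1 : d.x k.castSucc < d.x k.succ := d.strictMono_x Fin.castSucc_lt_succ
        exact hin (d.mem_closure_cell ⟨h1.le.trans hz1.ge, hz1.le⟩ hz2)
    · change z ∈ closure {w | lab w = l (afterFace k i)}
      cases k using Fin.lastCases with
      | last =>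
        rw [afterFace, Fin.lastCases_last]
        exact hout (.inl (d.le_x_last.trans (hz1.symm.le.trans (le_abs_self _))))
      | cast k =>
        rw [afterFace, Fin.lastCases_castSucc]
        have h1 : d.x k.castSucc < d.x k.succ := d.strictMono_x Fin.castSucc_lt_succ
        exact hin (d.mem_closure_cell ⟨hz1.ge, hz1.trans_le h1.le⟩ hz2)

theorem openEdge_subset {ι : Type*} (hD : IsClosed D) (lab : ℂ → Option ι)
    (hconst : ∀ C : Set ℂ, Convex ℝ C → Disjoint C D → ∀ x ∈ C, ∀ y ∈ C, lab x = lab y)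
    (hR : ∀ z, R ≤ ‖z‖ → lab z = none) (l : Option (Fin d.M × Fin d.n) → Option ι)
    (hl : l none = none) (hcell : ∀ k i, ∀ z ∈ d.cell k i, lab z = l (some (k, i))) (e)
    (he : l (d.complex.left e) ≠ l (d.complex.right e)) : d.openEdge e ⊆ D := by
  intro z hz
  by_contra hzD
  obtain ⟨ε, hε, hball⟩ := Metric.isOpen_iff.mp hD.isOpen_compl z hzD
  obtain ⟨h1, h2⟩ := d.mem_closure_openEdge_cells lab hR l hl hcell e z hz
  obtain ⟨w, hw, hwz⟩ := Metric.mem_closure_iff.mp h1 ε hε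
  obtain ⟨v, hv, hvz⟩ := Metric.mem_closure_iff.mp h2 ε hε
  refine he ?_
  rw [← Set.mem_ofPred_eq.mp hw, ← Set.mem_ofPred_eq.mp hv]
  exact hconst _ (convex_ball z ε) (Set.disjoint_left.mpr hball) w (Metric.mem_ball'.mpr hwz) v
    (Metric.mem_ball'.mpr hvz)

theorem volume_label_le {ι : Type} [DecidableEq ι] (lab : ℂ → Option ι)
    (hR : ∀ z, R ≤ ‖z‖ → lab z = none) (l : Option (Fin d.M × Fin d.n) → Option ι)
    (hl : l none = none) (hcell : ∀ k i, ∀ z ∈ d.cell k i, lab z = l (some (k, i))) (j : ι) :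
    MeasureTheory.volume {z | lab z = some j} ≤
      ENNReal.ofReal (d.complex.classArea l (some j)) := by
  classical
  set J : Finset (Fin d.M × Fin d.n) := {p | l (some p) = some j} with hJ
  have harea : d.complex.classArea l (some j) = ∑ p ∈ J, d.complex.area (some p) := by
    rw [PlaneComplex.classArea, Finset.sum_filter, Fintype.sum_option, hl]
    simp [hJ, Finset.sum_filter]
  have hnull1 : MeasureTheory.volume {z : ℂ | z.re ∈ Set.range d.x} = 0 := by
    have : {z : ℂ | z.re ∈ Set.range d.x} = Complex.measurableEquivRealProd ⁻¹'
        (Set.range d.x ×ˢ Set.univ) := by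
      ext z; simp
    rw [this, Complex.volume_preserving_equiv_real_prod.measure_preimage_equiv,
      MeasureTheory.Measure.volume_eq_prod, MeasureTheory.Measure.prod_prod,
      (Set.finite_range d.x).measure_zero, zero_mul]
  have hnull2 : MeasureTheory.volume (⋃ e, d.openEdge (.inl e)) = 0 := by
    refine MeasureTheory.measure_iUnion_null fun e => ?_
    set s : Set (ℝ × ℝ) := {p | p.2 = d.slope e.1 e.2 * p.1 + d.icept e.1 e.2} with hs
    have hsm : MeasurableSet s :=
      measurableSet_eq_fun measurable_snd ((measurable_fst.const_mul _).add_const _)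
    have : d.openEdge (.inl e) ⊆ Complex.measurableEquivRealProd ⁻¹' s := by
      rintro z ⟨h1, h2⟩
      rw [d.y_eq' h1] at h2
      exact h2
    refine MeasureTheory.measure_mono_null this ?_
    rw [Complex.volume_preserving_equiv_real_prod.measure_preimage_equiv,
      MeasureTheory.Measure.volume_eq_prod, MeasureTheory.Measure.measure_prod_null hsm]
    refine Filter.Eventually.of_forall fun t => ?_
    have : Prod.mk t ⁻¹' s = {d.slope e.1 e.2 * t + d.icept e.1 e.2} := by
      ext u; simp [hs]
    change MeasureTheory.volume (Prod.mk t ⁻¹' s) = 0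
    rw [this, MeasureTheory.measure_singleton]
  have hsub : {z | lab z = some j} ⊆ (⋃ p ∈ J, d.cell p.1 p.2) ∪
      ({z : ℂ | z.re ∈ Set.range d.x} ∪ ⋃ e, d.openEdge (.inl e)) := by
    intro z hz
    have hzR : ‖z‖ < R := by
      by_contra! h
      rw [Set.mem_ofPred_eq, hR z h] at hz
      cases hz
    by_cases h1 : z.re ∈ Set.range d.x
    · exact .inr (.inl h1)
    have hre := abs_lt.mp ((Complex.abs_re_le_norm z).trans_lt hzR)
    have him := abs_lt.mp ((Complex.abs_im_le_norm z).trans_lt hzR)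
    obtain ⟨k, hk⟩ := exists_mem_Ioo_of_notMem_range (d.x_zero_le.trans_lt hre.1)
      (hre.2.trans_le d.le_x_last) h1
    by_cases h2 : z.im ∈ Set.range (d.y z.re)
    · obtain ⟨i, hi⟩ := h2
      exact .inr (.inr (Set.mem_iUnion.mpr ⟨(k, i), hk, hi.symm⟩))
    obtain ⟨i, hi⟩ := exists_mem_Ioo_of_notMem_range ((d.y_zero_le z.re).trans_lt him.1)
      (him.2.trans_le (d.le_y_last z.re)) h2
    refine .inl (Set.mem_iUnion₂.mpr ⟨(k, i), ?_, hk, hi⟩)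
    simp only [hJ, Finset.mem_filter, Finset.mem_univ, true_and]
    rw [← hcell k i z ⟨hk, hi⟩]
    exact hz
  calc MeasureTheory.volume {z | lab z = some j}
      ≤ MeasureTheory.volume (⋃ p ∈ J, d.cell p.1 p.2) + 0 := by
        refine (MeasureTheory.measure_mono hsub).trans ((MeasureTheory.measure_union_le _ _).trans
          (add_le_add le_rfl ?_))
        exact (MeasureTheory.measure_union_null hnull1 hnull2).le
    _ ≤ ∑ p ∈ J, MeasureTheory.volume (d.cell p.1 p.2) := by
        rw [add_zero]
        exact MeasureTheory.measure_biUnion_finset_le _ _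
    _ = _ := by
        have h0 : ∀ p ∈ J, 0 ≤ d.complex.area (some p) := fun p _ =>
          d.complex.area_nonneg' (Option.some_ne_none p)
        rw [harea, ENNReal.ofReal_sum_of_nonneg h0]
        exact Finset.sum_congr rfl fun p _ => d.volume_cell p.1 p.2

end SlabDecomposition

/-- The honeycomb inequality for a finite family of segments and a labelling of the plane that is
constant on convex sets avoiding the segments. -/
theorem segments_length_ge {S : Type} [Fintype S] (a b : S → ℂ) {ι : Type} [Fintype ι]
    [DecidableEq ι] (lab : ℂ → Option ι)
    (hconst : ∀ C : Set ℂ, Convex ℝ C → (∀ s, Disjoint C (segment ℝ (a s) (b s))) →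
      ∀ x ∈ C, ∀ y ∈ C, lab x = lab y) {R : ℝ} (hR : ∀ z, R ≤ ‖z‖ → lab z = none) :
    ∃ L : ℝ, 0 ≤ L ∧
      4 * Real.pi * ∑ i, (MeasureTheory.volume {z | lab z = some i}).toReal ≤ L ^ 2 ∧
      hexK * ∑ i, min 1 (MeasureTheory.volume {z | lab z = some i}).toReal + L / 200 ≤
        ∑ s, ‖b s - a s‖ := by
  classical
  set D : Set ℂ := ⋃ s, segment ℝ (a s) (b s) with hD
  obtain ⟨d⟩ := exists_slabDecomposition a b R
  rw [← hD] at d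
  have hDc : IsClosed D := isClosed_iUnion_of_finite fun s => by
    rw [segment_eq_image']
    exact (isCompact_Icc.image (by fun_prop)).isClosed
  have hconst' : ∀ C : Set ℂ, Convex ℝ C → Disjoint C D → ∀ x ∈ C, ∀ y ∈ C, lab x = lab y :=
    fun C hC hCD => hconst C hC (Set.disjoint_iUnion_right.mp hCD)
  set l : Option (Fin d.M × Fin d.n) → Option ι :=
    fun o => o.elim none fun p => lab (d.center p.1 p.2) with hl
  have hcell : ∀ k i, ∀ z ∈ d.cell k i, lab z = l (some (k, i)) := fun k i z hz =>
    hconst' _ (d.convex_cell k i) (d.disjoint_cell k i) z hz _ (d.center_mem_cell k i)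
  obtain ⟨L, hL0, hL1, hL2⟩ := d.complex.hexK_mul_sum_le l rfl
  have hvol : ∀ j, (MeasureTheory.volume {z | lab z = some j}).toReal ≤
      d.complex.classArea l (some j) := fun j =>
    ENNReal.toReal_le_of_le_ofReal (Finset.sum_nonneg fun f hf => d.complex.area_nonneg' fun h => by
      have hf2 := (Finset.mem_filter.mp hf).2
      rw [h] at hf2
      cases hf2) (d.volume_label_le lab hR l rfl hcell j)
  refine ⟨L, hL0, le_trans ?_ hL1, le_trans ?_ (hL2.trans ?_)⟩
  · have := Real.pi_pos
    gcongr with j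
    exact hvol j
  · have := hexK_pos
    gcongr with j
    exact hvol j
  · set μ : MeasureTheory.Measure ℂ := MeasureTheory.Measure.hausdorffMeasure 1
    rw [← ENNReal.ofReal_le_ofReal_iff (Finset.sum_nonneg fun s _ => norm_nonneg _),
      ENNReal.ofReal_sum_of_nonneg fun _ _ => norm_nonneg _,
      ENNReal.ofReal_sum_of_nonneg fun _ _ => norm_nonneg _]
    calc ∑ e ∈ d.complex.ifaceEdges l, ENNReal.ofReal ‖d.complex.vec (e, true)‖
        ≤ ∑ e ∈ d.complex.ifaceEdges l, μ (d.openEdge e) :=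
          Finset.sum_le_sum fun e _ => d.norm_vec_le e
      _ = μ (⋃ e ∈ d.complex.ifaceEdges l, d.openEdge e) :=
          (MeasureTheory.measure_biUnion_finset
            (fun e _ e' _ hne => d.pairwise_disjoint_openEdge hne)
            fun e _ => d.measurableSet_openEdge e).symm
      _ ≤ μ D := by
          refine MeasureTheory.measure_mono (Set.iUnion₂_subset fun e he => ?_)
          exact d.openEdge_subset hDc lab hconst' hR l rfl hcell e
            (by simpa [PlaneComplex.ifaceEdges] using he)
      _ ≤ ∑ s, μ (segment ℝ (a s) (b s)) := MeasureTheory.measure_iUnion_fintype_le _ _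
      _ = _ := Finset.sum_congr rfl fun s _ => by
          rw [MeasureTheory.hausdorffMeasure_segment, edist_comm, edist_dist, dist_eq_norm]

/-! ### Angles subtended at a point -/

/-- The signed angle subtended at `x` by the pair `a`, `b`. -/
noncomputable def ang (x a b : ℂ) : ℝ := Complex.arg ((b - x) / (a - x))

theorem ang_potential {x y : ℂ} {r : ℝ} (hx : x ∉ Metric.ball y r) :
    ∃ A : ℂ → ℝ, ∀ a ∈ Metric.ball y r, ∀ b ∈ Metric.ball y r, ang x a b = A b - A a := by
  refine ⟨fun p => Complex.arg ((p - x) / (y - x)), fun a ha b hb => ?_⟩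
  have hr : 0 < r := dist_nonneg.trans_lt (Metric.mem_ball.mp ha)
  have hyx : y - x ≠ 0 := by
    intro h
    rw [sub_eq_zero] at h
    exact hx (h ▸ Metric.mem_ball_self hr)
  have hre : ∀ p ∈ Metric.ball y r, 0 < ((p - x) / (y - x)).re := by
    intro p hp
    have h1 : (p - x) / (y - x) = 1 + (p - y) / (y - x) := by
      field_simp
      ring
    have h2 : ‖(p - y) / (y - x)‖ < 1 := by
      rw [norm_div, div_lt_one (norm_pos_iff.mpr hyx)]
      rw [Metric.mem_ball, not_lt, dist_comm, dist_eq_norm] at hx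
      rw [Metric.mem_ball, dist_eq_norm] at hp
      exact hp.trans_le hx
    have h3 := (abs_lt.mp ((Complex.abs_re_le_norm _).trans_lt h2)).1
    rw [h1, Complex.add_re, Complex.one_re]
    linarith
  have hne : ∀ p ∈ Metric.ball y r, (p - x) / (y - x) ≠ 0 := by
    intro p hp h
    have := hre p hp
    rw [h] at this
    exact lt_irrefl _ this
  have hb1 := abs_lt.mp (Complex.abs_arg_lt_pi_div_two_iff.mpr (.inl (hre a ha)))
  have hb2 := abs_lt.mp (Complex.abs_arg_lt_pi_div_two_iff.mpr (.inl (hre b hb)))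
  have hdiv : (b - x) / (a - x) = (b - x) / (y - x) / ((a - x) / (y - x)) := by
    rw [div_div_div_cancel_right₀ hyx]
  rw [ang, hdiv, ← Complex.arg_coe_angle_toReal_eq_arg,
    Complex.arg_div_coe_angle (hne b hb) (hne a ha), ← Real.Angle.coe_sub,
    Real.Angle.toReal_coe_eq_self_iff]
  constructor <;> linarith [hb1.1, hb1.2, hb2.1, hb2.2]

theorem div_mem_slitPlane_of_notMem_segment {z p q : ℂ} (h : z ∉ segment ℝ p q) :
    (z - p) / (z - q) ∈ Complex.slitPlane := by
  by_contra hs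
  refine h ?_
  have hzq : z - q ≠ 0 := by
    intro h1
    rw [sub_eq_zero] at h1
    exact h (h1 ▸ right_mem_segment ℝ p q)
  rw [Complex.mem_slitPlane_iff_not_le_zero, not_not, Complex.le_def] at hs
  set w := (z - p) / (z - q) with hw
  obtain ⟨h1, h2⟩ := hs
  simp only [Complex.zero_re, Complex.zero_im] at h1 h2
  have hwr : w = ((-(-w.re) : ℝ) : ℂ) := by
    apply Complex.ext <;> simp [h2]
  set s := -w.re with hsdef
  have hs0 : 0 ≤ s := by linarith
  have hz : z - p = -(s : ℂ) * (z - q) := by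
    have h3 : z - p = w * (z - q) := (div_mul_cancel₀ _ hzq).symm
    rw [hwr] at h3
    push_cast at h3
    exact h3
  refine ⟨1 / (1 + s), s / (1 + s), by positivity, by positivity, by field_simp, ?_⟩
  have hne : (1 + (s : ℂ)) ≠ 0 := by
    norm_cast
    positivity
  simp only [Complex.real_smul]
  push_cast
  field_simp
  linear_combination -hz

theorem ang_sub_ang {a b p q : ℂ} (h : Disjoint (segment ℝ a b) (segment ℝ p q)) :
    ang p a b - ang q a b =
      Complex.arg ((b - p) / (b - q)) - Complex.arg ((a - p) / (a - q)) := by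
  rw [Set.disjoint_left] at h
  set c : ℝ → ℂ := fun t => a + t * (b - a) with hc
  have hcs : ∀ t ∈ Set.Icc (0 : ℝ) 1, ∀ u ∈ Set.Icc (0 : ℝ) 1, u ≤ t → c u ∈ segment ℝ a (c t) := by
    intro t ht u hu hut
    rw [segment_eq_image']
    rcases ht.1.eq_or_lt with h0 | h0
    · refine ⟨0, by simp, ?_⟩
      obtain rfl : u = 0 := le_antisymm (h0 ▸ hut) hu.1
      simp [hc]
    · refine ⟨u / t, ⟨div_nonneg hu.1 h0.le, (div_le_one h0).mpr hut⟩, ?_⟩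
      have : (t : ℂ) ≠ 0 := by exact_mod_cast h0.ne'
      simp only [hc, Complex.real_smul]
      push_cast
      field_simp
      ring
  have hcab : ∀ t ∈ Set.Icc (0 : ℝ) 1, c t ∈ segment ℝ a b := by
    intro t ht
    have := hcs 1 (by simp) t ht ht.2
    simpa [hc] using this
  have hsub : ∀ t ∈ Set.Icc (0 : ℝ) 1, segment ℝ a (c t) ⊆ segment ℝ a b := fun t ht =>
    (convex_segment a b).segment_subset (left_mem_segment ℝ a b) (hcab t ht)
  have hp := left_mem_segment ℝ p q
  have hq := right_mem_segment ℝ p q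
  have hslit : ∀ x ∈ segment ℝ p q, ∀ t ∈ Set.Icc (0 : ℝ) 1,
      (c t - x) / (a - x) ∈ Complex.slitPlane := by
    intro x hx t ht
    have h1 : x ∉ segment ℝ (c t) a := by
      rw [segment_symm]
      exact fun h2 => h (hsub t ht h2) hx
    rw [← neg_div_neg_eq, neg_sub, neg_sub]
    exact div_mem_slitPlane_of_notMem_segment h1
  have hslit2 : ∀ t ∈ Set.Icc (0 : ℝ) 1, (c t - p) / (c t - q) ∈ Complex.slitPlane := fun t ht =>
    div_mem_slitPlane_of_notMem_segment (h (hcab t ht))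
  have hne : ∀ x ∈ segment ℝ p q, ∀ z ∈ segment ℝ a b, z - x ≠ 0 := by
    intro x hx z hz h1
    rw [sub_eq_zero] at h1
    exact h hz (h1 ▸ hx)
  have ha := left_mem_segment ℝ a b
  set F : ℝ → ℝ := fun t => ang p a (c t) - ang q a (c t) -
    (Complex.arg ((c t - p) / (c t - q)) - Complex.arg ((a - p) / (a - q))) with hF
  have hcc : Continuous c := by simp only [hc]; fun_prop
  have hcont : ContinuousOn F (Set.Icc 0 1) := by
    intro t ht
    refine ContinuousAt.continuousWithinAt ?_
    have h1 : ∀ x ∈ segment ℝ p q, ContinuousAt (fun t => ang x a (c t)) t := fun x hx =>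
      ContinuousAt.comp (f := fun t => (c t - x) / (a - x))
        (Complex.continuousAt_arg (hslit x hx t ht)) (by fun_prop)
    have h2 : ContinuousAt (fun t => Complex.arg ((c t - p) / (c t - q))) t :=
      ContinuousAt.comp (f := fun t => (c t - p) / (c t - q))
        (Complex.continuousAt_arg (hslit2 t ht))
        ((hcc.continuousAt.sub continuousAt_const).div (hcc.continuousAt.sub continuousAt_const)
          (hne q hq _ (hcab t ht)))
    exact ((h1 p hp).sub (h1 q hq)).sub (h2.sub continuousAt_const)
  have hint : ∀ t ∈ Set.Icc (0 : ℝ) 1, ∃ k : ℤ, F t = 2 * Real.pi * k := by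
    intro t ht
    have hz := hcab t ht
    have := (Real.Angle.angle_eq_iff_two_pi_dvd_sub
      (θ := ang p a (c t) - ang q a (c t))
      (ψ := Complex.arg ((c t - p) / (c t - q)) - Complex.arg ((a - p) / (a - q)))).mp (by
        simp only [Real.Angle.coe_sub, ang]
        rw [Complex.arg_div_coe_angle (hne p hp _ hz) (hne p hp _ ha),
          Complex.arg_div_coe_angle (hne q hq _ hz) (hne q hq _ ha),
          Complex.arg_div_coe_angle (hne p hp _ hz) (hne q hq _ hz),
          Complex.arg_div_coe_angle (hne p hp _ ha) (hne q hq _ ha)]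
        abel)
    exact this
  have hF0 : F 0 = 0 := by
    have h1 := hne p hp a ha
    have h2 := hne q hq a ha
    simp [hF, hc, ang, div_self h1, div_self h2]
  have hpi := Real.pi_pos
  obtain ⟨k, hk⟩ := hint 1 (by simp)
  have key : ∀ y : ℝ, y ∈ Set.uIcc (F 0) (F 1) → ∃ k : ℤ, y = 2 * Real.pi * k := by
    intro y hy
    have h1 := intermediate_value_uIcc (a := (0 : ℝ)) (b := 1) (f := F)
      (by rwa [Set.uIcc_of_le zero_le_one])
    obtain ⟨t, ht, rfl⟩ := h1 hy
    rw [Set.uIcc_of_le zero_le_one] at ht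
    exact hint t ht
  have hF1 : F 1 = 0 := by
    rcases lt_trichotomy k 0 with hk0 | rfl | hk0
    · exfalso
      have h1 : (k : ℝ) ≤ -1 := by exact_mod_cast Int.le_sub_one_of_lt hk0
      obtain ⟨j, hj⟩ := key (-Real.pi) (by
        rw [hF0, Set.mem_uIcc]
        right
        constructor <;> nlinarith)
      have h2 : (j : ℝ) = -1 / 2 := by
        field_simp
        nlinarith
      have h3 : (2 * j : ℤ) = -1 := by
        exact_mod_cast (by linarith : (2 * j : ℝ) = -1)
      omega
    · simpa using hk
    · exfalso
      have h1 : (1 : ℝ) ≤ k := by exact_mod_cast hk0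
      obtain ⟨j, hj⟩ := key Real.pi (by
        rw [hF0, Set.mem_uIcc]
        left
        constructor <;> nlinarith)
      have h2 : (j : ℝ) = 1 / 2 := by
        field_simp
        nlinarith
      have h3 : (2 * j : ℤ) = 1 := by
        exact_mod_cast (by linarith : (2 * j : ℝ) = 1)
      omega
  have hc1 : c 1 = b := by simp [hc]
  simp only [hF, hc1] at hF1
  linarith

/-! ### Angles along grid squares -/

/-- The vertices of the square grid of mesh `η`. -/
noncomputable def gridPt (η : ℝ) (q : ℤ × ℤ) : ℂ := ⟨η * q.1, η * q.2⟩

/-- The centres of the squares of the grid of mesh `η`. -/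
noncomputable def gridCenter (η : ℝ) (q : ℤ × ℤ) : ℂ := ⟨η * (q.1 + 1 / 2), η * (q.2 + 1 / 2)⟩

theorem sum_ang_square {η : ℝ} (hη : 0 < η) (p q : ℤ × ℤ) :
    ang (gridCenter η p) (gridPt η q) (gridPt η (q + (1, 0))) +
      ang (gridCenter η p) (gridPt η (q + (1, 0))) (gridPt η (q + (1, 0) + (0, 1))) -
      ang (gridCenter η p) (gridPt η (q + (0, 1))) (gridPt η (q + (0, 1) + (1, 0))) -
      ang (gridCenter η p) (gridPt η q) (gridPt η (q + (0, 1))) =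
    if q = p then 2 * Real.pi else 0 := by
  split_ifs with h
  · subst h
    have key : ∀ a b : ℂ, a ≠ 0 → b = Complex.I * a → Complex.arg (b / a) = Real.pi / 2 := by
      rintro a b ha rfl
      rw [mul_div_assoc, div_self ha, mul_one, Complex.arg_I]
    have key' : ∀ a b : ℂ, a ≠ 0 → b = -Complex.I * a → Complex.arg (b / a) = -(Real.pi / 2) := by
      rintro a b ha rfl
      rw [mul_div_assoc, div_self ha, mul_one, Complex.arg_neg_I]
    have hne : ∀ a : ℂ, a.re ≠ 0 → a ≠ 0 := by
      rintro a ha rfl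
      exact ha rfl
    rw [ang, ang, ang, ang, key, key, key', key']
    · ring
    all_goals first
      | (apply Complex.ext <;> simp [gridCenter, gridPt] <;> ring)
      | (refine hne _ ?_
         simp [gridCenter, gridPt]
         intro h
         nlinarith)
  · have hx : gridCenter η p ∉ Metric.ball (gridCenter η q) η := by
      rw [Metric.mem_ball, not_lt, dist_eq_norm]
      by_cases h1 : q.1 = p.1
      · have h2 : q.2 ≠ p.2 := fun h2 => h (Prod.ext h1 h2)
        refine le_trans ?_ (Complex.abs_im_le_norm _)
        have h3 : (1 : ℝ) ≤ |(p.2 : ℝ) - q.2| := by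
          exact_mod_cast Int.one_le_abs (sub_ne_zero.mpr h2.symm)
        simp only [gridCenter, Complex.sub_im]
        rw [← mul_sub, abs_mul, abs_of_pos hη, add_sub_add_right_eq_sub]
        nlinarith
      · refine le_trans ?_ (Complex.abs_re_le_norm _)
        have h3 : (1 : ℝ) ≤ |(p.1 : ℝ) - q.1| := by
          exact_mod_cast Int.one_le_abs (sub_ne_zero.mpr (Ne.symm h1))
        simp only [gridCenter, Complex.sub_re]
        rw [← mul_sub, abs_mul, abs_of_pos hη, add_sub_add_right_eq_sub]
        nlinarith
    obtain ⟨A, hA⟩ := ang_potential hx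
    have hmem : ∀ z : ℂ, |z.re - η * (q.1 + 1 / 2)| ≤ η / 2 → |z.im - η * (q.2 + 1 / 2)| ≤ η / 2 →
        z ∈ Metric.ball (gridCenter η q) η := by
      intro z h1 h2
      rw [Metric.mem_ball, dist_eq_norm, Complex.norm_def, Real.sqrt_lt' hη, Complex.normSq_apply]
      simp only [gridCenter, Complex.sub_re, Complex.sub_im]
      rw [abs_le] at h1 h2
      nlinarith
    rw [hA, hA, hA, hA, add_right_comm q (1, 0) (0, 1)]
    · ring
    all_goals
      refine hmem _ ?_ ?_ <;> simp only [gridPt, Prod.fst_add, Prod.snd_add] <;> push_cast <;>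
        rw [abs_le] <;> constructor <;> nlinarith

/-! ### Sparse cycles in finite graphs -/

section Sparse

variable {V E : Type*} [Fintype E]

/-- Real edge weights with zero divergence at every vertex. -/
def IsCirculation (s t : E → V) (z : E → ℝ) : Prop :=
  ∀ g : V → ℝ, ∑ e, z e * (g (t e) - g (s e)) = 0

variable [Fintype V] [DecidableEq V] [DecidableEq E]

/-- The vertices touched by a set of edges. -/
def touched (s t : E → V) (S : Finset E) : Finset V := {v | ∃ e ∈ S, s e = v ∨ t e = v}

/-- The ends of a set of edges at a vertex. -/
def endsAt (s t : E → V) (S : Finset E) (v : V) : Finset (E × Bool) :=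
  {d | d.1 ∈ S ∧ (bif d.2 then t d.1 else s d.1) = v}

theorem exists_sparse_circulations {X ι : Type*} [Fintype X] (s t : E → V) (W : E → X → ℝ)
    (τ : ι → X → ℝ) (z : ι → E → ℝ) (hz : ∀ i, IsCirculation s t (z i))
    (hW : ∀ i x, ∑ e, z i e * W e x = τ i x) :
    ∃ (S : Finset E) (z' : ι → E → ℝ), (∀ i, ∀ e ∉ S, z' i e = 0) ∧
      (∀ i, IsCirculation s t (z' i)) ∧ (∀ i x, ∑ e, z' i e * W e x = τ i x) ∧
      S.card ≤ (touched s t S).card + Fintype.card X ∧ ∀ v, (endsAt s t S v).card ≠ 1 := by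
  obtain ⟨S, ⟨z', hsupp, hcyc, hval⟩, hmin⟩ := exists_minimal_of_wellFoundedLT
    (fun S : Finset E => ∃ z' : ι → E → ℝ, (∀ i, ∀ e ∉ S, z' i e = 0) ∧
      (∀ i, IsCirculation s t (z' i)) ∧ ∀ i x, ∑ e, z' i e * W e x = τ i x)
    ⟨Finset.univ, z, fun i e he => absurd (Finset.mem_univ e) he, hz, hW⟩
  have hmin' : ∀ e ∈ S, ∀ y : ι → E → ℝ, (∀ i, ∀ e ∉ S, y i e = 0) → (∀ i, y i e = 0) →
      (∀ i, IsCirculation s t (y i)) → (∀ i x, ∑ e, y i e * W e x = τ i x) → False := by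
    intro e he y h1 h2 h3 h4
    have := hmin (y := S.erase e) ⟨y, fun i f hf => ?_, h3, h4⟩ (Finset.erase_subset _ _)
    · exact Finset.notMem_erase e S (this he)
    · rw [Finset.mem_erase, not_and_or, not_not] at hf
      rcases hf with rfl | hf
      · exact h2 i
      · exact h1 i f hf
  refine ⟨S, z', hsupp, hcyc, hval, ?_, fun v hv => ?_⟩
  · let Φ : (S → ℝ) →ₗ[ℝ] (touched s t S → ℝ) × (X → ℝ) :=
      { toFun := fun φ => (fun v => ∑ e : S, φ e *
          ((if t e = v then 1 else 0) - if s e = v then 1 else 0), fun x => ∑ e : S, φ e * W e x)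
        map_add' := fun φ ψ => by
          ext <;> simp [add_mul, Finset.sum_add_distrib]
        map_smul' := fun c φ => by
          ext <;> simp [mul_assoc, Finset.mul_sum] }
    have hΦ : Function.Injective Φ := by
      rw [injective_iff_map_eq_zero]
      intro φ hφ
      have hφ1 : ∀ v : touched s t S, ∑ e : S, φ e *
          ((if t e = v then (1 : ℝ) else 0) - if s e = v then 1 else 0) = 0 :=
        fun v => congrFun (congrArg Prod.fst hφ) v
      have hφ2 : ∀ x, ∑ e : S, φ e * W e x = 0 := fun x => congrFun (congrArg Prod.snd hφ) x
      set y : E → ℝ := fun e => if h : e ∈ S then φ ⟨e, h⟩ else 0 with hy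
      have hsum : ∀ G : E → ℝ, ∑ e, y e * G e = ∑ e : S, φ e * G e := by
        intro G
        rw [← Finset.sum_subset (Finset.subset_univ S) fun e _ he => by simp [hy, he],
          ← Finset.sum_coe_sort]
        exact Finset.sum_congr rfl fun e _ => by simp [hy]
      by_contra hne
      obtain ⟨⟨e, he⟩, hne⟩ := Function.ne_iff.mp hne
      have hye : y e ≠ 0 := by simpa [hy, he] using hne
      have hycyc : IsCirculation s t y := by
        intro g
        have h1 : ∀ v, ∑ e, y e * ((if t e = v then (1 : ℝ) else 0) - if s e = v then 1 else 0) =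
            0 := by
          intro v
          by_cases hv : v ∈ touched s t S
          · rw [hsum]
            exact hφ1 ⟨v, hv⟩
          · refine Finset.sum_eq_zero fun e _ => ?_
            by_cases heS : e ∈ S
            · have h2 : t e ≠ v := fun h => hv (by simp only [touched, Finset.mem_filter_univ]; exact ⟨e, heS, .inr h⟩)
              have h3 : s e ≠ v := fun h => hv (by simp only [touched, Finset.mem_filter_univ]; exact ⟨e, heS, .inl h⟩)
              simp [h2, h3]
            · simp [hy, heS]
        have h2 : ∀ e, y e * (g (t e) - g (s e)) = ∑ v, g v *
            (y e * ((if t e = v then (1 : ℝ) else 0) - if s e = v then 1 else 0)) := by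
          intro e
          simp [mul_sub, Finset.sum_sub_distrib]
          ring
        simp_rw [h2]
        rw [Finset.sum_comm]
        refine Finset.sum_eq_zero fun v _ => ?_
        rw [← Finset.mul_sum, h1, mul_zero]
      refine hmin' e he (fun i f => z' i f - z' i e / y e * y f) (fun i f hf => ?_) (fun i => ?_)
        (fun i g => ?_) fun i x => ?_
      · simp [hsupp i f hf, hy, hf]
      · field_simp
        ring
      · have h1 := hcyc i g
        have h2 := hycyc g
        simp only [sub_mul, Finset.sum_sub_distrib, mul_assoc, ← Finset.mul_sum, h1, h2]
        ring
      · have h2 : ∑ e, y e * W e x = 0 := (hsum _).trans (hφ2 x)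
        simp only [sub_mul, Finset.sum_sub_distrib, mul_assoc, ← Finset.mul_sum, hval i x, h2]
        ring
    have := LinearMap.finrank_le_finrank_of_injective hΦ
    simpa using this
  · obtain ⟨⟨e, b⟩, he⟩ := Finset.card_eq_one.mp hv
    have hmem : ∀ d : E × Bool, d.1 ∈ S → (bif d.2 then t d.1 else s d.1) = v → d = (e, b) := by
      intro d h1 h2
      rw [← Finset.mem_singleton, ← he]
      simp only [endsAt, Finset.mem_filter_univ]
      exact ⟨h1, h2⟩
    have hself : (e, b) ∈ endsAt s t S v := he ▸ Finset.mem_singleton_self _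
    simp only [endsAt, Finset.mem_filter_univ] at hself
    refine hmin' e hself.1 z' hsupp (fun i => ?_) hcyc hval
    have h1 := hcyc i fun u => if u = v then 1 else 0
    have h2 : ∀ f, f ≠ e → z' i f * ((if t f = v then 1 else 0) - if s f = v then 1 else 0) = 0 := by
      intro f hf
      by_cases hfS : f ∈ S
      · have h3 : t f ≠ v := fun h => hf (congrArg Prod.fst (hmem (f, true) hfS h))
        have h4 : s f ≠ v := fun h => hf (congrArg Prod.fst (hmem (f, false) hfS h))
        simp [h3, h4]
      · simp [hsupp i f hfS]
    rw [Finset.sum_eq_single e (fun f _ hf => h2 f hf) (by simp)] at h1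
    rcases mul_eq_zero.mp h1 with h1 | h1
    · exact h1
    · exfalso
      cases b with
      | true =>
        have h3 : t e = v := hself.2
        have h4 : s e ≠ v := fun h => by simpa using hmem (e, false) hself.1 h
        simp [h3, h4] at h1
      | false =>
        have h3 : s e = v := hself.2
        have h4 : t e ≠ v := fun h => by simpa using hmem (e, true) hself.1 h
        simp [h3, h4] at h1

end Sparse

/-! ### Grid sums and covers -/

theorem Finset.sum_eq_sum_add_right {A : Type*} [AddCommGroup A] [DecidableEq A] (Q : Finset A)
    (e : A) (G : A → ℝ) (hG : ∀ q, G q ≠ 0 → (q ∈ Q ↔ q - e ∈ Q)) :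
    ∑ q ∈ Q, G q = ∑ q ∈ Q, G (q + e) := by
  refine Finset.sum_bij_ne_zero (fun q _ _ => q - e) (fun q h1 h2 => (hG q h2).mp h1)
    (fun q _ _ q' _ _ h => sub_left_injective h) (fun q h1 h2 => ⟨q + e, ?_, h2, ?_⟩)
    fun q _ _ => ?_
  · rw [hG _ h2, add_sub_cancel_right]
    exact h1
  · rw [add_sub_cancel_right]
  · rw [sub_add_cancel]

theorem grid_stokes (Q : Finset (ℤ × ℤ)) (Gh Gv : ℤ × ℤ → ℝ)
    (hh : ∀ q, Gh q ≠ 0 → (q ∈ Q ↔ q - (0, 1) ∈ Q))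
    (hv : ∀ q, Gv q ≠ 0 → (q ∈ Q ↔ q - (1, 0) ∈ Q)) :
    ∑ q ∈ Q, (Gh q + Gv (q + (1, 0)) - Gh (q + (0, 1)) - Gv q) = 0 := by
  simp only [Finset.sum_sub_distrib, Finset.sum_add_distrib]
  rw [← Q.sum_eq_sum_add_right _ Gh hh, ← Q.sum_eq_sum_add_right _ Gv hv]
  ring

theorem exists_open_cover_sum_le {G : Set ℂ} (hG : IsCompact G) {Λ : ℝ}
    (hΛ : MeasureTheory.Measure.hausdorffMeasure 1 G < ENNReal.ofReal Λ) {δ : ℝ} (hδ : 0 < δ) :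
    ∃ (V : Finset ℕ) (C : ℕ → Set ℂ) (d : ℕ → ℝ), (∀ k, IsOpen (C k)) ∧ (G ⊆ ⋃ k ∈ V, C k) ∧
      (∀ k ∈ V, (C k ∩ G).Nonempty) ∧ (∀ k ∈ V, d k ≤ δ) ∧
      (∀ k ∈ V, ∀ p ∈ C k, ∀ q ∈ C k, dist p q ≤ d k) ∧ ∑ k ∈ V, d k ≤ Λ := by
  classical
  rw [MeasureTheory.Measure.hausdorffMeasure_apply] at hΛ
  have hδ2 : (0 : ENNReal) < ENNReal.ofReal (δ / 2) := ENNReal.ofReal_pos.mpr (by positivity)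
  have h1 := (le_iSup₂ (f := fun (r : ENNReal) (_ : 0 < r) => ⨅ (t : ℕ → Set ℂ)
    (_ : G ⊆ ⋃ n, t n) (_ : ∀ n, Metric.ediam (t n) ≤ r),
      ∑' n, ⨆ _ : (t n).Nonempty, Metric.ediam (t n) ^ (1 : ℝ)) _ hδ2).trans_lt hΛ
  simp only [iInf_lt_iff] at h1
  obtain ⟨t, htG, htd, hsum⟩ := h1
  have hterm : ∀ n, (⨆ _ : (t n).Nonempty, Metric.ediam (t n) ^ (1 : ℝ)) = Metric.ediam (t n) := by
    intro n
    rw [ENNReal.rpow_one]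
    rcases (t n).eq_empty_or_nonempty with h | h
    · simp [h]
    · simp [h]
  simp only [hterm] at hsum
  have htop : ∑' n, Metric.ediam (t n) ≠ ⊤ := (hsum.trans ENNReal.ofReal_lt_top).ne
  have hfin : ∀ n, Metric.ediam (t n) ≠ ⊤ := ENNReal.ne_top_of_tsum_ne_top htop
  set σ := Λ - (∑' n, Metric.ediam (t n)).toReal with hσ
  have hσ0 : 0 < σ := by
    rw [hσ, sub_pos]
    exact (ENNReal.lt_ofReal_iff_toReal_lt htop).mp hsum
  set ε : ℕ → ℝ := fun n => min (δ / 4) (σ / 4 * (1 / 2) ^ n) with hε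
  have hε0 : ∀ n, 0 < ε n := fun n => lt_min (by positivity) (by positivity)
  obtain ⟨F, hF⟩ := hG.elim_finite_subcover (fun n => Metric.thickening (ε n) (t n))
    (fun n => Metric.isOpen_thickening) (htG.trans (Set.iUnion_mono fun n =>
      Metric.self_subset_thickening (hε0 n) _))
  set V := F.filter fun n => (Metric.thickening (ε n) (t n) ∩ G).Nonempty with hV
  refine ⟨V, fun n => Metric.thickening (ε n) (t n), fun n => (Metric.ediam (t n)).toReal + 2 * ε n,
    fun n => Metric.isOpen_thickening, ?_, ?_, ?_, ?_, ?_⟩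
  · intro z hz
    obtain ⟨n, hn, hzn⟩ := Set.mem_iUnion₂.mp (hF hz)
    exact Set.mem_iUnion₂.mpr ⟨n, Finset.mem_filter.mpr ⟨hn, z, hzn, hz⟩, hzn⟩
  · intro k hk
    exact (Finset.mem_filter.mp hk).2
  · intro k _
    have h2 := ENNReal.toReal_mono ENNReal.ofReal_ne_top (htd k)
    rw [ENNReal.toReal_ofReal (by positivity)] at h2
    have h3 : ε k ≤ δ / 4 := min_le_left _ _
    linarith
  · intro k _ p hp q hq
    obtain ⟨p', hp', hpp⟩ := Metric.mem_thickening_iff.mp hp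
    obtain ⟨q', hq', hqq⟩ := Metric.mem_thickening_iff.mp hq
    have h2 : dist p' q' ≤ (Metric.ediam (t k)).toReal := by
      rw [dist_edist]
      exact ENNReal.toReal_mono (hfin k) (Metric.edist_le_ediam_of_mem hp' hq')
    have h3 := dist_triangle4 p p' q' q
    rw [dist_comm q' q] at h3
    linarith
  · rw [Finset.sum_add_distrib]
    have h2 : ∑ k ∈ V, (Metric.ediam (t k)).toReal ≤ (∑' n, Metric.ediam (t n)).toReal := by
      rw [← ENNReal.toReal_sum fun n _ => hfin n]
      exact ENNReal.toReal_mono htop (ENNReal.sum_le_tsum _)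
    have h3 : ∑ k ∈ V, 2 * ε k ≤ σ := by
      obtain ⟨N, hN⟩ := V.exists_nat_subset_range
      calc ∑ k ∈ V, 2 * ε k ≤ ∑ k ∈ Finset.range N, 2 * ε k :=
            Finset.sum_le_sum_of_subset_of_nonneg hN fun n _ _ => by linarith [hε0 n]
        _ ≤ ∑ k ∈ Finset.range N, σ / 2 * (1 / 2) ^ k := by
            refine Finset.sum_le_sum fun n _ => ?_
            have : ε n ≤ σ / 4 * (1 / 2) ^ n := min_le_right _ _
            linarith
        _ = σ / 2 * ∑ k ∈ Finset.range N, (1 / 2) ^ k := by rw [Finset.mul_sum]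
        _ ≤ σ / 2 * 2 := by
            gcongr
            exact sum_geometric_two_le N
        _ = σ := by ring
    linarith

/-! ### Circulations in the nerve of a cover -/

theorem gridPt_add_one_zero (η : ℝ) (q : ℤ × ℤ) : gridPt η (q + (1, 0)) = gridPt η q + η := by
  apply Complex.ext <;> simp [gridPt, mul_add]

theorem gridPt_add_zero_one (η : ℝ) (q : ℤ × ℤ) :
    gridPt η (q + (0, 1)) = gridPt η q + η * Complex.I := by
  apply Complex.ext <;> simp [gridPt, mul_add]

theorem dist_gridPt_add {η : ℝ} (hη : 0 < η) {e : ℤ × ℤ} (he : e = (1, 0) ∨ e = (0, 1))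
    (q : ℤ × ℤ) : dist (gridPt η (q + e)) (gridPt η q) = η := by
  rcases he with rfl | rfl
  · rw [gridPt_add_one_zero, dist_eq_norm]
    simp [abs_of_pos hη]
  · rw [gridPt_add_zero_one, dist_eq_norm]
    simp [abs_of_pos hη]

theorem finite_gridPt_preimage {η : ℝ} (hη : 0 < η) {R : Set ℂ} (hR : Bornology.IsBounded R) :
    (gridPt η ⁻¹' R).Finite := by
  obtain ⟨B, hB⟩ := hR.exists_norm_le
  refine (Set.toFinite (Set.Icc (-⌈B / η⌉) ⌈B / η⌉ ×ˢ Set.Icc (-⌈B / η⌉) ⌈B / η⌉)).subset ?_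
  intro q hq
  have h := hB _ hq
  have key : ∀ a : ℤ, |η * a| ≤ B → a ∈ Set.Icc (-⌈B / η⌉) ⌈B / η⌉ := by
    intro a ha
    rw [abs_mul, abs_of_pos hη, ← le_div_iff₀' hη] at ha
    have h1 := abs_le.mp (ha.trans (Int.le_ceil (B / η)))
    exact ⟨by exact_mod_cast h1.1, by exact_mod_cast h1.2⟩
  exact ⟨key _ ((Complex.abs_re_le_norm (gridPt η q)).trans h),
    key _ ((Complex.abs_im_le_norm (gridPt η q)).trans h)⟩

theorem IsPreconnected.inter_frontier_nonempty_of_mem {X : Type*} [TopologicalSpace X] {t u : Set X}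
    (ht : IsPreconnected t) {x y : X} (hx : x ∈ t) (hy : y ∈ t) (hxu : x ∈ u) (hyu : y ∉ u) :
    (t ∩ frontier u).Nonempty := by
  by_contra hne
  have hno : ∀ z ∈ t, z ∉ frontier u := fun z hz hzf => hne ⟨z, hz, hzf⟩
  have hcover : t ⊆ interior u ∪ (closure u)ᶜ := by
    intro z hz
    by_cases h : z ∈ interior u
    · exact Or.inl h
    · exact Or.inr fun hc => hno z hz ⟨hc, h⟩
  obtain ⟨z, -, hz1, hz2⟩ := ht _ _ isOpen_interior isClosed_closure.isOpen_compl hcover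
    ⟨x, hx, (hcover hx).resolve_right fun h => h (subset_closure hxu)⟩
    ⟨y, hy, (hcover hy).resolve_left fun h => hyu (interior_subset h)⟩
  exact hz2 (interior_subset.trans subset_closure hz1)

theorem mem_iff_of_gridPt {η : ℝ} (hη : 0 < η) {R : Set ℂ} {N : ℤ × ℤ → Prop}
    (hN : ∀ g ∈ frontier R, ∀ q, dist (gridPt η q) g ≤ 3 * η → N q) {e e' : ℤ × ℤ}
    (he : e = (1, 0) ∨ e = (0, 1)) (he' : e' = (1, 0) ∨ e' = (0, 1)) {q : ℤ × ℤ}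
    (h : ¬ (N q ∧ N (q + e))) : gridPt η q ∈ R ↔ gridPt η (q - e') ∈ R := by
  by_contra hne
  have hd : dist (gridPt η q) (gridPt η (q - e')) = η := by
    have := dist_gridPt_add hη he' (q - e')
    rwa [sub_add_cancel] at this
  have hmeet : (segment ℝ (gridPt η q) (gridPt η (q - e')) ∩ frontier R).Nonempty := by
    have hpre : IsPreconnected (segment ℝ (gridPt η q) (gridPt η (q - e'))) :=
      (convex_segment _ _).isPreconnected
    have hl := left_mem_segment ℝ (gridPt η q) (gridPt η (q - e'))
    have hr := right_mem_segment ℝ (gridPt η q) (gridPt η (q - e'))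
    by_cases h1 : gridPt η q ∈ R
    · exact hpre.inter_frontier_nonempty_of_mem hl hr h1 fun h2 => hne (iff_of_true h1 h2)
    · exact hpre.inter_frontier_nonempty_of_mem hr hl
        (by_contra fun h2 => hne (iff_of_false h1 h2)) h1
  obtain ⟨g, hgs, hg⟩ := hmeet
  have hgq : dist g (gridPt η q) ≤ η := by
    have h1 := (convex_closedBall (gridPt η q) η).segment_subset
      (Metric.mem_closedBall_self hη.le) (y := gridPt η (q - e')) (by
        rw [Metric.mem_closedBall, dist_comm, hd])
    exact h1 hgs
  refine h ⟨hN g hg q (by rw [dist_comm]; linarith), hN g hg _ ?_⟩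
  have h1 := dist_triangle (gridPt η (q + e)) (gridPt η q) g
  rw [dist_gridPt_add hη he, dist_comm (gridPt η q) g] at h1
  linarith

theorem exists_nerve_circulation {V E : Type*} [Fintype E] [DecidableEq E] (s t : E → V)
    (C : V → Set ℂ) (hE : ∀ k l, (C k ∩ C l).Nonempty → ∃ e, s e = k ∧ t e = l) {c : V → ℂ}
    (hc : ∀ k, c k ∈ C k) {δ : ℝ} (hδ : 0 < δ) (hdiam : ∀ k, ∀ p ∈ C k, ∀ q ∈ C k, dist p q ≤ δ)
    {R : Set ℂ} (hR : Bornology.IsBounded R) {η : ℝ} (hη : 0 < η)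
    (hcov : ∀ g ∈ frontier R, ∃ k, Metric.ball g (5 * η) ⊆ C k) :
    ∃ z : E → ℝ, IsCirculation s t z ∧ ∀ p : ℤ × ℤ,
      (∀ k, ∀ y ∈ C k, gridCenter η p ∉ Metric.ball y (2 * δ)) →
      ∑ e, z e * ang (gridCenter η p) (c (s e)) (c (t e)) =
        Set.indicator R (fun _ => 2 * Real.pi) (gridPt η p) := by
  classical
  set N : ℤ × ℤ → Prop := fun q => ∃ k, Metric.ball (gridPt η q) (2 * η) ⊆ C k with hNdef
  have hN : ∀ g ∈ frontier R, ∀ q, dist (gridPt η q) g ≤ 3 * η → N q := by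
    intro g hg q hq
    obtain ⟨k, hk⟩ := hcov g hg
    exact ⟨k, (Metric.ball_subset_ball' (by linarith)).trans hk⟩
  choose κ hκ using fun q (h : N q) => h
  have hκs : ∀ q h, gridPt η q ∈ C (κ q h) := fun q h =>
    hκ q h (Metric.mem_ball_self (by linarith))
  have hyex : ∀ q e, ∃ y : E → ℝ, (e = (1, 0) ∨ e = (0, 1)) → ∀ hq : N q, ∀ hq' : N (q + e),
      ∃ f, s f = κ q hq ∧ t f = κ (q + e) hq' ∧ y = Pi.single f 1 := by
    intro q e
    by_cases h : (e = (1, 0) ∨ e = (0, 1)) ∧ N q ∧ N (q + e)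
    · obtain ⟨he, hq, hq'⟩ := h
      obtain ⟨f, hf1, hf2⟩ := hE (κ q hq) (κ (q + e) hq') ⟨gridPt η (q + e), hκ q hq (by
        rw [Metric.mem_ball, dist_gridPt_add hη he]
        linarith), hκs _ hq'⟩
      exact ⟨_, fun _ _ _ => ⟨f, hf1, hf2, rfl⟩⟩
    · exact ⟨0, fun h1 h2 h3 => absurd ⟨h1, h2, h3⟩ h⟩
  choose y hy using hyex
  set Q := (finite_gridPt_preimage hη hR).toFinset with hQ
  have hQmem : ∀ q, q ∈ Q ↔ gridPt η q ∈ R := fun q => by simp [hQ]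
  set z : E → ℝ := fun e => ∑ q ∈ Q, (y q (1, 0) e + y (q + (1, 0)) (0, 1) e -
    y (q + (0, 1)) (1, 0) e - y q (0, 1) e) with hz
  have key : ∀ (w : E → ℝ) (F : ℤ × ℤ → ℤ × ℤ → ℝ),
      (∀ q e, (e = (1, 0) ∨ e = (0, 1)) → ∀ hq : N q, ∀ hq' : N (q + e), ∀ f, s f = κ q hq →
        t f = κ (q + e) hq' → w f = F q (q + e)) →
      ∑ e, z e * w e = ∑ q ∈ Q, (F q (q + (1, 0)) + F (q + (1, 0)) (q + (1, 0) + (0, 1)) -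
        F (q + (0, 1)) (q + (0, 1) + (1, 0)) - F q (q + (0, 1))) := by
    intro w F hF
    have hzero : ∀ q e, (e = (1, 0) ∨ e = (0, 1)) → N q ∧ N (q + e) →
        (∑ f, y q e f * w f) - F q (q + e) = 0 := by
      rintro q e he ⟨hq, hq'⟩
      obtain ⟨f, hf1, hf2, hf3⟩ := hy q e he hq hq'
      rw [hf3, ← hF q e he hq hq' f hf1 hf2]
      simp [Pi.single_apply]
    have h1 := grid_stokes Q (fun q => (∑ f, y q (1, 0) f * w f) - F q (q + (1, 0)))
      (fun q => (∑ f, y q (0, 1) f * w f) - F q (q + (0, 1)))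
      (fun q hq => by
        rw [hQmem, hQmem]
        exact mem_iff_of_gridPt hη hN (.inl rfl) (.inr rfl) fun h => hq (hzero q _ (.inl rfl) h))
      (fun q hq => by
        rw [hQmem, hQmem]
        exact mem_iff_of_gridPt hη hN (.inr rfl) (.inl rfl) fun h => hq (hzero q _ (.inr rfl) h))
    have h2 : ∑ e, z e * w e = ∑ q ∈ Q, ((∑ f, y q (1, 0) f * w f) +
        (∑ f, y (q + (1, 0)) (0, 1) f * w f) - (∑ f, y (q + (0, 1)) (1, 0) f * w f) -
        ∑ f, y q (0, 1) f * w f) := by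
      simp only [hz, Finset.sum_mul]
      rw [Finset.sum_comm]
      refine Finset.sum_congr rfl fun q _ => ?_
      rw [← Finset.sum_add_distrib, ← Finset.sum_sub_distrib, ← Finset.sum_sub_distrib]
      exact Finset.sum_congr rfl fun f _ => by ring
    rw [h2, ← sub_eq_zero, ← Finset.sum_sub_distrib, ← h1]
    exact Finset.sum_congr rfl fun q _ => by ring
  refine ⟨z, fun g => ?_, fun p hp => ?_⟩
  · set β : ℤ × ℤ → ℝ := fun q => if h : N q then g (κ q h) else 0 with hβ
    rw [key _ (fun q q' => β q' - β q) fun q e _ hq hq' f hf1 hf2 => by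
      rw [hf1, hf2, hβ]
      simp only [hq, hq', dite_true]]
    refine Finset.sum_eq_zero fun q _ => ?_
    rw [add_right_comm q (0, 1)]
    ring
  · set x := gridCenter η p
    set β : ℤ × ℤ → ℝ := fun q => if h : N q then ang x (gridPt η q) (c (κ q h)) else 0 with hβ
    rw [key _ (fun q q' => ang x (gridPt η q) (gridPt η q') + (β q' - β q)) fun q e he hq hq' f
      hf1 hf2 => ?_]
    · have h1 : ∀ q ∈ Q, (ang x (gridPt η q) (gridPt η (q + (1, 0))) +
          (β (q + (1, 0)) - β q)) + (ang x (gridPt η (q + (1, 0))) (gridPt η (q + (1, 0) + (0, 1))) +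
          (β (q + (1, 0) + (0, 1)) - β (q + (1, 0)))) -
          (ang x (gridPt η (q + (0, 1))) (gridPt η (q + (0, 1) + (1, 0))) +
          (β (q + (0, 1) + (1, 0)) - β (q + (0, 1)))) -
          (ang x (gridPt η q) (gridPt η (q + (0, 1))) + (β (q + (0, 1)) - β q)) =
          if q = p then 2 * Real.pi else 0 := by
        intro q _
        rw [← sum_ang_square hη p q, add_right_comm q (0, 1) (1, 0)]
        ring
      rw [Finset.sum_congr rfl h1, Finset.sum_ite_eq', Set.indicator_apply]
      simp only [hQmem]
    · have hmem : ∀ k, gridPt η (q + e) ∈ C k → ∀ a ∈ C k,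
          a ∈ Metric.ball (gridPt η (q + e)) (2 * δ) := fun k hk a ha =>
        Metric.mem_ball.mpr ((hdiam k a ha _ hk).trans_lt (by linarith))
      have hk1 : gridPt η (q + e) ∈ C (κ q hq) := hκ q hq (by
        rw [Metric.mem_ball, dist_gridPt_add hη he]
        linarith)
      obtain ⟨A, hA⟩ := ang_potential (hp _ _ hk1)
      have m1 := hmem _ hk1 _ (hc _)
      have m2 := hmem _ hk1 _ (hκs q hq)
      have m3 := hmem _ (hκs _ hq') _ (hc _)
      have m4 := hmem _ (hκs _ hq') _ (hκs _ hq')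
      simp only [hf1, hf2, hβ, hq, hq', dite_true]
      rw [hA _ m1 _ m3, hA _ m2 _ m4, hA _ m4 _ m3, hA _ m2 _ m1]
      ring

/-! ### Replacing a planar set of finite length by a segment network -/

theorem exists_hubs {V E : Type*} [Fintype V] [Fintype E] [DecidableEq V] [DecidableEq E]
    (s t : E → V) (C : V → Set ℂ)
    {c : V → ℂ} (hc : ∀ k, c k ∈ C k) {q : E → ℂ} (hqs : ∀ e, q e ∈ C (s e))
    (hqt : ∀ e, q e ∈ C (t e)) {d : V → ℝ} {δ : ℝ} (hδ : 0 ≤ δ)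
    (hdδ : ∀ k, d k ≤ δ)
    (hd : ∀ k, ∀ p ∈ C k, ∀ q ∈ C k, dist p q ≤ d k) {S : Finset E} {n : ℕ}
    (hcard : S.card ≤ (touched s t S).card + n) (hdeg : ∀ v, (endsAt s t S v).card ≠ 1) :
    ∃ h : V → ℂ, (∀ k, h k ∈ C k) ∧
      ∑ e ∈ S, (dist (q e) (h (s e)) + dist (q e) (h (t e))) ≤
        ∑ v ∈ touched s t S, d v + 2 * n * δ := by
  classical
  let en : E × Bool → V := fun x => bif x.2 then t x.1 else s x.1
  have hqen : ∀ x : E × Bool, q x.1 ∈ C (en x) := by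
    rintro ⟨e, _ | _⟩
    · exact hqs e
    · exact hqt e
  have hmem : ∀ v x, x ∈ endsAt s t S v ↔ x.1 ∈ S ∧ en x = v := by
    intro v x
    simp [endsAt, en]
  have hex : ∀ v, ∃ y : ℂ, y ∈ C v ∧
      ∑ x ∈ endsAt s t S v, dist (q x.1) y ≤ (((endsAt s t S v).card : ℝ) - 1) * d v ∨
      y ∈ C v ∧ endsAt s t S v = ∅ := by
    intro v
    rcases (endsAt s t S v).eq_empty_or_nonempty with h0 | ⟨x, hx⟩
    · exact ⟨c v, Or.inr ⟨hc v, h0⟩⟩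
    · have hv : ∀ x ∈ endsAt s t S v, q x.1 ∈ C v := fun x hx => ((hmem v x).mp hx).2 ▸ hqen x
      refine ⟨q x.1, Or.inl ⟨hv x hx, ?_⟩⟩
      rw [← Finset.sum_erase_add _ _ hx, dist_self, add_zero]
      refine (Finset.sum_le_card_nsmul _ _ (d v) fun y hy =>
        hd v _ (hv y (Finset.mem_of_mem_erase hy)) _ (hv x hx)).trans (le_of_eq ?_)
      rw [nsmul_eq_mul, Finset.card_erase_of_mem hx,
        Nat.cast_sub (Finset.card_pos.mpr ⟨x, hx⟩), Nat.cast_one]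
  choose h hh using hex
  refine ⟨h, fun k => (hh k).elim (·.1) (·.1), ?_⟩
  have hT : ∀ x ∈ S ×ˢ (Finset.univ : Finset Bool), en x ∈ touched s t S := by
    rintro ⟨e, b⟩ hx
    have he := (Finset.mem_product.mp hx).1
    rw [touched, Finset.mem_filter_univ]
    exact ⟨e, he, by cases b <;> simp [en]⟩
  have hfib : ∀ v, (S ×ˢ (Finset.univ : Finset Bool)).filter (fun x => en x = v) =
      endsAt s t S v := by
    intro v
    ext x
    simp [hmem]
  have hsum : ∑ e ∈ S, (dist (q e) (h (s e)) + dist (q e) (h (t e))) =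
      ∑ v ∈ touched s t S, ∑ x ∈ endsAt s t S v, dist (q x.1) (h v) := by
    calc _ = ∑ x ∈ S ×ˢ (Finset.univ : Finset Bool), dist (q x.1) (h (en x)) := by
          rw [Finset.sum_product]
          refine Finset.sum_congr rfl fun e _ => ?_
          simp [en, add_comm]
      _ = _ := by
          rw [← Finset.sum_fiberwise_of_maps_to hT]
          refine Finset.sum_congr rfl fun v _ => ?_
          rw [hfib]
          exact Finset.sum_congr rfl fun x hx => by rw [((hmem v x).mp hx).2]
  have hcardsum : ∑ v ∈ touched s t S, ((endsAt s t S v).card : ℝ) = 2 * S.card := by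
    have h1 := Finset.card_eq_sum_card_fiberwise hT
    simp only [hfib] at h1
    rw [Finset.card_product] at h1
    have h2 : (2 * S.card : ℝ) = ((S.card * (Finset.univ : Finset Bool).card : ℕ) : ℝ) := by
      simp [mul_comm]
    rw [h2, h1]
    push_cast
    rfl
  have hdeg2 : ∀ v ∈ touched s t S, 2 ≤ (endsAt s t S v).card := by
    intro v hv
    have : (endsAt s t S v).Nonempty := by
      simp only [touched] at hv
      obtain ⟨e, he, h1 | h1⟩ : ∃ e ∈ S, s e = v ∨ t e = v := by simpa using hv
      · exact ⟨(e, false), (hmem v _).mpr ⟨he, h1⟩⟩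
      · exact ⟨(e, true), (hmem v _).mpr ⟨he, h1⟩⟩
    have := this.card_pos
    have := hdeg v
    omega
  rw [hsum]
  calc _ ≤ ∑ v ∈ touched s t S, (d v + (((endsAt s t S v).card : ℝ) - 2) * δ) := by
        refine Finset.sum_le_sum fun v hv => ?_
        have h2 : (2 : ℝ) ≤ (endsAt s t S v).card := by exact_mod_cast hdeg2 v hv
        rcases hh v with h1 | h1
        · nlinarith [h1.2, mul_le_mul_of_nonneg_left (hdδ v) (sub_nonneg.mpr h2)]
        · rw [h1.2] at h2
          norm_num at h2
    _ = ∑ v ∈ touched s t S, d v + (2 * S.card - 2 * (touched s t S).card) * δ := by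
        rw [Finset.sum_add_distrib, ← Finset.sum_mul, Finset.sum_sub_distrib, hcardsum]
        simp [mul_comm]
    _ ≤ _ := by
        have h1 : (S.card : ℝ) ≤ (touched s t S).card + n := by exact_mod_cast hcard
        nlinarith

/-- The total angle, seen from `p`, of a chain of broken lines `h (s e) → q e → h (t e)`. -/
noncomputable def chainAng {V E : Type*} [Fintype E] (s t : E → V) (h : V → ℂ) (q : E → ℂ)
    (z : E → ℝ) (p : ℂ) : ℝ :=
  ∑ e, z e * (ang p (h (s e)) (q e) + ang p (q e) (h (t e)))

section chainAng

variable {V E : Type*} [Fintype E] {s t : E → V} {h : V → ℂ} {q : E → ℂ} {z : E → ℝ}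

theorem chainAng_eq_of_disjoint (hz : IsCirculation s t z) {p p' : ℂ}
    (h₁ : ∀ e, z e ≠ 0 → Disjoint (segment ℝ (h (s e)) (q e)) (segment ℝ p p'))
    (h₂ : ∀ e, z e ≠ 0 → Disjoint (segment ℝ (q e) (h (t e))) (segment ℝ p p')) :
    chainAng s t h q z p = chainAng s t h q z p' := by
  rw [← sub_eq_zero, chainAng, chainAng, ← Finset.sum_sub_distrib,
    ← hz fun v => Complex.arg ((h v - p) / (h v - p'))]
  refine Finset.sum_congr rfl fun e _ => ?_
  by_cases he : z e = 0
  · simp [he]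
  · have e1 := ang_sub_ang (h₁ e he)
    have e2 := ang_sub_ang (h₂ e he)
    rw [← mul_sub]
    congr 1
    linarith

theorem chainAng_eq_of_notMem_ball (hz : IsCirculation s t z) {C : V → Set ℂ} {c : V → ℂ}
    (hc : ∀ k, c k ∈ C k) (hh : ∀ k, h k ∈ C k) (hqs : ∀ e, q e ∈ C (s e))
    (hqt : ∀ e, q e ∈ C (t e)) {δ : ℝ} (hδ : 0 < δ)
    (hdiam : ∀ k, ∀ p ∈ C k, ∀ q ∈ C k, dist p q ≤ δ) {x : ℂ}
    (hx : ∀ k, ∀ y ∈ C k, x ∉ Metric.ball y (2 * δ)) :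
    chainAng s t h q z x = ∑ e, z e * ang x (c (s e)) (c (t e)) := by
  rw [← sub_eq_zero, chainAng, ← Finset.sum_sub_distrib, ← hz fun v => ang x (c v) (h v)]
  refine Finset.sum_congr rfl fun e _ => ?_
  obtain ⟨A, hA⟩ := ang_potential (hx _ _ (hqs e))
  have hS : ∀ y ∈ C (s e), y ∈ Metric.ball (q e) (2 * δ) := fun y hy =>
    Metric.mem_ball.mpr ((hdiam _ _ hy _ (hqs e)).trans_lt (by linarith))
  have hT : ∀ y ∈ C (t e), y ∈ Metric.ball (q e) (2 * δ) := fun y hy =>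
    Metric.mem_ball.mpr ((hdiam _ _ hy _ (hqt e)).trans_lt (by linarith))
  rw [hA _ (hS _ (hh _)) _ (hS _ (hqs e)), hA _ (hT _ (hqt e)) _ (hT _ (hh _)),
    hA _ (hS _ (hc _)) _ (hT _ (hc _)), hA _ (hT _ (hc _)) _ (hT _ (hh _)),
    hA _ (hS _ (hc _)) _ (hS _ (hh _))]
  ring

theorem chainAng_eq_zero (hz : IsCirculation s t z) {B : ℝ} (hh : ∀ k, h k ∈ Metric.ball 0 B)
    (hq : ∀ e, q e ∈ Metric.ball 0 B) {x : ℂ} (hx : x ∉ Metric.ball 0 B) :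
    chainAng s t h q z x = 0 := by
  obtain ⟨A, hA⟩ := ang_potential hx
  rw [chainAng, ← hz fun v => A (h v)]
  refine Finset.sum_congr rfl fun e _ => ?_
  rw [hA _ (hh _) _ (hq e), hA _ (hq e) _ (hh _)]
  ring

end chainAng

/-- Decodes a vector of total angles: the label `i` is the one whose angle is a full turn. -/
noncomputable def labelOf {ι : Type} [DecidableEq ι] (u : ι → ℝ) : Option ι :=
  open Classical in if h : ∃ i, u = Pi.single i (2 * Real.pi) then some h.choose else none

theorem labelOf_single {ι : Type} [DecidableEq ι] (i : ι) :
    labelOf (Pi.single i (2 * Real.pi)) = some i := by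
  have h : ∃ j, Pi.single (M := fun _ : ι => ℝ) i (2 * Real.pi) = Pi.single j (2 * Real.pi) :=
    ⟨i, rfl⟩
  rw [labelOf, dif_pos h]
  by_contra hne
  have h1 := congrFun h.choose_spec i
  rw [Pi.single_eq_same, Pi.single_eq_of_ne (fun h2 => hne (congrArg some h2.symm))] at h1
  exact Real.two_pi_pos.ne' h1

theorem labelOf_zero {ι : Type} [DecidableEq ι] : labelOf (0 : ι → ℝ) = none := by
  rw [labelOf, dif_neg]
  rintro ⟨i, hi⟩
  have h1 := congrFun hi i
  rw [Pi.single_eq_same, Pi.zero_apply] at h1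
  exact Real.two_pi_pos.ne h1

theorem exists_gridCenter_near {η : ℝ} (hη : 0 < η) (z : ℂ) :
    ∃ p : ℤ × ℤ, dist (gridCenter η p) z ≤ 2 * η ∧ dist (gridPt η p) z ≤ 2 * η := by
  have hk : ∀ a : ℝ, 0 ≤ a - η * ⌊a / η⌋ ∧ a - η * ⌊a / η⌋ ≤ η := by
    intro a
    have h1 := Int.floor_le (a / η)
    have h2 := (Int.lt_floor_add_one (a / η)).le
    rw [le_div_iff₀' hη] at h1
    rw [div_le_iff₀' hη] at h2
    constructor <;> linarith
  refine ⟨(⌊z.re / η⌋, ⌊z.im / η⌋), ?_, ?_⟩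
  · rw [dist_eq_norm]
    refine (Complex.norm_le_abs_re_add_abs_im _).trans ?_
    have h1 := hk z.re
    have h2 := hk z.im
    have e1 : |(gridCenter η (⌊z.re / η⌋, ⌊z.im / η⌋) - z).re| ≤ η := by
      simp only [gridCenter, Complex.sub_re]
      rw [abs_le]
      constructor <;> nlinarith
    have e2 : |(gridCenter η (⌊z.re / η⌋, ⌊z.im / η⌋) - z).im| ≤ η := by
      simp only [gridCenter, Complex.sub_im]
      rw [abs_le]
      constructor <;> nlinarith
    linarith
  · rw [dist_eq_norm]
    refine (Complex.norm_le_abs_re_add_abs_im _).trans ?_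
    have h1 := hk z.re
    have h2 := hk z.im
    have e1 : |(gridPt η (⌊z.re / η⌋, ⌊z.im / η⌋) - z).re| ≤ η := by
      simp only [gridPt, Complex.sub_re]
      rw [abs_le]
      constructor <;> nlinarith
    have e2 : |(gridPt η (⌊z.re / η⌋, ⌊z.im / η⌋) - z).im| ≤ η := by
      simp only [gridPt, Complex.sub_im]
      rw [abs_le]
      constructor <;> nlinarith
    linarith

theorem exists_segments {ι X : Type} [Fintype ι] [DecidableEq ι] [Fintype X] {R : ι → Set ℂ}
    (hR : ∀ i, Bornology.IsBounded (R i)) (hdisj : Pairwise (Function.onFun Disjoint R))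
    {Λ : ℝ} (hΛ : MeasureTheory.Measure.hausdorffMeasure 1 (⋃ i, frontier (R i)) <
      ENNReal.ofReal Λ) {c : X → ℂ} {r : X → ℝ} (hr : ∀ x, 0 < r x) (ix : X → ι)
    (hball : ∀ x, Metric.ball (c x) (2 * r x) ⊆ R (ix x)) {ε : ℝ} (hε : 0 < ε) :
    ∃ (S : Type) (_ : Fintype S) (a b : S → ℂ) (lab : ℂ → Option ι) (B : ℝ),
      (∀ C, Convex ℝ C → (∀ s, Disjoint C (segment ℝ (a s) (b s))) →
        ∀ x ∈ C, ∀ y ∈ C, lab x = lab y) ∧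
      (∀ z, B ≤ ‖z‖ → lab z = none) ∧ ∑ s, ‖b s - a s‖ ≤ Λ + ε ∧
      ∀ x, Metric.ball (c x) (r x) ⊆ {z | lab z = some (ix x)} := by
  classical
  set G : Set ℂ := ⋃ i, frontier (R i) with hGdef
  have hG : IsCompact G := isCompact_iUnion fun i =>
    (hR i).isCompact_closure.of_isClosed_subset isClosed_frontier frontier_subset_closure
  -- the balls stay away from `G`
  have hfar : ∀ x, ∀ g ∈ G, g ∉ Metric.ball (c x) (2 * r x) := by
    intro x g hg hgb
    obtain ⟨i, hi⟩ := Set.mem_iUnion.mp hg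
    by_cases h : i = ix x
    · subst h
      exact hi.2 (interior_maximal (hball x) Metric.isOpen_ball hgb)
    · obtain ⟨y, hy1, hy2⟩ := mem_closure_iff.mp hi.1 _ Metric.isOpen_ball hgb
      exact Set.disjoint_left.mp (hdisj h) hy2 (hball x hy1)
  obtain ⟨ρ, hρ, hρr⟩ : ∃ ρ : ℝ, 0 < ρ ∧ ∀ x, ρ ≤ r x := by
    rcases isEmpty_or_nonempty X with hX | hX
    · exact ⟨1, one_pos, fun x => hX.elim x⟩
    · obtain ⟨x, hx⟩ := Finite.exists_min r
      exact ⟨r x, hr x, hx⟩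
  obtain ⟨δ, hδ, hδρ, hδε⟩ : ∃ δ : ℝ, 0 < δ ∧ 4 * δ ≤ ρ ∧ 2 * (Fintype.card X : ℝ) * δ ≤ ε := by
    refine ⟨min (ρ / 4) (ε / (2 * Fintype.card X + 1)), by positivity, ?_, ?_⟩
    · linarith [min_le_left (ρ / 4) (ε / (2 * (Fintype.card X : ℝ) + 1))]
    · have h1 := min_le_right (ρ / 4) (ε / (2 * (Fintype.card X : ℝ) + 1))
      have h2 : (0 : ℝ) ≤ 2 * (Fintype.card X : ℝ) := by positivity
      refine (mul_le_mul_of_nonneg_left h1 h2).trans ?_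
      rw [mul_div_assoc', div_le_iff₀ (by positivity)]
      nlinarith
  obtain ⟨V, C, d, hCo, hGC, hne, hdδ, hd, hdΛ⟩ := exists_open_cover_sum_le hG hΛ hδ
  choose! γ hγ using hne
  obtain ⟨η₀, hη₀, hleb⟩ := lebesgue_number_lemma_of_metric (c := fun k : V => C k) hG
    (fun k => hCo k) (by rwa [Set.iUnion_subtype])
  obtain ⟨η, hη, hη1, hη2⟩ : ∃ η : ℝ, 0 < η ∧ 5 * η ≤ η₀ ∧ 4 * η ≤ ρ :=
    ⟨min (η₀ / 5) (ρ / 4), by positivity, by linarith [min_le_left (η₀ / 5) (ρ / 4)],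
      by linarith [min_le_right (η₀ / 5) (ρ / 4)]⟩
  let E := {p : V × V // (C p.1 ∩ C p.2).Nonempty}
  let s : E → V := fun e => e.1.1
  let t : E → V := fun e => e.1.2
  let C' : V → Set ℂ := fun k => C k
  let γ' : V → ℂ := fun k => γ k
  have hγC : ∀ k, γ' k ∈ C' k := fun k => (hγ k k.2).1
  have hdiam : ∀ k, ∀ p ∈ C' k, ∀ q ∈ C' k, dist p q ≤ δ := fun k p hp q hq =>
    (hd k k.2 p hp q hq).trans (hdδ k k.2)
  choose q hq using fun e : E => e.2
  have hqs : ∀ e, q e ∈ C' (s e) := fun e => (hq e).1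
  have hqt : ∀ e, q e ∈ C' (t e) := fun e => (hq e).2
  have hcirc := fun i => exists_nerve_circulation s t C'
    (fun k l hkl => ⟨⟨(k, l), hkl⟩, rfl, rfl⟩) hγC hδ hdiam (hR i) hη fun g hg =>
      (hleb g (Set.mem_iUnion.mpr ⟨i, hg⟩)).imp fun k hk =>
        (Metric.ball_subset_ball hη1).trans hk
  choose z hz hzang using hcirc
  choose p hpc hpp using fun x => exists_gridCenter_near hη (c x)
  -- the cover stays away from the smaller balls
  have hCfar : ∀ x, ∀ k, ∀ y ∈ C' k, 2 * r x - δ ≤ dist y (c x) := by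
    intro x k y hy
    have h1 := hfar x _ (hγ k k.2).2
    rw [Metric.mem_ball, not_lt] at h1
    have h2 := hdiam k _ (hγC k) _ hy
    linarith [dist_triangle (γ k) y (c x)]
  have hcen : ∀ x, ∀ k, ∀ y ∈ C' k, gridCenter η (p x) ∉ Metric.ball y (2 * δ) := by
    intro x k y hy hmem
    rw [Metric.mem_ball, dist_comm] at hmem
    have h1 := hCfar x k y hy
    linarith [dist_triangle y (gridCenter η (p x)) (c x), hpc x, hρr x]
  have hgrid : ∀ x, gridPt η (p x) ∈ R (ix x) := fun x =>
    hball x (Metric.mem_ball.mpr (by linarith [hpp x, hρr x, hr x]))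
  obtain ⟨S, z', hzS, hz', hzW, hcard, hdeg⟩ := exists_sparse_circulations s t
    (fun e x => ang (gridCenter η (p x)) (γ' (s e)) (γ' (t e)))
    (fun i x => Set.indicator (R i) (fun _ => 2 * Real.pi) (gridPt η (p x))) z hz
    fun i x => hzang i (p x) (hcen x)
  obtain ⟨h, hhC, hlen⟩ := exists_hubs s t C' hγC hqs hqt (d := fun k => d k) hδ.le
    (fun k => hdδ k k.2) (fun k => hd k k.2) hcard hdeg
  obtain ⟨B, hB⟩ : ∃ B : ℝ, ∀ k, C' k ⊆ Metric.ball 0 B := by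
    obtain ⟨B, hB⟩ := (Set.finite_range fun k : V => ‖γ' k‖ + 2 * δ).bddAbove
    refine ⟨B, fun k y hy => ?_⟩
    have h1 : ‖γ' k‖ + 2 * δ ≤ B := hB ⟨k, rfl⟩
    rw [Metric.mem_ball]
    have h2 := hdiam k y hy _ (hγC k)
    have h3 := dist_triangle y (γ' k) 0
    rw [dist_zero_right (γ' k)] at h3
    linarith
  let w : ℂ → ι → ℝ := fun p i => chainAng s t h q (z' i) p
  have hconst : ∀ D : Set ℂ, Convex ℝ D →
      (∀ e ∈ S, Disjoint D (segment ℝ (q e) (h (s e))) ∧ Disjoint D (segment ℝ (q e) (h (t e)))) →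
      ∀ x ∈ D, ∀ y ∈ D, w x = w y := by
    intro D hD hDS x hx y hy
    funext i
    refine chainAng_eq_of_disjoint (hz' i) (fun e he => ?_) fun e he => ?_
    · rw [segment_symm ℝ (h (s e))]
      exact ((hDS e (by_contra fun h => he (hzS i e h))).1.mono_left
        (hD.segment_subset hx hy)).symm
    · exact ((hDS e (by_contra fun h => he (hzS i e h))).2.mono_left
        (hD.segment_subset hx hy)).symm
  refine ⟨S × Bool, inferInstance, fun x => q x.1,
    fun x => bif x.2 then h (t x.1) else h (s x.1), fun p => labelOf (w p), B, ?_, ?_, ?_, ?_⟩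
  · intro D hD hDS x hx y hy
    exact congrArg labelOf (hconst D hD
      (fun e he => ⟨hDS (⟨e, he⟩, false), hDS (⟨e, he⟩, true)⟩) x hx y hy)
  · intro y hy
    have h0 : w y = 0 := funext fun i => chainAng_eq_zero (hz' i) (fun k => hB k (hhC k))
      (fun e => hB _ (hqs e)) (by simpa using hy)
    simp only [h0, labelOf_zero]
  · rw [Fintype.sum_prod_type]
    calc _ = ∑ e ∈ S, (dist (q e) (h (s e)) + dist (q e) (h (t e))) := by
          rw [← Finset.sum_coe_sort S]
          refine Finset.sum_congr rfl fun e _ => ?_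
          simp [dist_eq_norm', add_comm]
      _ ≤ ∑ v ∈ touched s t S, d v + 2 * Fintype.card X * δ := hlen
      _ ≤ ∑ v : V, d v + ε := by
          refine add_le_add (Finset.sum_le_sum_of_subset_of_nonneg (Finset.subset_univ _) ?_) hδε
          intro k _ _
          simpa using hd k k.2 _ (hγC k) _ (hγC k)
      _ ≤ Λ + ε := by
          have : ∑ v : V, d v = ∑ k ∈ V, d k := Finset.sum_coe_sort V d
          linarith
  · intro x y hy
    have hDS : ∀ e k, q e ∈ C' k →
        Disjoint (Metric.ball (c x) (r x)) (segment ℝ (q e) (h k)) := by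
      intro e k hqk
      rw [Set.disjoint_left]
      intro y hy hys
      have h1 := (convex_closedBall (q e) δ).segment_subset (Metric.mem_closedBall_self hδ.le)
        (Metric.mem_closedBall.mpr (hdiam k _ (hhC k) _ hqk)) hys
      rw [Metric.mem_closedBall, dist_comm] at h1
      rw [Metric.mem_ball] at hy
      linarith [hCfar x k _ hqk, dist_triangle (q e) y (c x), hρr x]
    have hcx : gridCenter η (p x) ∈ Metric.ball (c x) (r x) :=
      Metric.mem_ball.mpr (by linarith [hpc x, hρr x])
    have h1 : w y = Pi.single (ix x) (2 * Real.pi) := by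
      rw [hconst _ (convex_ball (c x) (r x))
        (fun e _ => ⟨hDS e _ (hqs e), hDS e _ (hqt e)⟩) y hy _ hcx]
      funext i
      refine (chainAng_eq_of_notMem_ball (hz' i) hγC hhC hqs hqt hδ hdiam (hcen x)).trans ?_
      refine (hzW i x).trans ?_
      by_cases hi : i = ix x
      · subst hi
        rw [Pi.single_eq_same, Set.indicator_of_mem (hgrid x)]
      · rw [Pi.single_eq_of_ne hi, Set.indicator_of_notMem]
        exact fun h2 => Set.disjoint_left.mp (hdisj hi) h2 (hgrid x)
    change labelOf (w y) = some (ix x)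
    rw [h1, labelOf_single]

/-! ### The honeycomb inequality for regions with boundary of finite length -/

theorem volume_eq_zero_of_hausdorffMeasure_lt_top {G : Set ℂ}
    (hG : MeasureTheory.Measure.hausdorffMeasure 1 G < ⊤) : MeasureTheory.volume G = 0 := by
  have hL : LipschitzWith 1 Complex.measurableEquivRealProd := LipschitzWith.of_dist_le_mul fun x y => by
    rw [NNReal.coe_one, one_mul, Prod.dist_eq]
    simp only [Complex.measurableEquivRealProd_apply, Real.dist_eq, ← Complex.sub_re,
      ← Complex.sub_im, Complex.dist_eq]
    exact max_le (Complex.abs_re_le_norm _) (Complex.abs_im_le_norm _)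
  have h1 : MeasureTheory.Measure.hausdorffMeasure 1 (Complex.measurableEquivRealProd '' G) < ⊤ := by
    refine (hL.hausdorffMeasure_image_le zero_le_one G).trans_lt ?_
    simpa using hG
  have h2 := (MeasureTheory.Measure.hausdorffMeasure_zero_or_top (d₁ := 1) (d₂ := 2) one_lt_two
    (Complex.measurableEquivRealProd '' G)).resolve_right h1.ne
  rw [MeasureTheory.hausdorffMeasure_prod_real] at h2
  rw [← Complex.volume_preserving_equiv_real_prod.measure_preimage_equiv,
    Complex.measurableEquivRealProd.injective.preimage_image] at h2
  exact h2

theorem IsCompact.exists_finset_balls {K U : Set ℂ} (hK : IsCompact K) (hU : IsOpen U)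
    (hKU : K ⊆ U) : ∃ (T : Finset ℂ) (r : ℂ → ℝ), (∀ x ∈ T, 0 < r x) ∧
      (∀ x ∈ T, Metric.ball x (2 * r x) ⊆ U) ∧ K ⊆ ⋃ x ∈ T, Metric.ball x (r x) := by
  have h : ∀ x ∈ K, ∃ r : ℝ, 0 < r ∧ Metric.ball x (2 * r) ⊆ U := by
    intro x hx
    obtain ⟨r, hr, hrU⟩ := Metric.isOpen_iff.mp hU x (hKU hx)
    exact ⟨r / 2, half_pos hr, by rwa [mul_div_cancel₀ r two_ne_zero]⟩
  choose! r hr hrU using h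
  obtain ⟨T, hTK, hT⟩ := hK.elim_nhds_subcover (fun x => Metric.ball x (r x))
    fun x hx => Metric.ball_mem_nhds x (hr x hx)
  exact ⟨T, r, fun x hx => hr x (hTK x hx), fun x hx => hrU x (hTK x hx), hT⟩

theorem hausdorffMeasure_frontier_ge_of_compact {ι : Type} [Fintype ι] {R : ι → Set ℂ}
    (hR : ∀ i, Bornology.IsBounded (R i)) (hdisj : Pairwise (Function.onFun Disjoint R))
    (hfin : MeasureTheory.Measure.hausdorffMeasure 1 (⋃ i, frontier (R i)) < ⊤)
    {K : ι → Set ℂ} (hK : ∀ i, IsCompact (K i)) (hKR : ∀ i, K i ⊆ interior (R i)) :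
    hexK * ∑ i, min 1 (MeasureTheory.volume (K i)).toReal +
        √(4 * Real.pi * ∑ i, (MeasureTheory.volume (K i)).toReal) / 200 ≤
      (MeasureTheory.Measure.hausdorffMeasure 1 (⋃ i, frontier (R i))).toReal := by
  classical
  refine le_of_forall_pos_le_add fun ε hε => ?_
  set M := (MeasureTheory.Measure.hausdorffMeasure 1 (⋃ i, frontier (R i))).toReal with hM
  have hΛ : MeasureTheory.Measure.hausdorffMeasure 1 (⋃ i, frontier (R i)) <
      ENNReal.ofReal (M + ε / 2) := by
    rw [ENNReal.lt_ofReal_iff_toReal_lt hfin.ne]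
    linarith
  choose T r hr hrR hKT using fun i => (hK i).exists_finset_balls isOpen_interior (hKR i)
  obtain ⟨S, _, a, b, lab, B, hconst, hB, hlen, hball⟩ := exists_segments
    (X := Σ i, T i) hR hdisj hΛ (c := fun x => x.2) (r := fun x => r x.1 x.2)
    (fun x => hr x.1 x.2 x.2.2) (fun x => x.1)
    (fun x => (hrR x.1 x.2 x.2.2).trans interior_subset) (half_pos hε)
  obtain ⟨L, hL0, hL, hseg⟩ := segments_length_ge a b lab hconst hB
  have hle : ∀ i, (MeasureTheory.volume (K i)).toReal ≤
      (MeasureTheory.volume {z | lab z = some i}).toReal := by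
    intro i
    refine ENNReal.toReal_mono (ne_top_of_le_ne_top
      (Metric.isBounded_closedBall (x := (0 : ℂ)) (r := B)).measure_lt_top.ne
      (MeasureTheory.measure_mono fun z hz => ?_)) (MeasureTheory.measure_mono fun z hz => ?_)
    · rw [mem_closedBall_zero_iff]
      by_contra h
      have hz' : lab z = some i := hz
      rw [hB z (not_le.mp h).le] at hz'
      exact Option.some_ne_none i hz'.symm
    · obtain ⟨x, hx, hzx⟩ := Set.mem_iUnion₂.mp (hKT i hz)
      exact hball ⟨i, x, hx⟩ hzx
  have h1 : ∑ i, min 1 (MeasureTheory.volume (K i)).toReal ≤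
      ∑ i, min 1 (MeasureTheory.volume {z | lab z = some i}).toReal :=
    Finset.sum_le_sum fun i _ => min_le_min_left 1 (hle i)
  have h2 : √(4 * Real.pi * ∑ i, (MeasureTheory.volume (K i)).toReal) ≤ L := by
    refine Real.sqrt_le_iff.mpr ⟨hL0, (mul_le_mul_of_nonneg_left
      (Finset.sum_le_sum fun i _ => hle i) (by positivity)).trans hL⟩
  have h3 := mul_le_mul_of_nonneg_left h1 hexK_pos.le
  linarith

theorem hausdorffMeasure_frontier_ge {ι : Type} [Fintype ι] {R : ι → Set ℂ}
    (hR : ∀ i, Bornology.IsBounded (R i)) (hdisj : Pairwise (Function.onFun Disjoint R))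
    (hfin : MeasureTheory.Measure.hausdorffMeasure 1 (⋃ i, frontier (R i)) < ⊤) :
    hexK * ∑ i, min 1 (MeasureTheory.volume (R i)).toReal +
        √(4 * Real.pi * ∑ i, (MeasureTheory.volume (R i)).toReal) / 200 ≤
      (MeasureTheory.Measure.hausdorffMeasure 1 (⋃ i, frontier (R i))).toReal := by
  have hvol : ∀ i, MeasureTheory.volume (interior (R i)) = MeasureTheory.volume (R i) := by
    intro i
    refine le_antisymm (MeasureTheory.measure_mono interior_subset) ?_
    have h0 : MeasureTheory.volume (frontier (R i)) = 0 :=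
      volume_eq_zero_of_hausdorffMeasure_lt_top ((MeasureTheory.measure_mono
        (Set.subset_iUnion (fun i => frontier (R i)) i)).trans_lt hfin)
    have h1 : R i ⊆ interior (R i) ∪ frontier (R i) := by
      rw [← closure_eq_interior_union_frontier]
      exact subset_closure
    refine (MeasureTheory.measure_mono h1).trans ((MeasureTheory.measure_union_le _ _).trans ?_)
    rw [h0, add_zero]
  have hex : ∀ (n : ℕ) (i : ι), ∃ K ⊆ interior (R i), IsCompact K ∧
      MeasureTheory.volume (R i) < MeasureTheory.volume K + ENNReal.ofReal (1 / (n + 1)) := by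
    intro n i
    obtain ⟨K, h1, h2, h3⟩ := isOpen_interior.measurableSet.exists_isCompact_lt_add
      (((hR i).subset interior_subset).measure_lt_top (μ := MeasureTheory.volume)).ne
      (ε := ENNReal.ofReal (1 / (n + 1))) (by simpa using Nat.cast_add_one_pos n)
    exact ⟨K, h1, h2, hvol i ▸ h3⟩
  choose K hKR hK hKlt using hex
  have hlim : ∀ i, Filter.Tendsto (fun n => (MeasureTheory.volume (K n i)).toReal) Filter.atTop
      (nhds (MeasureTheory.volume (R i)).toReal) := by
    intro i
    have hRtop := ((hR i).measure_lt_top (μ := MeasureTheory.volume)).ne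
    have hle : ∀ n, MeasureTheory.volume (K n i) ≤ MeasureTheory.volume (R i) := fun n =>
      MeasureTheory.measure_mono ((hKR n i).trans interior_subset)
    refine tendsto_of_tendsto_of_tendsto_of_le_of_le (b := Filter.atTop)
      (g := fun n : ℕ => (MeasureTheory.volume (R i)).toReal - 1 / ((n : ℝ) + 1)) ?_
      tendsto_const_nhds (fun n => ?_) (fun n => ENNReal.toReal_mono hRtop (hle n))
    · simpa using (tendsto_one_div_add_atTop_nhds_zero_nat (𝕜 := ℝ)).const_sub
        (MeasureTheory.volume (R i)).toReal
    · have h1 := ENNReal.toReal_mono (ENNReal.add_ne_top.mpr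
        ⟨ne_top_of_le_ne_top hRtop (hle n), ENNReal.ofReal_ne_top⟩) (hKlt n i).le
      rw [ENNReal.toReal_add (ne_top_of_le_ne_top hRtop (hle n)) ENNReal.ofReal_ne_top,
        ENNReal.toReal_ofReal (by positivity)] at h1
      simp only
      linarith
  have hsum : Filter.Tendsto (fun n => hexK * ∑ i, min 1 (MeasureTheory.volume (K n i)).toReal +
      √(4 * Real.pi * ∑ i, (MeasureTheory.volume (K n i)).toReal) / 200) Filter.atTop
      (nhds (hexK * ∑ i, min 1 (MeasureTheory.volume (R i)).toReal +
        √(4 * Real.pi * ∑ i, (MeasureTheory.volume (R i)).toReal) / 200)) :=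
    ((tendsto_finsetSum _ fun i _ => tendsto_const_nhds.min (hlim i)).const_mul _).add
      (((tendsto_finsetSum _ fun i _ => hlim i).const_mul _).sqrt.div_const _)
  exact le_of_tendsto' hsum fun n =>
    hausdorffMeasure_frontier_ge_of_compact hR hdisj hfin (hK n) (hKR n)

theorem hausdorffMeasure_iUnion_frontier_gt {R : ℕ → Set ℂ} {K : Set ℂ} (hK : IsCompact K)
    (hRK : ∀ i, R i ⊆ K) (hmeas : ∀ i, MeasurableSet (R i))
    (hdisj : Pairwise (Function.onFun Disjoint R)) (hpos : ∃ i, 0 < MeasureTheory.volume (R i)) :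
    ENNReal.ofReal hexK * ∑' i, min 1 (MeasureTheory.volume (R i)) <
      MeasureTheory.Measure.hausdorffMeasure 1 (⋃ i, frontier (R i)) := by
  have hRb : ∀ i, Bornology.IsBounded (R i) := fun i => hK.isBounded.subset (hRK i)
  rcases eq_top_or_lt_top (MeasureTheory.Measure.hausdorffMeasure 1 (⋃ i, frontier (R i)))
    with htop | hfin
  · rw [htop]
    refine ENNReal.mul_lt_top ENNReal.ofReal_lt_top ?_
    calc _ ≤ ∑' i, MeasureTheory.volume (R i) := ENNReal.tsum_le_tsum fun i => min_le_right _ _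
      _ = MeasureTheory.volume (⋃ i, R i) := (MeasureTheory.measure_iUnion hdisj hmeas).symm
      _ ≤ MeasureTheory.volume K := MeasureTheory.measure_mono (Set.iUnion_subset hRK)
      _ < ⊤ := hK.measure_lt_top
  obtain ⟨k, hk⟩ := hpos
  have htop : ∀ i, MeasureTheory.volume (R i) ≠ ⊤ := fun i => (hRb i).measure_lt_top.ne
  set σ : ℝ := √(4 * Real.pi * (MeasureTheory.volume (R k)).toReal) / 200 with hσ
  have hσ0 : 0 < σ := by
    have := ENNReal.toReal_pos hk.ne' (htop k)
    positivity
  have hpart : ∀ n, ENNReal.ofReal hexK * ∑ i ∈ Finset.range n,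
      min 1 (MeasureTheory.volume (R i)) ≤
        MeasureTheory.Measure.hausdorffMeasure 1 (⋃ i, frontier (R i)) - ENNReal.ofReal σ := by
    intro n
    set N := n + (k + 1)
    have hsub : (⋃ i : Fin N, frontier (R i)) ⊆ ⋃ i, frontier (R i) :=
      Set.iUnion_subset fun i => Set.subset_iUnion (fun i => frontier (R i)) i
    have hmono := MeasureTheory.measure_mono (μ := MeasureTheory.Measure.hausdorffMeasure 1) hsub
    have h1 := hausdorffMeasure_frontier_ge (R := fun i : Fin N => R i) (fun i => hRb i)
      (fun i j hij => hdisj (Fin.val_injective.ne hij)) (hmono.trans_lt hfin)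
    have h2 : σ ≤ √(4 * Real.pi * ∑ i : Fin N, (MeasureTheory.volume (R i)).toReal) / 200 := by
      rw [hσ]
      gcongr
      exact Finset.single_le_sum (f := fun i : Fin N => (MeasureTheory.volume (R i)).toReal)
        (fun i _ => ENNReal.toReal_nonneg) (Finset.mem_univ (⟨k, by omega⟩ : Fin N))
    have h3 := ENNReal.toReal_mono hfin.ne hmono
    have h4 : ∑ i ∈ Finset.range n, min 1 (MeasureTheory.volume (R i)) ≤
        ENNReal.ofReal (∑ i : Fin N, min 1 (MeasureTheory.volume (R i)).toReal) := by
      rw [ENNReal.ofReal_sum_of_nonneg fun i _ => le_min zero_le_one ENNReal.toReal_nonneg]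
      refine (Finset.sum_le_sum_of_subset (Finset.range_subset_range.mpr
        (Nat.le_add_right n (k + 1)))).trans (le_of_eq ?_)
      rw [Finset.sum_range]
      refine Finset.sum_congr rfl fun i _ => ?_
      rw [ENNReal.ofReal_min, ENNReal.ofReal_one, ENNReal.ofReal_toReal (htop i)]
    refine ENNReal.le_sub_of_add_le_right ENNReal.ofReal_ne_top ?_
    rw [← ENNReal.ofReal_toReal hfin.ne]
    refine (add_le_add_left (mul_le_mul_right h4 _) _).trans ?_
    rw [← ENNReal.ofReal_mul hexK_pos.le, ← ENNReal.ofReal_add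
      (mul_nonneg hexK_pos.le (Finset.sum_nonneg fun i _ => le_min zero_le_one
        ENNReal.toReal_nonneg)) hσ0.le]
    exact ENNReal.ofReal_le_ofReal (by linarith)
  have h5 : ENNReal.ofReal hexK * ∑' i, min 1 (MeasureTheory.volume (R i)) ≤
      MeasureTheory.Measure.hausdorffMeasure 1 (⋃ i, frontier (R i)) - ENNReal.ofReal σ := by
    rw [← ENNReal.tsum_mul_left]
    refine ENNReal.tsum_le_of_sum_range_le fun n => ?_
    rw [← Finset.mul_sum]
    exact hpart n
  refine h5.trans_lt (ENNReal.sub_lt_self hfin.ne ?_ (ENNReal.ofReal_pos.mpr hσ0).ne')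
  intro h0
  rw [h0] at h5
  simp only [zero_tsub, nonpos_iff_eq_zero, mul_eq_zero, ENNReal.ofReal_eq_zero,
    ENNReal.tsum_eq_zero] at h5
  rcases h5 with h5 | h5
  · exact h5.not_gt hexK_pos
  · exact (lt_min one_pos hk).ne' (h5 k)

open MeasureTheory Set ENNReal

theorem honeycomb_conjecture_disconnected_regions
    (K : Set (EuclideanSpace ℝ (Fin 2))) (hK : IsCompact K)
    (R : ℕ → Set (EuclideanSpace ℝ (Fin 2)))
    (hRK : ∀ i, R i ⊆ K)
    (hmeas : ∀ i, MeasurableSet (R i))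
    (hdisj : Pairwise (Function.onFun Disjoint R))
    (hbd : ∀ i, μH[1] (frontier (R i)) < ⊤)
    (α : ℕ → ℝ≥0∞) (hα : ∀ i, α i = min 1 (volume (R i)))
    (Γ : Set (EuclideanSpace ℝ (Fin 2))) (hΓ : Γ = ⋃ i, frontier (R i))
    (hpos : ∃ i, 0 < α i) :
    μH[1] Γ > ENNReal.ofReal ((12 : ℝ) ^ ((1 : ℝ) / 4)) * ∑' i, α i := by
  let e : ℂ ≃ₗᵢ[ℝ] EuclideanSpace ℝ (Fin 2) := Complex.orthonormalBasisOneI.repr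
  have hvol : ∀ i, volume (e ⁻¹' R i) = volume (R i) := fun i =>
    e.measurePreserving.measure_preimage (hmeas i).nullMeasurableSet
  have hfr : ⋃ i, frontier (e ⁻¹' R i) = e ⁻¹' Γ := by
    rw [hΓ, preimage_iUnion]
    exact iUnion_congr fun i => (e.toHomeomorph.preimage_frontier (R i)).symm
  have hH : μH[1] (e ⁻¹' Γ) = μH[1] Γ := e.toIsometryEquiv.hausdorffMeasure_preimage 1 Γ
  obtain ⟨k, hk⟩ := hpos
  have key := hausdorffMeasure_iUnion_frontier_gt (R := fun i => e ⁻¹' R i)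
    (e.toHomeomorph.isCompact_preimage.mpr hK) (fun i => preimage_mono (hRK i))
    (fun i => e.continuous.measurable (hmeas i)) (fun i j hij => (hdisj hij).preimage e)
    ⟨k, by rw [hvol]; rw [hα] at hk; exact (lt_min_iff.mp hk).2⟩
  rw [hfr, hH] at key
  simp only [hvol, ← hα] at key
  exact key
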